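/- Let ψ : S³₊ → ℝ and φ : B³ → ℝ be restrictions of smooth functions defined on open neighborhoods (in ℝ⁴) of S³₊ and B³ respectively, and suppose that at every point p ∈ Σ one has ν_M ψ(p) = π/4 and ν_N φ(p) − φ(p) = π/4. Then there exists ω : B⁴₊ → ℝ of class C³ up to the boundary of the closed half-ball (all partial derivatives of order ≤ 3 extend continuously to B⁴₊) such that: ω is constant on Σ; Δ²ω = 0 in the interior of B⁴₊; (1/2)μ_M(Δω) + Δ_{S³}(μ_M ω) − Δ_{S³}(ω|_M) = −2 at every point of M \ Σ; (1/2)μ_N(Δω) + Δ_{ℝ³}(μ_N ω) = 0 at every point of N \ Σ; ν_M(μ_M ω) + ν_N(μ_N ω) − ν_M(ω|_M) = π/2 at every point of Σ; μ_M ω = ψ on M; and μ_N ω = φ on N. Moreover, subject to the additional condition ω|_Σ = 0, such ω is unique. -/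

import Mathlib

noncomputable section

open Real Set
open scoped RealInnerProductSpace Topology

abbrev E4 := EuclideanSpace ℝ (Fin 4)

def e4 (i : Fin 4) : E4 := EuclideanSpace.single i 1

/-- Euclidean Laplacian on `ℝ⁴`. -/
def lap (u : E4 → ℝ) (x : E4) : ℝ :=
  ∑ i : Fin 4, fderiv ℝ (fun y => fderiv ℝ u y (e4 i)) x (e4 i)

/-- Laplacian in the first three variables. -/
def lap3 (u : E4 → ℝ) (x : E4) : ℝ :=
  ∑ i : Fin 3, fderiv ℝ (fun y => fderiv ℝ u y (e4 i.castSucc)) x (e4 i.castSucc)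

/-- Spherical Laplacian of (the restriction to `S³` of) `f`, via the `0`-homogeneous
extension `y ↦ f (y / ‖y‖)`. -/
def sphLap (f : E4 → ℝ) (x : E4) : ℝ := lap (fun y => f (‖y‖⁻¹ • y)) x

/-- Inward normal derivative at a point of the unit sphere: `μ_M u x = -⟨∇u x, x⟩`. -/
def muM (u : E4 → ℝ) (x : E4) : ℝ := -(fderiv ℝ u x x)

/-- Inward normal derivative at a point of the flat boundary `B³ ⊂ {x₄ = 0}`. -/
def muN (u : E4 → ℝ) (x : E4) : ℝ := fderiv ℝ u x (e4 3)

/-- At `p ∈ Σ`, `ν_M f p = -(d/dφ)|_{φ = π/2} f(sin φ • σ, cos φ)`. -/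
def nuM (f : E4 → ℝ) (p : E4) : ℝ :=
  -(deriv (fun t : ℝ => f (Real.sin t • p + Real.cos t • e4 3)) (π/2))

/-- At `p ∈ Σ`, `ν_N f p = -(d/dr)|_{r = 1} f (r • p)`. -/
def nuN (f : E4 → ℝ) (p : E4) : ℝ := -(deriv (fun r : ℝ => f (r • p)) 1)

/-- The closed upper half-ball `B⁴₊`. -/
def B4p : Set E4 := {x | ‖x‖ ≤ 1 ∧ 0 ≤ x 3}
/-- The upper half-sphere `M = S³₊`. -/
def Mhs : Set E4 := {x | ‖x‖ = 1 ∧ 0 ≤ x 3}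
/-- The flat boundary `N = B³`. -/
def Nfb : Set E4 := {x | ‖x‖ ≤ 1 ∧ x 3 = 0}
/-- The corner `Σ = S²`. -/
def Sig : Set E4 := {x | ‖x‖ = 1 ∧ x 3 = 0}

/-- `P₃^M u = (1/2) μ_M (Δu) + Δ_{S³}(μ_M u) - Δ_{S³}(u|_M)`. -/
def P3M (u : E4 → ℝ) (x : E4) : ℝ :=
  (1/2) * muM (lap u) x + sphLap (muM u) x - sphLap u x

/-- `P₃^N u = (1/2) μ_N (Δu) + Δ_{ℝ³}(μ_N u)`. -/
def P3N (u : E4 → ℝ) (x : E4) : ℝ :=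
  (1/2) * muN (lap u) x + lap3 (muN u) x

/-- The boundary value problem of Theorem A:  `ω` is `C³` up to the boundary of the closed
half-ball (encoded, via Whitney extension, as `ω` being globally `C³`), four times
differentiable in the interior where it is biharmonic, constant along the corner `Σ`,
`P₃^M ω = -2` on `M`, `P₃^N ω = 0` on `N`, the corner condition
`ν_M(μ_M ω) + ν_N(μ_N ω) - ν_M(ω|_M) = π/2` holds along `Σ`, and the prescribed inward
normal derivatives are `μ_M ω = ψ` on `M` and `μ_N ω = φ` on `N`. -/
def SolHB (ψ φ ω : E4 → ℝ) : Prop :=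
  ContDiff ℝ 3 ω ∧
  ContDiffOn ℝ 4 ω {x : E4 | ‖x‖ < 1 ∧ 0 < x 3} ∧
  (∃ c : ℝ, ∀ p ∈ Sig, ω p = c) ∧
  (∀ x : E4, ‖x‖ < 1 → 0 < x 3 → lap (lap ω) x = 0) ∧
  (∀ x ∈ Mhs \ Sig, P3M ω x = -2) ∧
  (∀ x ∈ Nfb \ Sig, P3N ω x = 0) ∧
  (∀ p ∈ Sig, nuM (muM ω) p + nuN (muN ω) p - nuM ω p = π/2) ∧
  (∀ x ∈ Mhs, muM ω x = ψ x) ∧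
  (∀ x ∈ Nfb, muN ω x = φ x)

/-! ### Partial derivatives -/

/-- The `i`-th partial derivative. -/
def pd (i : Fin 4) (u : E4 → ℝ) (x : E4) : ℝ := fderiv ℝ u x (e4 i)

/-- The radial (Euler) derivative `x · ∇u`. -/
def Dr (u : E4 → ℝ) (x : E4) : ℝ := fderiv ℝ u x x

theorem lap_eq (u : E4 → ℝ) (x : E4) : lap u x = ∑ i, pd i (pd i u) x := rfl

theorem lap3_eq (u : E4 → ℝ) (x : E4) :
    lap3 u x = ∑ i : Fin 3, pd i.castSucc (pd i.castSucc u) x := rfl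

theorem muM_eq (u : E4 → ℝ) : muM u = fun x => -Dr u x := rfl

theorem muN_eq (u : E4 → ℝ) : muN u = pd 3 u := rfl

theorem lap_eq_lap3_add (u : E4 → ℝ) (x : E4) : lap u x = lap3 u x + pd 3 (pd 3 u) x := by
  rw [lap_eq, lap3_eq, Fin.sum_univ_castSucc]
  rfl

theorem E4_eq_sum (x : E4) : x = ∑ i, x i • e4 i := by
  ext j
  simp [e4, Finset.sum_apply, Pi.single_apply]

theorem e4_apply (i j : Fin 4) : e4 i j = if j = i then 1 else 0 := by
  simp [e4]

theorem inner_e4 (x : E4) (i : Fin 4) : inner ℝ x (e4 i) = x i := by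
  simp [e4, EuclideanSpace.inner_single_right]

theorem norm_e4 (i : Fin 4) : ‖e4 i‖ = 1 := by simp [e4]

theorem fderiv_eq_sum_pd (u : E4 → ℝ) (x v : E4) : fderiv ℝ u x v = ∑ i, v i * pd i u x := by
  conv_lhs => rw [E4_eq_sum v]
  simp [map_sum, pd]

theorem Dr_eq_sum (u : E4 → ℝ) (x : E4) : Dr u x = ∑ i, x i * pd i u x :=
  fderiv_eq_sum_pd u x x

theorem pd_congr {u v : E4 → ℝ} {x : E4} (h : u =ᶠ[𝓝 x] v) (i : Fin 4) :
    pd i u =ᶠ[𝓝 x] pd i v := by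
  filter_upwards [h.fderiv (𝕜 := ℝ)] with y hy
  simp only [pd, hy]

theorem Dr_congr {u v : E4 → ℝ} {x : E4} (h : u =ᶠ[𝓝 x] v) : Dr u =ᶠ[𝓝 x] Dr v := by
  filter_upwards [h.fderiv (𝕜 := ℝ)] with y hy
  simp only [Dr, hy]

theorem lap_congr {u v : E4 → ℝ} {x : E4} (h : u =ᶠ[𝓝 x] v) : lap u =ᶠ[𝓝 x] lap v := by
  have h2 : ∀ i, pd i (pd i u) =ᶠ[𝓝 x] pd i (pd i v) := fun i => pd_congr (pd_congr h i) i
  filter_upwards [Filter.eventually_all.2 h2] with y hy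
  simp only [lap_eq, hy]

theorem lap3_congr {u v : E4 → ℝ} {x : E4} (h : u =ᶠ[𝓝 x] v) : lap3 u =ᶠ[𝓝 x] lap3 v := by
  have h2 : ∀ i, pd i (pd i u) =ᶠ[𝓝 x] pd i (pd i v) := fun i => pd_congr (pd_congr h i) i
  filter_upwards [Filter.eventually_all.2 h2] with y hy
  simp only [lap3_eq, hy]

theorem ContDiffAt.pd {n m : WithTop ℕ∞} {u : E4 → ℝ} {x : E4} (h : ContDiffAt ℝ n u x)
    (hm : m + 1 ≤ n) (i : Fin 4) : ContDiffAt ℝ m (pd i u) x :=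
  (h.fderiv_right hm).clm_apply contDiffAt_const

theorem ContDiffAt.Dr {n m : WithTop ℕ∞} {u : E4 → ℝ} {x : E4} (h : ContDiffAt ℝ n u x)
    (hm : m + 1 ≤ n) : ContDiffAt ℝ m (Dr u) x :=
  (h.fderiv_right hm).clm_apply contDiffAt_id

theorem ContDiffAt.lap {n m : WithTop ℕ∞} {u : E4 → ℝ} {x : E4} (h : ContDiffAt ℝ n u x)
    (hm : m + 1 + 1 ≤ n) : ContDiffAt ℝ m (lap u) x := by
  have : ContDiffAt ℝ m (fun y => ∑ i, _root_.pd i (_root_.pd i u) y) x :=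
    ContDiffAt.sum fun i _ => (h.pd hm i).pd le_rfl i
  exact this

theorem ContDiffAt.lap3 {n m : WithTop ℕ∞} {u : E4 → ℝ} {x : E4} (h : ContDiffAt ℝ n u x)
    (hm : m + 1 + 1 ≤ n) : ContDiffAt ℝ m (lap3 u) x := by
  have : ContDiffAt ℝ m
      (fun y => ∑ i : Fin 3, _root_.pd i.castSucc (_root_.pd i.castSucc u) y) x :=
    ContDiffAt.sum fun i _ => (h.pd hm _).pd le_rfl _
  exact this

theorem ContDiffAt.diff {n : WithTop ℕ∞} {u : E4 → ℝ} {x : E4} (h : ContDiffAt ℝ n u x)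
    (hn : 1 ≤ n) : DifferentiableAt ℝ u x :=
  (h.of_le hn).differentiableAt one_ne_zero

theorem pd_add {u v : E4 → ℝ} {x : E4} (hu : DifferentiableAt ℝ u x)
    (hv : DifferentiableAt ℝ v x) (i : Fin 4) :
    pd i (fun y => u y + v y) x = pd i u x + pd i v x := by
  simp [pd, fderiv_fun_add hu hv]

theorem pd_sub {u v : E4 → ℝ} {x : E4} (hu : DifferentiableAt ℝ u x)
    (hv : DifferentiableAt ℝ v x) (i : Fin 4) :
    pd i (fun y => u y - v y) x = pd i u x - pd i v x := by
  simp [pd, fderiv_fun_sub hu hv]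

theorem pd_mul {u v : E4 → ℝ} {x : E4} (hu : DifferentiableAt ℝ u x)
    (hv : DifferentiableAt ℝ v x) (i : Fin 4) :
    pd i (fun y => u y * v y) x = u x * pd i v x + v x * pd i u x := by
  simp [pd, fderiv_fun_mul hu hv]

theorem pd_sum {ι : Type*} {s : Finset ι} {u : ι → E4 → ℝ} {x : E4}
    (hu : ∀ k ∈ s, DifferentiableAt ℝ (u k) x) (i : Fin 4) :
    pd i (fun y => ∑ k ∈ s, u k y) x = ∑ k ∈ s, pd i (u k) x := by
  simp [pd, fderiv_fun_sum hu]

theorem pd_const_mul {u : E4 → ℝ} {x : E4} (c : ℝ) (i : Fin 4) :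
    pd i (fun y => c * u y) x = c * pd i u x := by
  have : (fun y => c * u y) = c • u := rfl
  simp [pd, this, fderiv_const_smul_field]

theorem pd_neg {u : E4 → ℝ} {x : E4} (i : Fin 4) :
    pd i (fun y => -u y) x = -pd i u x := by
  simp [pd, fderiv_fun_neg]

theorem pd_const (c : ℝ) (i : Fin 4) (x : E4) : pd i (fun _ => c) x = 0 := by
  simp [pd]

theorem contDiff_coord {n : WithTop ℕ∞} (j : Fin 4) : ContDiff ℝ n (fun y : E4 => y j) :=
  contDiff_euclidean.1 contDiff_id j

theorem pd_coord (i j : Fin 4) (x : E4) :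
    pd i (fun y : E4 => y j) x = if j = i then 1 else 0 := by
  have : (fun y : E4 => y j) = (EuclideanSpace.proj j : E4 →L[ℝ] ℝ) := by
    ext y; simp
  rw [pd, this, ContinuousLinearMap.fderiv, ← e4_apply]
  simp

theorem pd_norm_sq (i : Fin 4) (x : E4) : pd i (fun y : E4 => ‖y‖ ^ 2) x = 2 * x i := by
  rw [pd, (hasStrictFDerivAt_norm_sq x).hasFDerivAt.fderiv]
  simp [inner_e4]

theorem pd_comm {u : E4 → ℝ} {x : E4} (h : ContDiffAt ℝ 2 u x) (i j : Fin 4) :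
    pd i (pd j u) x = pd j (pd i u) x := by
  have hd : DifferentiableAt ℝ (fderiv ℝ u) x :=
    (h.fderiv_right (m := 1) (by norm_num)).differentiableAt one_ne_zero
  have key : ∀ k l, pd k (pd l u) x = fderiv ℝ (fderiv ℝ u) x (e4 k) (e4 l) := by
    intro k l
    have h1 : HasFDerivAt (pd l u)
        ((ContinuousLinearMap.apply ℝ ℝ (e4 l)).comp (fderiv ℝ (fderiv ℝ u) x)) x :=
      (ContinuousLinearMap.apply ℝ ℝ (e4 l)).hasFDerivAt.comp x hd.hasFDerivAt
    rw [pd, h1.fderiv]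
    simp
  rw [key, key]
  exact (h.isSymmSndFDerivAt (by simp)).eq _ _

theorem Dr_add {u v : E4 → ℝ} {x : E4} (hu : DifferentiableAt ℝ u x)
    (hv : DifferentiableAt ℝ v x) : Dr (fun y => u y + v y) x = Dr u x + Dr v x := by
  simp [Dr, fderiv_fun_add hu hv]

theorem Dr_mul {u v : E4 → ℝ} {x : E4} (hu : DifferentiableAt ℝ u x)
    (hv : DifferentiableAt ℝ v x) :
    Dr (fun y => u y * v y) x = u x * Dr v x + v x * Dr u x := by
  simp [Dr, fderiv_fun_mul hu hv]

theorem Dr_sum {ι : Type*} {s : Finset ι} {u : ι → E4 → ℝ} {x : E4}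
    (hu : ∀ k ∈ s, DifferentiableAt ℝ (u k) x) :
    Dr (fun y => ∑ k ∈ s, u k y) x = ∑ k ∈ s, Dr (u k) x := by
  simp [Dr, fderiv_fun_sum hu]

theorem Dr_const_mul {u : E4 → ℝ} {x : E4} (c : ℝ) :
    Dr (fun y => c * u y) x = c * Dr u x := by
  have : (fun y => c * u y) = c • u := rfl
  simp [Dr, this, fderiv_const_smul_field]

theorem Dr_coord (j : Fin 4) (x : E4) : Dr (fun y : E4 => y j) x = x j := by
  simp [Dr_eq_sum, pd_coord]

theorem norm_sq_eq_sum (x : E4) : ‖x‖ ^ 2 = ∑ i, x i * x i := by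
  rw [EuclideanSpace.real_norm_sq_eq]
  simp [sq]

theorem Dr_norm_sq (x : E4) : Dr (fun y : E4 => ‖y‖ ^ 2) x = 2 * ‖x‖ ^ 2 := by
  rw [Dr_eq_sum, norm_sq_eq_sum, Finset.mul_sum]
  simp only [pd_norm_sq]
  exact Finset.sum_congr rfl fun i _ => by ring

theorem pd_Dr {u : E4 → ℝ} {x : E4} (h : ContDiffAt ℝ 2 u x) (i : Fin 4) :
    pd i (Dr u) x = pd i u x + Dr (pd i u) x := by
  have h1 : ∀ j, DifferentiableAt ℝ (pd j u) x := fun j =>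
    (h.pd (m := 1) (by norm_num) j).diff le_rfl
  have h2 : Dr u = fun y => ∑ j, y j * pd j u y := by
    ext y; exact Dr_eq_sum u y
  have h3 : ∀ j, DifferentiableAt ℝ (fun y : E4 => y j) x := fun j =>
    (contDiff_coord (n := 1) j).contDiffAt.diff le_rfl
  rw [h2, pd_sum fun j _ => (h3 j).fun_mul (h1 j)]
  simp only [pd_mul (h3 _) (h1 _), pd_coord, Finset.sum_add_distrib, mul_ite, mul_one, mul_zero,
    Finset.sum_ite_eq', Finset.mem_univ, if_true, Dr_eq_sum (pd i u) x, pd_comm h i]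
  simp [add_comm]

/-! ### The Laplacian -/

theorem lap_add {u v : E4 → ℝ} {x : E4} (hu : ContDiffAt ℝ 2 u x) (hv : ContDiffAt ℝ 2 v x) :
    lap (fun y => u y + v y) x = lap u x + lap v x := by
  simp only [lap_eq, ← Finset.sum_add_distrib]
  refine Finset.sum_congr rfl fun i _ => ?_
  have : pd i (fun y => u y + v y) =ᶠ[𝓝 x] fun y => pd i u y + pd i v y := by
    filter_upwards [hu.eventually (by simp), hv.eventually (by simp)] with y h1 h2
    exact pd_add (h1.diff (by norm_num)) (h2.diff (by norm_num)) i
  rw [(pd_congr this i).eq_of_nhds]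
  exact pd_add ((hu.pd (m := 1) (by norm_num) i).diff le_rfl)
    ((hv.pd (m := 1) (by norm_num) i).diff le_rfl) i

theorem lap_const_mul {u : E4 → ℝ} {x : E4} (c : ℝ) :
    lap (fun y => c * u y) x = c * lap u x := by
  simp only [lap_eq, Finset.mul_sum]
  refine Finset.sum_congr rfl fun i _ => ?_
  have : pd i (fun y => c * u y) = fun y => c * pd i u y := by
    ext y; exact pd_const_mul c i
  rw [this, pd_const_mul]

theorem pd_pd_mul {u v : E4 → ℝ} {x : E4} (hu : ContDiffAt ℝ 2 u x) (hv : ContDiffAt ℝ 2 v x)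
    (i : Fin 4) :
    pd i (pd i (fun y => u y * v y)) x =
      u x * pd i (pd i v) x + 2 * (pd i u x * pd i v x) + v x * pd i (pd i u) x := by
  have : pd i (fun y => u y * v y) =ᶠ[𝓝 x] fun y => u y * pd i v y + v y * pd i u y := by
    filter_upwards [hu.eventually (by simp), hv.eventually (by simp)] with y h1 h2
    exact pd_mul (h1.diff (by norm_num)) (h2.diff (by norm_num)) i
  have du := hu.diff (by norm_num)
  have dv := hv.diff (by norm_num)
  have du' := (hu.pd (m := 1) (by norm_num) i).diff le_rfl
  have dv' := (hv.pd (m := 1) (by norm_num) i).diff le_rfl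
  rw [(pd_congr this i).eq_of_nhds, pd_add (du.fun_mul dv') (dv.fun_mul du'), pd_mul du dv', pd_mul dv du']
  ring

theorem lap_mul {u v : E4 → ℝ} {x : E4} (hu : ContDiffAt ℝ 2 u x) (hv : ContDiffAt ℝ 2 v x) :
    lap (fun y => u y * v y) x =
      u x * lap v x + 2 * ∑ i, pd i u x * pd i v x + v x * lap u x := by
  simp only [lap_eq, pd_pd_mul hu hv, Finset.sum_add_distrib, Finset.mul_sum]

theorem lap_coord (j : Fin 4) (x : E4) : lap (fun y : E4 => y j) x = 0 := by
  have : ∀ i, pd i (fun y : E4 => y j) = fun _ => if j = i then 1 else 0 := fun i => by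
    ext y; exact pd_coord i j y
  simp [lap_eq, this, pd_const]

theorem lap_norm_sq (x : E4) : lap (fun y : E4 => ‖y‖ ^ 2) x = 8 := by
  have : ∀ i, pd i (fun y : E4 => ‖y‖ ^ 2) = fun y => 2 * y i := fun i => by
    ext y; exact pd_norm_sq i y
  simp [lap_eq, this, pd_const_mul, pd_coord]
  norm_num

theorem lap_const (c : ℝ) (x : E4) : lap (fun _ => c) x = 0 := by
  have : ∀ i, pd i (fun _ => c) = fun _ => 0 := fun i => by ext y; exact pd_const c i y
  simp [lap_eq, this, pd_const]

theorem lap_Dr {u : E4 → ℝ} {x : E4} (h : ContDiffAt ℝ 3 u x) :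
    lap (Dr u) x = Dr (lap u) x + 2 * lap u x := by
  have h2 : ContDiffAt ℝ 2 u x := h.of_le (by norm_num)
  have hi : ∀ i, ContDiffAt ℝ 2 (pd i u) x := fun i => h.pd (by norm_num) i
  have hii : ∀ i, ContDiffAt ℝ 1 (pd i (pd i u)) x := fun i => (hi i).pd (by norm_num) i
  have e1 : ∀ i, pd i (Dr u) =ᶠ[𝓝 x] fun y => pd i u y + Dr (pd i u) y := fun i => by
    filter_upwards [h2.eventually (by simp)] with y hy using pd_Dr hy i
  have e2 : Dr (lap u) x = ∑ i, Dr (pd i (pd i u)) x := by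
    have : lap u = fun y => ∑ i, pd i (pd i u) y := rfl
    rw [this, Dr_sum fun i _ => (hii i).diff le_rfl]
  rw [e2, lap_eq, lap_eq, Finset.mul_sum, ← Finset.sum_add_distrib]
  refine Finset.sum_congr rfl fun i _ => ?_
  rw [(pd_congr (e1 i) i).eq_of_nhds, pd_add ((hi i).diff (by norm_num))
    (((hi i).Dr (m := 1) (by norm_num)).diff le_rfl), pd_Dr (hi i)]
  ring

/-! ### The spherical Laplacian -/

theorem hasFDerivAt_inv_norm {E : Type*} [NormedAddCommGroup E] [InnerProductSpace ℝ E]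
    {x : E} (hx : x ≠ 0) :
    HasFDerivAt (fun y : E => ‖y‖⁻¹) (-(‖x‖⁻¹ ^ 3) • innerSL ℝ x) x := by
  have hx' : ‖x‖ ≠ 0 := norm_ne_zero_iff.2 hx
  have h1 : HasFDerivAt (fun y : E => ‖y‖ ^ 2) (2 • innerSL ℝ x) x :=
    (hasStrictFDerivAt_norm_sq x).hasFDerivAt
  have h2 := (hasDerivAt_inv (Real.sqrt_ne_zero'.2 (by positivity))).comp_hasFDerivAt x
    (h1.sqrt (pow_ne_zero 2 hx'))
  have h3 : (Inv.inv ∘ fun y : E => √(‖y‖ ^ 2)) = fun y => ‖y‖⁻¹ := by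
    ext y; simp
  rw [h3] at h2
  refine h2.congr_fderiv ?_
  rw [Real.sqrt_sq (norm_nonneg x)]
  ext v
  simp
  field_simp

theorem hasFDerivAt_normalize {E : Type*} [NormedAddCommGroup E] [InnerProductSpace ℝ E]
    {x : E} (hx : x ≠ 0) :
    HasFDerivAt (fun y : E => ‖y‖⁻¹ • y) (‖x‖⁻¹ • ContinuousLinearMap.id ℝ E +
      (-(‖x‖⁻¹ ^ 3) • innerSL ℝ x).smulRight x) x := by
  exact (hasFDerivAt_inv_norm hx).fun_smul (hasFDerivAt_id x)

theorem pd_comp_normalize {a : E4 → ℝ} {x : E4} (hx : x ≠ 0)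
    (ha : DifferentiableAt ℝ a (‖x‖⁻¹ • x)) (i : Fin 4) :
    pd i (fun y => a (‖y‖⁻¹ • y)) x =
      ‖x‖⁻¹ * pd i a (‖x‖⁻¹ • x) - x i * ‖x‖⁻¹ ^ 2 * Dr a (‖x‖⁻¹ • x) := by
  have h := HasFDerivAt.comp (f := fun y : E4 => ‖y‖⁻¹ • y) x ha.hasFDerivAt
    (hasFDerivAt_normalize hx)
  have h2 : (fun y : E4 => a (‖y‖⁻¹ • y)) = a ∘ fun y => ‖y‖⁻¹ • y := rfl
  rw [pd, h2, h.fderiv, pd, Dr]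
  simp [inner_e4]
  ring

theorem pd_inv_norm {x : E4} (hx : x ≠ 0) (i : Fin 4) :
    pd i (fun y : E4 => ‖y‖⁻¹) x = -(‖x‖⁻¹ ^ 3 * x i) := by
  rw [pd, (hasFDerivAt_inv_norm hx).fderiv]
  simp [inner_e4]

theorem sphLap_eq {f : E4 → ℝ} {x : E4} (hx : ‖x‖ = 1) (hf : ContDiffAt ℝ 2 f x) :
    sphLap f x = lap f x - Dr (Dr f) x - 2 * Dr f x := by
  have hx0 : x ≠ 0 := norm_ne_zero_iff.1 (by rw [hx]; exact one_ne_zero)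
  have hN : ‖x‖⁻¹ • x = x := by simp [hx]
  have hc : ContinuousAt (fun y : E4 => ‖y‖⁻¹ • y) x := (hasFDerivAt_normalize hx0).continuousAt
  have hfN : ∀ᶠ y in 𝓝 x, ContDiffAt ℝ 2 f (‖y‖⁻¹ • y) := by
    have := hf.eventually (by simp)
    rw [← hN] at this
    exact hc.eventually this
  have e1 : ∀ i, pd i (fun y => f (‖y‖⁻¹ • y)) =ᶠ[𝓝 x] fun y =>
      ‖y‖⁻¹ * pd i f (‖y‖⁻¹ • y) - y i * (‖y‖⁻¹ * (‖y‖⁻¹ * Dr f (‖y‖⁻¹ • y))) := fun i => by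
    filter_upwards [hfN, isOpen_ne.mem_nhds hx0] with y h1 h2
    rw [pd_comp_normalize h2 (h1.diff (by norm_num)) i]
    ring
  have dn : DifferentiableAt ℝ (fun y : E4 => ‖y‖⁻¹) x :=
    (hasFDerivAt_inv_norm hx0).differentiableAt
  have dN := (hasFDerivAt_normalize hx0).differentiableAt
  have dN' : ∀ {a : E4 → ℝ}, DifferentiableAt ℝ a x →
      DifferentiableAt ℝ (fun y : E4 => a (‖y‖⁻¹ • y)) x := fun {a} ha => by
    rw [← hN] at ha
    exact DifferentiableAt.comp (f := fun y : E4 => ‖y‖⁻¹ • y) x ha dN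
  have pdN : ∀ {a : E4 → ℝ} (_ : DifferentiableAt ℝ a x) (i : Fin 4),
      pd i (fun y : E4 => a (‖y‖⁻¹ • y)) x = pd i a x - x i * Dr a x := fun {a} ha i => by
    have := pd_comp_normalize hx0 (by rwa [hN]) i (a := a)
    simpa [hN, hx] using this
  have hi : ∀ i, DifferentiableAt ℝ (pd i f) x := fun i =>
    (hf.pd (m := 1) (by norm_num) i).diff le_rfl
  have hD : DifferentiableAt ℝ (Dr f) x := (hf.Dr (m := 1) (by norm_num)).diff le_rfl
  have dc : ∀ j, DifferentiableAt ℝ (fun y : E4 => y j) x := fun j =>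
    (contDiff_coord (n := 1) j).contDiffAt.diff le_rfl
  have e2 : ∀ i, pd i (pd i (fun y => f (‖y‖⁻¹ • y))) x =
      pd i (pd i f) x - x i * pd i f x - x i * Dr (pd i f) x
        + 2 * (x i * x i) * Dr f x + (x i * x i) * Dr (Dr f) x - Dr f x - x i * pd i (Dr f) x := by
    intro i
    rw [(pd_congr (e1 i) i).eq_of_nhds, pd_sub (dn.fun_mul (dN' (hi i)))
      ((dc i).fun_mul (dn.fun_mul (dn.fun_mul (dN' hD)))), pd_mul dn (dN' (hi i)),
      pd_mul (dc i) (dn.fun_mul (dn.fun_mul (dN' hD))), pd_mul dn (dn.fun_mul (dN' hD)),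
      pd_mul dn (dN' hD), pdN (hi i), pdN hD, pd_inv_norm hx0, pd_coord, hN, hx]
    simp
    ring
  have e3 : Dr (Dr f) x = ∑ i, x i * pd i (Dr f) x := Dr_eq_sum _ _
  have e4' : Dr (Dr f) x = Dr f x + ∑ i, x i * Dr (pd i f) x := by
    rw [e3, Dr_eq_sum f, ← Finset.sum_add_distrib]
    refine Finset.sum_congr rfl fun i _ => ?_
    rw [pd_Dr hf]; ring
  have e5 : ∑ i, x i * x i = 1 := by rw [← norm_sq_eq_sum, hx, one_pow]
  rw [sphLap, lap_eq, Finset.sum_congr rfl fun i _ => e2 i]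
  simp only [Finset.sum_add_distrib, Finset.sum_sub_distrib, ← Finset.mul_sum, ← Finset.sum_mul,
    e5, ← e3, ← Dr_eq_sum, ← lap_eq]
  simp
  linarith

theorem sphLap_congr {f g : E4 → ℝ} {x : E4} (hx : ‖x‖ = 1)
    (h : ∀ᶠ y in 𝓝 x, ‖y‖ = 1 → f y = g y) : sphLap f x = sphLap g x := by
  have hx0 : x ≠ 0 := norm_ne_zero_iff.1 (by rw [hx]; exact one_ne_zero)
  have hN : ‖x‖⁻¹ • x = x := by simp [hx]
  have hc : ContinuousAt (fun y : E4 => ‖y‖⁻¹ • y) x := (hasFDerivAt_normalize hx0).continuousAt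
  rw [← hN] at h
  refine (lap_congr ?_).eq_of_nhds
  filter_upwards [hc.eventually h, isOpen_ne.mem_nhds hx0] with y h1 h2
  exact h1 (by rw [norm_smul, norm_inv, norm_norm, inv_mul_cancel₀ (norm_ne_zero_iff.2 h2)])

theorem sphLap_zero (x : E4) : sphLap (fun _ => 0) x = 0 := lap_const 0 x

/-! ### The half-ball -/

/-- The open upper half-ball. -/
def Bp : Set E4 := {x | ‖x‖ < 1 ∧ 0 < x 3}

theorem continuous_coord (i : Fin 4) : Continuous fun x : E4 => x i :=
  (contDiff_coord (n := 0) i).continuous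

theorem isOpen_Bp : IsOpen Bp :=
  (isOpen_lt continuous_norm continuous_const).inter
    (isOpen_lt continuous_const (continuous_coord 3))

theorem isCompact_B4p : IsCompact B4p := by
  have h : IsClosed {x : E4 | 0 ≤ x 3} := isClosed_le continuous_const (continuous_coord 3)
  have h2 := (isCompact_closedBall (0 : E4) 1).inter_right h
  have h3 : B4p = Metric.closedBall (0 : E4) 1 ∩ {x : E4 | 0 ≤ x 3} := by
    ext x
    simp [B4p]
  rwa [h3]

theorem convex_B4p : Convex ℝ B4p := by
  intro x hx y hy a b ha hb hab
  refine ⟨?_, ?_⟩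
  · calc ‖a • x + b • y‖ ≤ ‖a • x‖ + ‖b • y‖ := norm_add_le _ _
      _ = a * ‖x‖ + b * ‖y‖ := by
        rw [norm_smul, norm_smul, Real.norm_of_nonneg ha, Real.norm_of_nonneg hb]
      _ ≤ a * 1 + b * 1 := by
        gcongr
        exacts [hx.1, hy.1]
      _ = 1 := by linarith
  · have h1 := mul_nonneg ha hx.2
    have h2 := mul_nonneg hb hy.2
    simp
    linarith

theorem Mhs_subset_B4p : Mhs ⊆ B4p := fun _ hx => ⟨hx.1.le, hx.2⟩

theorem Nfb_subset_B4p : Nfb ⊆ B4p := fun _ hx => ⟨hx.1, hx.2.ge⟩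

theorem Bp_subset_B4p : Bp ⊆ B4p := fun _ hx => ⟨hx.1.le, hx.2.le⟩

theorem zero_mem_B4p : (0 : E4) ∈ B4p := ⟨by simp, by simp⟩

theorem B4p_cases {x : E4} (hx : x ∈ B4p) : x ∈ Bp ∨ x ∈ Mhs ∨ x ∈ Nfb \ Sig := by
  by_cases h1 : ‖x‖ = 1
  · exact Or.inr (Or.inl ⟨h1, hx.2⟩)
  · have h2 : ‖x‖ < 1 := lt_of_le_of_ne hx.1 h1
    rcases hx.2.eq_or_lt with h3 | h3
    · exact Or.inr (Or.inr ⟨⟨hx.1, h3.symm⟩, fun h => h1 h.1⟩)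
    · exact Or.inl ⟨h2, h3⟩

theorem mem_Mhs_diff {x : E4} : x ∈ Mhs \ Sig ↔ ‖x‖ = 1 ∧ 0 < x 3 := by
  constructor
  · rintro ⟨⟨h1, h2⟩, h3⟩
    exact ⟨h1, lt_of_le_of_ne h2 fun h => h3 ⟨h1, h.symm⟩⟩
  · rintro ⟨h1, h2⟩
    exact ⟨⟨h1, h2.le⟩, fun h => h2.ne' h.2⟩

theorem mem_Nfb_diff {x : E4} : x ∈ Nfb \ Sig ↔ ‖x‖ < 1 ∧ x 3 = 0 := by
  constructor
  · rintro ⟨⟨h1, h2⟩, h3⟩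
    exact ⟨lt_of_le_of_ne h1 fun h => h3 ⟨h, h2⟩, h2⟩
  · rintro ⟨h1, h2⟩
    exact ⟨⟨h1.le, h2⟩, fun h => h1.ne h.1⟩

theorem continuous_eq_on_Mhs {f g : E4 → ℝ} (hf : ContinuousOn f Mhs) (hg : ContinuousOn g Mhs)
    (h : ∀ x ∈ Mhs \ Sig, f x = g x) {x : E4} (hx : x ∈ Mhs) : f x = g x := by
  by_cases hs : x ∈ Sig
  swap
  · exact h x ⟨hx, hs⟩
  have hxy : ‖x + (0 : ℝ) • e4 3‖ ≠ 0 := by simp [hs.1]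
  set γ : ℝ → E4 := fun s => ‖x + s • e4 3‖⁻¹ • (x + s • e4 3) with hγ
  have hc : ContinuousAt γ 0 := by
    have h1 : ContinuousAt (fun s : ℝ => x + s • e4 3) 0 := by fun_prop
    exact (h1.norm.inv₀ hxy).smul h1
  have h0 : γ 0 = x := by simp [hγ, hs.1]
  have hmem : ∀ s : ℝ, 0 < s → γ s ∈ Mhs \ Sig := by
    intro s hs'
    have h3 : (x + s • e4 3) 3 = s := by simp [e4_apply, hs.2]
    have hn : ‖x + s • e4 3‖ ≠ 0 := by
      intro h; rw [norm_eq_zero] at h; rw [h] at h3; simp at h3; exact hs'.ne h3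
    rw [mem_Mhs_diff]
    refine ⟨by rw [hγ]; simp only [norm_smul, norm_inv, norm_norm]; exact inv_mul_cancel₀ hn, ?_⟩
    have : γ s 3 = ‖x + s • e4 3‖⁻¹ * (x + s • e4 3) 3 := by simp [hγ, mul_add]
    rw [this, h3]; positivity
  have ht : Filter.Tendsto γ (𝓝[>] 0) (𝓝[Mhs] x) := by
    refine tendsto_nhdsWithin_iff.2 ⟨?_, ?_⟩
    · rw [← h0]; exact hc.tendsto.mono_left nhdsWithin_le_nhds
    · filter_upwards [self_mem_nhdsWithin] with s hs'
      exact (hmem s hs').1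
  refine tendsto_nhds_unique (f := f ∘ γ) (l := 𝓝[>] (0 : ℝ)) ((hf x hx).tendsto.comp ht) ?_
  refine ((hg x hx).tendsto.comp ht).congr' ?_
  filter_upwards [self_mem_nhdsWithin] with s hs'
  exact (h _ (hmem s hs')).symm

theorem continuous_eq_on_Nfb {f g : E4 → ℝ} (hf : ContinuousOn f Nfb) (hg : ContinuousOn g Nfb)
    (h : ∀ x ∈ Nfb \ Sig, f x = g x) {x : E4} (hx : x ∈ Nfb) : f x = g x := by
  set γ : ℝ → E4 := fun s => (1 - s) • x with hγ
  have hc : ContinuousAt γ 0 := by fun_prop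
  have h0 : γ 0 = x := by simp [hγ]
  have hmem : ∀ s ∈ Ioo (0 : ℝ) 1, γ s ∈ Nfb \ Sig := by
    intro s hs
    rw [mem_Nfb_diff]
    refine ⟨?_, by simp [hγ, hx.2]⟩
    rw [hγ]
    simp only [norm_smul, Real.norm_of_nonneg (sub_nonneg.2 hs.2.le)]
    calc (1 - s) * ‖x‖ ≤ (1 - s) * 1 := by
          gcongr
          exacts [sub_nonneg.2 hs.2.le, hx.1]
      _ < 1 := by linarith [hs.1]
  have hev : ∀ᶠ s in 𝓝[>] (0 : ℝ), s ∈ Ioo (0 : ℝ) 1 := Ioo_mem_nhdsGT one_pos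
  have ht : Filter.Tendsto γ (𝓝[>] 0) (𝓝[Nfb] x) := by
    refine tendsto_nhdsWithin_iff.2 ⟨?_, ?_⟩
    · have := hc.tendsto.mono_left (nhdsWithin_le_nhds (s := Ioi (0 : ℝ)))
      rwa [h0] at this
    · filter_upwards [hev] with s hs'
      exact (hmem s hs').1
  refine tendsto_nhds_unique (f := f ∘ γ) (l := 𝓝[>] (0 : ℝ)) ((hf x hx).tendsto.comp ht) ?_
  refine ((hg x hx).tendsto.comp ht).congr' ?_
  filter_upwards [hev] with s hs'
  exact (h _ (hmem s hs')).symm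

/-! ### A maximum principle with mixed boundary conditions -/

theorem hasDerivAt_line {u : E4 → ℝ} {x v : E4} {s : ℝ}
    (hu : DifferentiableAt ℝ u (x + s • v)) :
    HasDerivAt (fun r : ℝ => u (x + r • v)) (fderiv ℝ u (x + s • v) v) s := by
  have h1 : HasDerivAt (fun r : ℝ => x + r • v) v s := by
    simpa using ((hasDerivAt_id s).smul_const v).const_add x
  exact hu.hasFDerivAt.comp_hasDerivAt s h1

theorem pd_pd_nonpos_of_isLocalMax {u : E4 → ℝ} {x : E4} (hu : ContDiffAt ℝ 2 u x)
    (hm : IsLocalMax u x) (i : Fin 4) : pd i (pd i u) x ≤ 0 := by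
  by_contra hpos
  push Not at hpos
  set γ : ℝ → E4 := fun r => x + r • e4 i with hγ
  have hγ0 : γ 0 = x := by simp [hγ]
  have hγc : ContinuousAt γ 0 := by fun_prop
  have hev : ∀ᶠ r in 𝓝 (0 : ℝ), ContDiffAt ℝ 2 u (γ r) := by
    have := hu.eventually (by simp)
    rw [← hγ0] at this
    exact hγc.eventually this
  have hd : deriv (fun r => u (γ r)) =ᶠ[𝓝 0] fun r => pd i u (γ r) := by
    filter_upwards [hev] with r hr
    exact (hasDerivAt_line (hr.diff (by norm_num))).deriv
  have hdd : deriv (deriv fun r => u (γ r)) 0 = pd i (pd i u) x := by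
    rw [hd.deriv_eq]
    have h1 : DifferentiableAt ℝ (pd i u) (x + (0 : ℝ) • e4 i) := by
      simpa using (hu.pd (m := 1) (by norm_num) i).diff le_rfl
    have := (hasDerivAt_line h1).deriv
    simpa [pd] using this
  have hmax : IsLocalMax (fun r => u (γ r)) 0 := by
    have : ∀ᶠ y in 𝓝 (γ 0), u y ≤ u (γ 0) := by rw [hγ0]; exact hm
    exact hγc.eventually this
  have hmin : IsLocalMin (fun r => u (γ r)) 0 := by
    refine isLocalMin_of_deriv_deriv_pos (by rwa [hdd]) hmax.deriv_eq_zero ?_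
    refine ContinuousAt.comp (f := γ) ?_ hγc
    rw [hγ0]; exact hu.continuousAt
  have hconst : (fun r => u (γ r)) =ᶠ[𝓝 0] fun _ => u (γ 0) := by
    filter_upwards [hmax, hmin] with r h1 h2 using le_antisymm h1 h2
  have : deriv (deriv fun r => u (γ r)) 0 = 0 := by
    rw [hconst.deriv.deriv_eq]; simp
  linarith

theorem nonpos_of_mixed_boundary {X : E4 → ℝ} (hc : Continuous X)
    (hB : ∀ x ∈ Bp, ContDiffAt ℝ 2 X x ∧ lap X x = 0)
    (hN : ∀ x ∈ Nfb \ Sig, DifferentiableAt ℝ X x ∧ pd 3 X x = 0)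
    (hM : ∀ x ∈ Mhs, X x ≤ 0 ∨ (DifferentiableAt ℝ X x ∧ Dr X x = -X x)) :
    ∀ x ∈ B4p, X x ≤ 0 := by
  suffices H : ∀ ε : ℝ, 0 < ε → ∀ x ∈ B4p, X x ≤ 5 * ε by
    intro x hx
    refine le_of_forall_pos_le_add fun ε hε => ?_
    have := H (ε / 5) (by positivity) x hx
    linarith
  intro ε hε
  set b : E4 → ℝ := fun y => ε * (y 3 + ‖y‖ ^ 2) with hb
  have hbs : ContDiff ℝ 2 b := contDiff_const.mul ((contDiff_coord 3).add (contDiff_norm_sq ℝ))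
  have hb0 : ∀ y ∈ B4p, 0 ≤ b y := fun y hy => by
    have := hy.2
    positivity
  have hb2 : ∀ y ∈ B4p, b y ≤ 2 * ε := fun y hy => by
    have h1 : y 3 ≤ 1 := by
      have := PiLp.norm_apply_le y 3
      exact (le_abs_self _).trans (this.trans hy.1)
    have h2 : ‖y‖ ^ 2 ≤ 1 := by nlinarith [norm_nonneg y, hy.1]
    rw [hb]; nlinarith
  have dc : ∀ (x : E4) j, DifferentiableAt ℝ (fun y : E4 => y j) x := fun x j =>
    (contDiff_coord (n := 1) j).contDiffAt.diff le_rfl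
  have dn : ∀ x : E4, DifferentiableAt ℝ (fun y : E4 => ‖y‖ ^ 2) x := fun x =>
    (contDiff_norm_sq ℝ (n := 1)).contDiffAt.diff le_rfl
  have hbd : ∀ x, DifferentiableAt ℝ b x := fun x => hbs.contDiffAt.diff (by norm_num)
  set Y : E4 → ℝ := fun y => X y + b y with hY
  obtain ⟨x₀, hx₀, hmax⟩ := isCompact_B4p.exists_isMaxOn ⟨0, zero_mem_B4p⟩
    (hc.add hbs.continuous).continuousOn (f := Y)
  suffices hs : Y x₀ ≤ 5 * ε by
    intro x hx
    have h1 : Y x ≤ Y x₀ := hmax hx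
    have := hb0 x hx
    simp only [hY] at h1 hs ⊢
    linarith
  have cone : ∀ y ∈ B4p, DifferentiableAt ℝ Y x₀ → fderiv ℝ Y x₀ (y - x₀) ≤ 0 :=
    fun y hy hd => hmax.localize.hasFDerivWithinAt_nonpos hd.hasFDerivAt.hasFDerivWithinAt
      (mem_posTangentConeAt_of_segment_subset (convex_B4p.segment_subset hx₀ (by simpa using hy)))
  rcases B4p_cases hx₀ with h | h | h
  · exfalso
    obtain ⟨h1, h2⟩ := hB x₀ h
    have hlm : IsLocalMax Y x₀ :=
      hmax.isLocalMax (Filter.mem_of_superset (isOpen_Bp.mem_nhds h) Bp_subset_B4p)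
    have h3 : lap Y x₀ ≤ 0 :=
      Finset.sum_nonpos fun i _ => pd_pd_nonpos_of_isLocalMax (h1.add hbs.contDiffAt) hlm i
    rw [hY, lap_add h1 hbs.contDiffAt, h2, hb, lap_const_mul,
      lap_add (contDiff_coord 3).contDiffAt (contDiff_norm_sq ℝ).contDiffAt,
      lap_coord, lap_norm_sq] at h3
    linarith
  · have hbx := hb2 x₀ hx₀
    rcases hM x₀ h with h1 | ⟨h1, h2⟩
    · simp only [hY]; linarith
    · have h3 := cone 0 zero_mem_B4p (h1.add (hbd x₀))
      rw [zero_sub, map_neg] at h3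
      have h4 : Dr Y x₀ = -X x₀ + ε * (x₀ 3 + 2 * ‖x₀‖ ^ 2) := by
        rw [hY, Dr_add h1 (hbd x₀), h2, hb, Dr_const_mul, Dr_add (dc _ _) (dn _), Dr_coord,
          Dr_norm_sq]
      have h5 : x₀ 3 ≤ 1 := by
        have := PiLp.norm_apply_le x₀ 3
        exact (le_abs_self _).trans (this.trans hx₀.1)
      rw [h.1] at h4
      simp only [Dr] at h4
      simp only [hY] at h3 h4 ⊢
      nlinarith
  · exfalso
    obtain ⟨h1, h2⟩ := hN x₀ h
    obtain ⟨hn, h3⟩ := mem_Nfb_diff.1 h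
    have hy : x₀ + (1 - ‖x₀‖) • e4 3 ∈ B4p := by
      refine ⟨?_, ?_⟩
      · calc ‖x₀ + (1 - ‖x₀‖) • e4 3‖ ≤ ‖x₀‖ + ‖(1 - ‖x₀‖) • e4 3‖ := norm_add_le _ _
          _ = 1 := by
            rw [norm_smul, norm_e4, Real.norm_of_nonneg (sub_nonneg.2 hn.le)]; ring
      · simp [e4_apply, h3, hn.le]
    have h4 := cone _ hy (h1.add (hbd x₀))
    rw [add_sub_cancel_left, map_smul, smul_eq_mul] at h4
    have h5 : pd 3 Y x₀ = ε := by
      rw [hY, pd_add h1 (hbd x₀), h2, hb, pd_const_mul, pd_add (dc _ _) (dn _), pd_coord,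
        pd_norm_sq, h3]
      simp
    rw [← pd, h5] at h4
    nlinarith

/-! ### Linearity of the boundary operators -/

theorem Dr_Dr_add {u v : E4 → ℝ} {x : E4} (hu : ContDiffAt ℝ 2 u x) (hv : ContDiffAt ℝ 2 v x) :
    Dr (Dr fun y => u y + v y) x = Dr (Dr u) x + Dr (Dr v) x := by
  have : Dr (fun y => u y + v y) =ᶠ[𝓝 x] fun y => Dr u y + Dr v y := by
    filter_upwards [hu.eventually (by simp), hv.eventually (by simp)] with y h1 h2
    exact Dr_add (h1.diff (by norm_num)) (h2.diff (by norm_num))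
  rw [(Dr_congr this).eq_of_nhds]
  exact Dr_add ((hu.Dr (m := 1) (by norm_num)).diff le_rfl)
    ((hv.Dr (m := 1) (by norm_num)).diff le_rfl)

theorem sphLap_add {u v : E4 → ℝ} {x : E4} (hx : ‖x‖ = 1) (hu : ContDiffAt ℝ 2 u x)
    (hv : ContDiffAt ℝ 2 v x) :
    sphLap (fun y => u y + v y) x = sphLap u x + sphLap v x := by
  rw [sphLap_eq hx hu, sphLap_eq hx hv, sphLap_eq hx (hu.add hv), lap_add hu hv,
    Dr_Dr_add hu hv, Dr_add (hu.diff (by norm_num)) (hv.diff (by norm_num))]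
  ring

theorem sphLap_const_mul (c : ℝ) (u : E4 → ℝ) (x : E4) :
    sphLap (fun y => c * u y) x = c * sphLap u x := lap_const_mul c

theorem muM_add {u v : E4 → ℝ} {x : E4} (hu : DifferentiableAt ℝ u x)
    (hv : DifferentiableAt ℝ v x) : muM (fun y => u y + v y) x = muM u x + muM v x := by
  simp only [muM_eq, Dr_add hu hv]
  ring

theorem lap_add_eventually {u v : E4 → ℝ} {x : E4} (hu : ContDiffAt ℝ 2 u x)
    (hv : ContDiffAt ℝ 2 v x) :
    lap (fun y => u y + v y) =ᶠ[𝓝 x] fun y => lap u y + lap v y := by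
  filter_upwards [hu.eventually (by simp), hv.eventually (by simp)] with y h1 h2
  exact lap_add h1 h2

theorem ContDiffAt.muM {n m : WithTop ℕ∞} {u : E4 → ℝ} {x : E4} (h : ContDiffAt ℝ n u x)
    (hm : m + 1 ≤ n) : ContDiffAt ℝ m (muM u) x :=
  (h.Dr hm).neg

theorem P3M_add {u v : E4 → ℝ} {x : E4} (hx : ‖x‖ = 1) (hu : ContDiffAt ℝ 3 u x)
    (hv : ContDiffAt ℝ 3 v x) : P3M (fun y => u y + v y) x = P3M u x + P3M v x := by
  have hu2 : ContDiffAt ℝ 2 u x := hu.of_le (by norm_num)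
  have hv2 : ContDiffAt ℝ 2 v x := hv.of_le (by norm_num)
  have h1 : Dr (lap fun y => u y + v y) x = Dr (lap u) x + Dr (lap v) x := by
    rw [(Dr_congr (lap_add_eventually hu2 hv2)).eq_of_nhds]
    exact Dr_add ((hu.lap (m := 1) (by norm_num)).diff le_rfl)
      ((hv.lap (m := 1) (by norm_num)).diff le_rfl)
  have h2 : muM (fun y => u y + v y) =ᶠ[𝓝 x] fun y => muM u y + muM v y := by
    filter_upwards [hu.eventually (by simp), hv.eventually (by simp)] with y h3 h4
    exact muM_add (h3.diff (by norm_num)) (h4.diff (by norm_num))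
  have h3 : sphLap (muM fun y => u y + v y) x = sphLap (muM u) x + sphLap (muM v) x := by
    rw [sphLap_congr hx (h2.mono fun y hy _ => hy),
      sphLap_add hx (hu.muM (by norm_num)) (hv.muM (by norm_num))]
  rw [P3M, h3, sphLap_add hx hu2 hv2, P3M, P3M]
  simp only [muM_eq, h1]
  ring

theorem P3M_const_mul (c : ℝ) (u : E4 → ℝ) (x : E4) :
    P3M (fun y => c * u y) x = c * P3M u x := by
  have h1 : (lap fun y => c * u y) = fun y => c * lap u y := by ext y; exact lap_const_mul c
  have h2 : (muM fun y => c * u y) = fun y => c * muM u y := by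
    ext y; simp only [muM_eq, Dr_const_mul]; ring
  rw [P3M, h2, sphLap_const_mul, sphLap_const_mul, P3M, h1]
  simp only [muM_eq, Dr_const_mul]
  ring

theorem lap3_add {u v : E4 → ℝ} {x : E4} (hu : ContDiffAt ℝ 2 u x) (hv : ContDiffAt ℝ 2 v x) :
    lap3 (fun y => u y + v y) x = lap3 u x + lap3 v x := by
  simp only [lap3_eq, ← Finset.sum_add_distrib]
  refine Finset.sum_congr rfl fun i _ => ?_
  have : pd i.castSucc (fun y => u y + v y) =ᶠ[𝓝 x]
      fun y => pd i.castSucc u y + pd i.castSucc v y := by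
    filter_upwards [hu.eventually (by simp), hv.eventually (by simp)] with y h1 h2
    exact pd_add (h1.diff (by norm_num)) (h2.diff (by norm_num)) _
  rw [(pd_congr this _).eq_of_nhds]
  exact pd_add ((hu.pd (m := 1) (by norm_num) _).diff le_rfl)
    ((hv.pd (m := 1) (by norm_num) _).diff le_rfl) _

theorem lap3_const_mul {u : E4 → ℝ} {x : E4} (c : ℝ) :
    lap3 (fun y => c * u y) x = c * lap3 u x := by
  simp only [lap3_eq, Finset.mul_sum]
  refine Finset.sum_congr rfl fun i _ => ?_
  have : pd i.castSucc (fun y => c * u y) = fun y => c * pd i.castSucc u y := by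
    ext y; exact pd_const_mul c _
  rw [this, pd_const_mul]

theorem P3N_add {u v : E4 → ℝ} {x : E4} (hu : ContDiffAt ℝ 3 u x)
    (hv : ContDiffAt ℝ 3 v x) : P3N (fun y => u y + v y) x = P3N u x + P3N v x := by
  have hu2 : ContDiffAt ℝ 2 u x := hu.of_le (by norm_num)
  have hv2 : ContDiffAt ℝ 2 v x := hv.of_le (by norm_num)
  have h1 : pd 3 (lap fun y => u y + v y) x = pd 3 (lap u) x + pd 3 (lap v) x := by
    rw [(pd_congr (lap_add_eventually hu2 hv2) 3).eq_of_nhds]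
    exact pd_add ((hu.lap (m := 1) (by norm_num)).diff le_rfl)
      ((hv.lap (m := 1) (by norm_num)).diff le_rfl) 3
  have h2 : pd 3 (fun y => u y + v y) =ᶠ[𝓝 x] fun y => pd 3 u y + pd 3 v y := by
    filter_upwards [hu.eventually (by simp), hv.eventually (by simp)] with y h3 h4
    exact pd_add (h3.diff (by norm_num)) (h4.diff (by norm_num)) 3
  simp only [P3N, muN_eq, h1]
  rw [(lap3_congr h2).eq_of_nhds, lap3_add (hu.pd (by norm_num) 3) (hv.pd (by norm_num) 3)]
  ring

theorem P3N_const_mul (c : ℝ) (u : E4 → ℝ) (x : E4) :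
    P3N (fun y => c * u y) x = c * P3N u x := by
  have h1 : (lap fun y => c * u y) = fun y => c * lap u y := by ext y; exact lap_const_mul c
  have h2 : (pd 3 fun y => c * u y) = fun y => c * pd 3 u y := by
    ext y; exact pd_const_mul c 3
  simp only [P3N, muN_eq, h1, h2, lap3_const_mul, pd_const_mul]
  ring

/-! ### Tangential derivatives along the flat boundary -/

theorem fderiv_tangential_eq_zero {f : E4 → ℝ}
    (hf : ∀ y : E4, ‖y‖ < 1 → y 3 = 0 → f y = 0) {x v : E4} (hx : ‖x‖ < 1) (hx3 : x 3 = 0)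
    (hv : v 3 = 0) : fderiv ℝ f x v = 0 := by
  by_cases hd : DifferentiableAt ℝ f x
  swap
  · simp [fderiv_zero_of_not_differentiableAt hd]
  have h1 : HasDerivAt (fun r : ℝ => f (x + r • v)) (fderiv ℝ f x v) 0 := by
    have := hasDerivAt_line (u := f) (x := x) (v := v) (s := 0) (by simpa using hd)
    simpa using this
  have h2 : (fun r : ℝ => f (x + r • v)) =ᶠ[𝓝 0] fun _ => 0 := by
    have hc : ContinuousAt (fun r : ℝ => ‖x + r • v‖) 0 := by fun_prop
    have : ∀ᶠ r in 𝓝 (0 : ℝ), ‖x + r • v‖ < 1 := hc.eventually_lt continuousAt_const (by simpa)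
    filter_upwards [this] with r hr
    exact hf _ hr (by simp [hx3, hv])
  rw [← h1.deriv, h2.deriv_eq]
  simp

theorem lap3_eq_zero_of_flat {f : E4 → ℝ}
    (hf : ∀ y : E4, ‖y‖ < 1 → y 3 = 0 → f y = 0) {x : E4} (hx : ‖x‖ < 1) (hx3 : x 3 = 0) :
    lap3 f x = 0 := by
  refine Finset.sum_eq_zero fun i _ => ?_
  have hi : e4 i.castSucc 3 = 0 := by
    rw [e4_apply, if_neg]
    exact (Fin.castSucc_lt_last i).ne'
  exact fderiv_tangential_eq_zero
    (fun y hy hy3 => fderiv_tangential_eq_zero hf hy hy3 hi) hx hx3 hi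

theorem Bp_approach {x : E4} (hx : x ∈ B4p) {s : ℝ} (hs : 0 < s) (hs1 : s ≤ 1) :
    (1 - s) • x + (s / 2) • e4 3 ∈ Bp := by
  refine ⟨?_, ?_⟩
  · calc ‖(1 - s) • x + (s / 2) • e4 3‖ ≤ ‖(1 - s) • x‖ + ‖(s / 2) • e4 3‖ := norm_add_le _ _
      _ = (1 - s) * ‖x‖ + s / 2 := by
        rw [norm_smul, norm_smul, norm_e4, Real.norm_of_nonneg (sub_nonneg.2 hs1),
          Real.norm_of_nonneg (by positivity)]; ring
      _ ≤ (1 - s) * 1 + s / 2 := by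
        have := mul_le_mul_of_nonneg_left hx.1 (sub_nonneg.2 hs1)
        linarith
      _ < 1 := by linarith
  · have h1 := mul_nonneg (sub_nonneg.2 hs1) hx.2
    simp [e4_apply]
    linarith

theorem continuous_eq_on_B4p {f g : E4 → ℝ} (hf : ContinuousOn f B4p) (hg : ContinuousOn g B4p)
    (h : ∀ x ∈ Bp, f x = g x) {x : E4} (hx : x ∈ B4p) : f x = g x := by
  set γ : ℝ → E4 := fun s => (1 - s) • x + (s / 2) • e4 3 with hγ
  have hc : ContinuousAt γ 0 := by fun_prop
  have h0 : γ 0 = x := by simp [hγ]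
  have hev : ∀ᶠ s in 𝓝[>] (0 : ℝ), s ∈ Ioo (0 : ℝ) 1 := Ioo_mem_nhdsGT one_pos
  have hmem : ∀ s ∈ Ioo (0 : ℝ) 1, γ s ∈ Bp := fun s hs => Bp_approach hx hs.1 hs.2.le
  have ht : Filter.Tendsto γ (𝓝[>] 0) (𝓝[B4p] x) := by
    refine tendsto_nhdsWithin_iff.2 ⟨?_, ?_⟩
    · have := hc.tendsto.mono_left (nhdsWithin_le_nhds (s := Ioi (0 : ℝ)))
      rwa [h0] at this
    · filter_upwards [hev] with s hs'
      exact Bp_subset_B4p (hmem s hs')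
  refine tendsto_nhds_unique (f := f ∘ γ) (l := 𝓝[>] (0 : ℝ)) ((hf x hx).tendsto.comp ht) ?_
  refine ((hg x hx).tendsto.comp ht).congr' ?_
  filter_upwards [hev] with s hs'
  exact (h _ (hmem s hs')).symm

/-! ### Uniqueness -/

theorem mixed_homogeneous_zero {X : E4 → ℝ} (hc : Continuous X)
    (hB : ∀ x ∈ Bp, ContDiffAt ℝ 2 X x ∧ lap X x = 0)
    (hN : ∀ x ∈ Nfb \ Sig, DifferentiableAt ℝ X x ∧ pd 3 X x = 0)
    (hM : ∀ x ∈ Mhs, X x = 0 ∨ (DifferentiableAt ℝ X x ∧ Dr X x = -X x)) :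
    ∀ x ∈ B4p, X x = 0 := by
  intro x hx
  have hneg : (fun y => -X y) = fun y => (-1) * X y := by ext y; ring
  refine le_antisymm (nonpos_of_mixed_boundary hc hB hN ?_ x hx) ?_
  · intro y hy
    exact (hM y hy).imp (fun h => h.le) id
  · have := nonpos_of_mixed_boundary (X := fun y => -X y) hc.neg
      (fun y hy => ⟨(hB y hy).1.neg, by rw [hneg, lap_const_mul, (hB y hy).2, mul_zero]⟩)
      (fun y hy => ⟨(hN y hy).1.neg, by rw [pd_neg, (hN y hy).2, neg_zero]⟩)
      (fun y hy => (hM y hy).imp (fun h => by rw [h, neg_zero])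
        fun h => ⟨h.1.neg, by rw [hneg, Dr_const_mul, h.2]; ring⟩) x hx
    linarith

theorem eq_value_at_zero_of_Dr_eq_zero {w : E4 → ℝ} (hw : ContDiff ℝ 1 w)
    (h : ∀ x ∈ B4p, Dr w x = 0) {x : E4} (hx : x ∈ B4p) : w x = w 0 := by
  set g : ℝ → ℝ := fun τ => w (Real.exp (-τ ^ 2) • x) with hg
  have hd : ∀ τ, HasDerivAt g 0 τ := by
    intro τ
    have h1 : HasDerivAt (fun τ : ℝ => Real.exp (-τ ^ 2)) (Real.exp (-τ ^ 2) * (-(2 * τ))) τ := by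
      have : HasDerivAt (fun τ : ℝ => -τ ^ 2) (-(2 * τ)) τ := by
        have h := (hasDerivAt_pow 2 τ).fun_neg
        simpa using h
      exact this.exp
    have h2 := (hw.contDiffAt.diff le_rfl (x := Real.exp (-τ ^ 2) • x)).hasFDerivAt.comp_hasDerivAt
      τ (h1.smul_const x)
    refine h2.congr_deriv ?_
    have hmem : Real.exp (-τ ^ 2) • x ∈ B4p := by
      have := convex_B4p hx zero_mem_B4p (Real.exp_pos (-τ ^ 2)).le
        (sub_nonneg.2 (Real.exp_le_one_iff.2 (neg_nonpos.2 (sq_nonneg τ)))) (by ring)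
      simpa using this
    have h3 := h _ hmem
    rw [Dr, map_smul] at h3
    rw [mul_comm, mul_smul, map_smul, map_smul, h3, smul_zero]
  have hconst : ∀ τ, g τ = w x := fun τ => by
    have := is_const_of_deriv_eq_zero (fun t => (hd t).differentiableAt) (fun t => (hd t).deriv) τ 0
    rw [this]; simp [hg]
  have hlim : Filter.Tendsto g Filter.atTop (𝓝 (w ((0 : ℝ) • x))) := by
    have h1 : Filter.Tendsto (fun τ : ℝ => Real.exp (-τ ^ 2)) Filter.atTop (𝓝 0) :=
      Real.tendsto_exp_atBot.comp
        (Filter.tendsto_neg_atTop_atBot.comp (Filter.tendsto_pow_atTop two_ne_zero))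
    exact (hw.continuous.tendsto _).comp (h1.smul_const x)
  rw [zero_smul] at hlim
  exact tendsto_nhds_unique (tendsto_const_nhds.congr fun τ => (hconst τ).symm) hlim

theorem Dr_eq_zero_of_eq_zero_on_B4p {X : E4 → ℝ} {x : E4} (hx : x ∈ B4p)
    (hd : DifferentiableAt ℝ X x) (h : ∀ y ∈ B4p, X y = 0) : Dr X x = 0 := by
  have hmax : IsMaxOn X B4p x := fun y hy => by rw [Set.mem_ofPred, h y hy, h x hx]
  have hmin : IsMinOn X B4p x := fun y hy => by rw [Set.mem_ofPred, h y hy, h x hx]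
  have hcone := mem_posTangentConeAt_of_segment_subset (x := x) (y := 0 - x)
    (convex_B4p.segment_subset hx (by simpa using zero_mem_B4p))
  have h1 := hmax.localize.hasFDerivWithinAt_nonpos hd.hasFDerivAt.hasFDerivWithinAt hcone
  have h2 := hmin.localize.hasFDerivWithinAt_nonneg hd.hasFDerivAt.hasFDerivWithinAt hcone
  rw [zero_sub, map_neg] at h1 h2
  exact le_antisymm (by rw [Dr]; linarith) (by rw [Dr]; linarith)

theorem homogeneous_problem_trivial {w : E4 → ℝ} (hw : ContDiff ℝ 3 w)
    (hw4 : ∀ x ∈ Bp, ContDiffAt ℝ 4 w x) (hbi : ∀ x ∈ Bp, lap (lap w) x = 0)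
    (hPM : ∀ x ∈ Mhs \ Sig, P3M w x = 0) (hPN : ∀ x ∈ Nfb \ Sig, P3N w x = 0)
    (hM : ∀ x ∈ Mhs, Dr w x = 0) (hN : ∀ x ∈ Nfb, pd 3 w x = 0) (hS : ∀ x ∈ Sig, w x = 0) :
    ∀ x ∈ B4p, w x = 0 := by
  set h := lap w with hh
  have hc1 : ContDiff ℝ 1 h := contDiff_iff_contDiffAt.2 fun x => hw.contDiffAt.lap (by norm_num)
  have hDr : ContDiff ℝ 2 (Dr w) := contDiff_iff_contDiffAt.2 fun x =>
    hw.contDiffAt.Dr (by norm_num)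
  have hh2 : ∀ x ∈ Bp, ContDiffAt ℝ 2 h x := fun x hx => (hw4 x hx).lap (by norm_num)
  have hflat : ∀ y : E4, ‖y‖ < 1 → y 3 = 0 → pd 3 w y = 0 := fun y hy hy3 => hN y ⟨hy.le, hy3⟩
  have hN3 : ∀ x ∈ Nfb \ Sig, pd 3 h x = 0 := by
    intro x hx
    obtain ⟨h1, h2⟩ := mem_Nfb_diff.1 hx
    have := hPN x hx
    rw [P3N, muN_eq, muN_eq, lap3_eq_zero_of_flat hflat h1 h2] at this
    linarith
  set q : E4 → ℝ := fun y => 1 / 4 + (-1 / 4) * ‖y‖ ^ 2 with hq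
  have hqs : ContDiff ℝ 2 q := contDiff_const.add (contDiff_const.mul (contDiff_norm_sq ℝ))
  have hqd : ∀ x, DifferentiableAt ℝ q x := fun x => hqs.contDiffAt.diff (by norm_num)
  have hns : ∀ x : E4, DifferentiableAt ℝ (fun y : E4 => -1 / 4 * ‖y‖ ^ 2) x := fun x =>
    ((contDiff_const (n := 1)).mul (contDiff_norm_sq ℝ)).contDiffAt.diff le_rfl
  have hqpd : ∀ i x, pd i q x = -x i / 2 := fun i x => by
    rw [hq, pd_add (differentiableAt_const _) (hns x), pd_const, pd_const_mul, pd_norm_sq]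
    ring
  have hqDr : ∀ x, Dr q x = -‖x‖ ^ 2 / 2 := fun x => by
    rw [Dr_eq_sum, norm_sq_eq_sum, neg_div, Finset.sum_div, ← Finset.sum_neg_distrib]
    exact Finset.sum_congr rfl fun i _ => by rw [hqpd]; ring
  have hqlap : ∀ x, lap q x = -2 := fun x => by
    have : ∀ i, pd i q = fun y => (-1 / 2) * y i := fun i => by ext y; rw [hqpd]; ring
    simp only [lap_eq, this, pd_const_mul, pd_coord]
    simp
    norm_num
  set X : E4 → ℝ := fun y => Dr w y + q y * h y with hX
  have hd1 : ∀ x, DifferentiableAt ℝ (Dr w) x := fun x => hDr.contDiffAt.diff (by norm_num)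
  have hdh : ∀ x, DifferentiableAt ℝ h x := fun x => hc1.contDiffAt.diff le_rfl
  have hX1 : ∀ x, DifferentiableAt ℝ X x := fun x => (hd1 x).fun_add ((hqd x).fun_mul (hdh x))
  have hX0 : ∀ x ∈ B4p, X x = 0 := by
    refine mixed_homogeneous_zero (hDr.continuous.add (hqs.continuous.mul hc1.continuous))
      (fun x hx => ⟨hDr.contDiffAt.add (hqs.contDiffAt.mul (hh2 x hx)), ?_⟩)
      (fun x hx => ⟨hX1 x, ?_⟩) (fun x hx => Or.inl ?_)
    · rw [hX, lap_add hDr.contDiffAt (hqs.contDiffAt.mul (hh2 x hx)), lap_Dr hw.contDiffAt,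
        lap_mul hqs.contDiffAt (hh2 x hx), hqlap, hbi x hx, ← hh]
      simp only [hqpd]
      rw [Dr_eq_sum h, Finset.mul_sum]
      have : ∑ i, 2 * (-x i / 2 * pd i h x) = -∑ i, x i * pd i h x := by
        rw [← Finset.sum_neg_distrib]
        exact Finset.sum_congr rfl fun i _ => by ring
      rw [this]; ring
    · obtain ⟨h1, h2⟩ := mem_Nfb_diff.1 hx
      have h3 : Dr (pd 3 w) x = 0 := fderiv_tangential_eq_zero hflat h1 h2 h2
      rw [hX, pd_add (hd1 x) ((hqd x).fun_mul (hdh x)), pd_Dr (hw.contDiffAt.of_le (by norm_num)),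
        pd_mul (hqd x) (hdh x), hN x hx.1, h3, hN3 x hx, hqpd, h2]
      ring
    · rw [hX]; simp only [hM x hx, hq, hx.1]; ring
  have hrob : ∀ x ∈ Mhs \ Sig, Dr h x = -h x := by
    intro x hx
    obtain ⟨h1, h2⟩ := mem_Mhs_diff.1 hx
    have h3 := Dr_eq_zero_of_eq_zero_on_B4p (Mhs_subset_B4p hx.1) (hX1 x) hX0
    rw [hX, Dr_add (hd1 x) ((hqd x).fun_mul (hdh x)), Dr_mul (hqd x) (hdh x), hqDr, hq] at h3
    simp only [h1] at h3
    have h4 : sphLap (muM w) x = 0 := by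
      rw [sphLap_congr (g := fun _ => 0) h1, sphLap_zero]
      filter_upwards [(isOpen_lt continuous_const (continuous_coord 3)).mem_nhds h2] with y hy hy1
      rw [muM_eq]
      simp only [hM y ⟨hy1, le_of_lt hy⟩, neg_zero]
    have h5 := hPM x hx
    rw [P3M, h4, sphLap_eq h1 (hw.contDiffAt.of_le (by norm_num)), muM_eq, hM x hx.1] at h5
    simp only [← hh] at h5
    linarith
  have hDrh : Continuous (Dr h) := by
    have : ContDiff ℝ 0 (Dr h) := contDiff_iff_contDiffAt.2 fun x =>
      hc1.contDiffAt.Dr (by norm_num)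
    exact this.continuous
  have hh0 : ∀ x ∈ B4p, h x = 0 :=
    mixed_homogeneous_zero hc1.continuous (fun x hx => ⟨hh2 x hx, hbi x hx⟩)
      (fun x hx => ⟨hdh x, hN3 x hx⟩) fun x hx => Or.inr ⟨hdh x,
        continuous_eq_on_Mhs hDrh.continuousOn hc1.continuous.neg.continuousOn hrob hx⟩
  have hDr0 : ∀ x ∈ B4p, Dr w x = 0 := fun x hx => by
    have := hX0 x hx
    rw [hX] at this
    simpa [hh0 x hx] using this
  have hp : e4 0 ∈ Sig := ⟨norm_e4 0, by rw [e4_apply]; simp⟩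
  have hw1 : ContDiff ℝ 1 w := hw.of_le (by norm_num)
  intro x hx
  rw [eq_value_at_zero_of_Dr_eq_zero hw1 hDr0 hx, ← eq_value_at_zero_of_Dr_eq_zero hw1 hDr0
    (Mhs_subset_B4p ⟨hp.1, hp.2.ge⟩), hS _ hp]

theorem solHB_unique {ψ φ ω₁ ω₂ : E4 → ℝ} (h₁ : SolHB ψ φ ω₁) (h₂ : SolHB ψ φ ω₂)
    (hs₁ : ∀ p ∈ Sig, ω₁ p = 0) (hs₂ : ∀ p ∈ Sig, ω₂ p = 0) : Set.EqOn ω₁ ω₂ B4p := by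
  obtain ⟨a1, a2, -, a3, a4, a5, -, a6, a7⟩ := h₁
  obtain ⟨b1, b2, -, b3, b4, b5, -, b6, b7⟩ := h₂
  have a2' : ∀ x ∈ Bp, ContDiffAt ℝ 4 ω₁ x := fun x hx => a2.contDiffAt (isOpen_Bp.mem_nhds hx)
  have b2' : ∀ x ∈ Bp, ContDiffAt ℝ 4 ω₂ x := fun x hx => b2.contDiffAt (isOpen_Bp.mem_nhds hx)
  have c1 : ContDiff ℝ 3 fun y => (-1) * ω₂ y := contDiff_const.mul b1
  have da : ∀ x, DifferentiableAt ℝ ω₁ x := fun x => a1.contDiffAt.diff (by norm_num)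
  have db : ∀ x, DifferentiableAt ℝ (fun y => (-1) * ω₂ y) x :=
    fun x => c1.contDiffAt.diff (by norm_num)
  have key := homogeneous_problem_trivial (w := fun y => ω₁ y + (-1) * ω₂ y) (a1.add c1)
    (fun x hx => (a2' x hx).add (contDiffAt_const.mul (b2' x hx)))
    (fun x hx => by
      have e1 : lap (fun y => ω₁ y + (-1) * ω₂ y) = fun y => lap ω₁ y + (-1) * lap ω₂ y := by
        ext y
        rw [lap_add (a1.contDiffAt.of_le (by norm_num)) (c1.contDiffAt.of_le (by norm_num)),
          lap_const_mul]
      rw [e1, lap_add ((a2' x hx).lap (by norm_num))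
        (contDiffAt_const.mul ((b2' x hx).lap (by norm_num))), lap_const_mul, a3 x hx.1 hx.2,
        b3 x hx.1 hx.2]
      ring)
    (fun x hx => by
      rw [P3M_add hx.1.1 a1.contDiffAt c1.contDiffAt, P3M_const_mul, a4 x hx, b4 x hx]; ring)
    (fun x hx => by
      rw [P3N_add a1.contDiffAt c1.contDiffAt, P3N_const_mul, a5 x hx, b5 x hx]; ring)
    (fun x hx => by
      have h1 := a6 x hx
      have h2 := b6 x hx
      simp only [muM_eq] at h1 h2
      rw [Dr_add (da x) (db x), Dr_const_mul]; linarith)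
    (fun x hx => by
      have h1 := a7 x hx
      have h2 := b7 x hx
      simp only [muN_eq] at h1 h2
      rw [pd_add (da x) (db x), pd_const_mul]; linarith)
    (fun x hx => by simp only [hs₁ x hx, hs₂ x hx]; ring)
  intro x hx
  have := key x hx
  linarith

/-! ### Boundary operators on products with harmonic functions -/

theorem lap_pd {u : E4 → ℝ} {x : E4} (h : ContDiffAt ℝ 3 u x) (k : Fin 4) :
    lap (pd k u) x = pd k (lap u) x := by
  have hii : ∀ i, DifferentiableAt ℝ (pd i (pd i u)) x := fun i =>
    ((h.pd (m := 2) (by norm_num) i).pd (m := 1) (by norm_num) i).diff le_rfl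
  have e1 : pd k (lap u) x = ∑ i, pd k (pd i (pd i u)) x := by
    have : lap u = fun y => ∑ i, pd i (pd i u) y := rfl
    rw [this, pd_sum fun i _ => hii i]
  rw [e1, lap_eq]
  refine Finset.sum_congr rfl fun i _ => ?_
  have e2 : pd i (pd k u) =ᶠ[𝓝 x] pd k (pd i u) := by
    filter_upwards [h.eventually (by simp)] with y hy
    exact pd_comm (hy.of_le (by norm_num)) i k
  rw [(pd_congr e2 i).eq_of_nhds, pd_comm (h.pd (by norm_num) i) i k]

theorem lap3_pd {u : E4 → ℝ} {x : E4} (h : ContDiffAt ℝ 3 u x) (k : Fin 4) :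
    lap3 (pd k u) x = pd k (lap3 u) x := by
  have hii : ∀ i : Fin 3, DifferentiableAt ℝ (pd i.castSucc (pd i.castSucc u)) x := fun i =>
    ((h.pd (m := 2) (by norm_num) _).pd (m := 1) (by norm_num) _).diff le_rfl
  have e1 : pd k (lap3 u) x = ∑ i : Fin 3, pd k (pd i.castSucc (pd i.castSucc u)) x := by
    have : lap3 u = fun y => ∑ i : Fin 3, pd i.castSucc (pd i.castSucc u) y := rfl
    rw [this, pd_sum fun i _ => hii i]
  rw [e1, lap3_eq]
  refine Finset.sum_congr rfl fun i _ => ?_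
  have e2 : pd i.castSucc (pd k u) =ᶠ[𝓝 x] pd k (pd i.castSucc u) := by
    filter_upwards [h.eventually (by simp)] with y hy
    exact pd_comm (hy.of_le (by norm_num)) _ k
  rw [(pd_congr e2 _).eq_of_nhds, pd_comm (h.pd (by norm_num) _) _ k]

theorem contDiffAt_coord {n : WithTop ℕ∞} (j : Fin 4) (x : E4) :
    ContDiffAt ℝ n (fun y : E4 => y j) x := (contDiff_coord j).contDiffAt

theorem differentiableAt_coord (j : Fin 4) (x : E4) :
    DifferentiableAt ℝ (fun y : E4 => y j) x := (contDiffAt_coord (n := 1) j x).diff le_rfl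

theorem lap_coord_mul {U : E4 → ℝ} {x : E4} (hU : ContDiffAt ℝ 2 U x) (hl : lap U x = 0) :
    lap (fun y => y 3 * U y) x = 2 * pd 3 U x := by
  rw [lap_mul (contDiffAt_coord 3 x) hU, hl, lap_coord]
  simp [pd_coord]

/-- A product whose first factor vanishes at `x` is differentiable there as soon as the second
factor is continuous. -/
theorem hasFDerivAt_mul_of_eq_zero {a b : E4 → ℝ} {x : E4} (ha : DifferentiableAt ℝ a x)
    (hb : ContinuousAt b x) (h0 : a x = 0) :
    HasFDerivAt (fun y => a y * b y) (b x • fderiv ℝ a x) x := by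
  have h1 : HasFDerivAt (fun y => a y * b x) (b x • fderiv ℝ a x) x := by
    simpa [mul_comm] using ha.hasFDerivAt.mul_const (b x)
  have h2 : HasFDerivAt (fun y => a y * (b y - b x)) (0 : E4 →L[ℝ] ℝ) x := by
    rw [hasFDerivAt_iff_isLittleO]
    have hO : (fun y => a y) =O[𝓝 x] fun y => y - x := by
      simpa [h0] using ha.isBigO_sub
    have ho : (fun y => b y - b x) =o[𝓝 x] fun _ => (1 : ℝ) := by
      rw [Asymptotics.isLittleO_one_iff]
      simpa using hb.tendsto.sub_const (b x)
    have := hO.norm_right.mul_isLittleO ho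
    simp only [h0, zero_mul, sub_zero, ContinuousLinearMap.zero_apply]
    exact (by simpa using this : _ =o[𝓝 x] fun y => ‖y - x‖).of_norm_right
  have := h1.fun_add h2
  simp only [add_zero] at this
  refine this.congr_of_eventuallyEq (Filter.Eventually.of_forall fun y => ?_)
  simp only
  ring

theorem fderiv_inward_eq_zero {X : E4 → ℝ} {x v : E4} (hx : x ∈ B4p) (hv : x + v ∈ B4p)
    (hd : DifferentiableAt ℝ X x) (h : ∀ y ∈ B4p, X y = 0) : fderiv ℝ X x v = 0 := by
  have hmax : IsMaxOn X B4p x := fun y hy => by rw [Set.mem_ofPred, h y hy, h x hx]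
  have hmin : IsMinOn X B4p x := fun y hy => by rw [Set.mem_ofPred, h y hy, h x hx]
  have hcone := mem_posTangentConeAt_of_segment_subset (x := x) (y := v)
    (convex_B4p.segment_subset hx hv)
  exact le_antisymm
    (hmax.localize.hasFDerivWithinAt_nonpos hd.hasFDerivAt.hasFDerivWithinAt hcone)
    (hmin.localize.hasFDerivWithinAt_nonneg hd.hasFDerivAt.hasFDerivWithinAt hcone)

theorem biharmonic_coord_mul {U ω : E4 → ℝ} {x : E4}
    (hU : ∀ᶠ y in 𝓝 x, ContDiffAt ℝ 4 U y ∧ lap U y = 0)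
    (hω : ω =ᶠ[𝓝 x] fun y => y 3 * U y) : lap (lap ω) x = 0 := by
  have h1 : lap ω =ᶠ[𝓝 x] fun y => 2 * pd 3 U y := by
    filter_upwards [lap_congr hω, hU] with y h1 h2
    rw [h1, lap_coord_mul (h2.1.of_le (by norm_num)) h2.2]
  have h2 : lap U =ᶠ[𝓝 x] fun _ => 0 := hU.mono fun y hy => hy.2
  rw [(lap_congr h1).eq_of_nhds, lap_const_mul, lap_pd (hU.self_of_nhds.1.of_le (by norm_num)),
    (pd_congr h2 3).eq_of_nhds, pd_const, mul_zero]

theorem P3N_coord_mul_harmonic {ω U : E4 → ℝ} (hω : ContDiff ℝ 3 ω)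
    (hU : ∀ y ∈ Bp, ContDiffAt ℝ 4 U y ∧ lap U y = 0) (hωU : ∀ y ∈ Bp, ω y = y 3 * U y)
    (h0 : ∀ y : E4, ‖y‖ < 1 → y 3 = 0 → ω y = 0) {x : E4} (hx : x ∈ Nfb \ Sig) :
    P3N ω x = 0 := by
  have hl : ∀ y, ContDiffAt ℝ 1 (lap ω) y := fun y => hω.contDiffAt.lap (by norm_num)
  have hl3 : ∀ y, ContDiffAt ℝ 1 (lap3 ω) y := fun y => hω.contDiffAt.lap3 (by norm_num)
  have hc : Continuous (pd 3 (lap ω)) := by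
    have : ContDiff ℝ 0 (pd 3 (lap ω)) := contDiff_iff_contDiffAt.2 fun y =>
      (hl y).pd (by norm_num) 3
    exact this.continuous
  have hc3 : Continuous (lap3 ω) := (contDiff_iff_contDiffAt.2 hl3).continuous
  set Z : E4 → ℝ := fun y => y 3 * pd 3 (lap ω) y + 2 * lap3 ω y with hZ
  have hintr : ∀ y ∈ Bp, Z y = 0 := by
    intro y hy
    have hev : ω =ᶠ[𝓝 y] fun z => z 3 * U z := by
      filter_upwards [isOpen_Bp.mem_nhds hy] with z hz using hωU z hz
    have hevU : ∀ᶠ z in 𝓝 y, ContDiffAt ℝ 4 U z ∧ lap U z = 0 := by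
      filter_upwards [isOpen_Bp.mem_nhds hy] with z hz using hU z hz
    obtain ⟨h4, hl0⟩ := hU y hy
    have h2 : ContDiffAt ℝ 2 U y := h4.of_le (by norm_num)
    have h1 : lap ω =ᶠ[𝓝 y] fun z => 2 * pd 3 U z := by
      filter_upwards [lap_congr hev, hevU] with z h1 h2
      rw [h1, lap_coord_mul (h2.1.of_le (by norm_num)) h2.2]
    have h3 : lap3 ω y = y 3 * lap3 U y := by
      rw [(lap3_congr hev).eq_of_nhds, lap3_eq, lap3_eq, Finset.mul_sum]
      refine Finset.sum_congr rfl fun i _ => ?_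
      have hi : ¬ (3 : Fin 4) = i.castSucc := (Fin.castSucc_lt_last i).ne'
      have hcc : pd i.castSucc (fun z : E4 => z 3) = fun _ => 0 := by
        ext z; rw [pd_coord, if_neg hi]
      rw [pd_pd_mul (contDiffAt_coord 3 y) h2, hcc, pd_const]
      ring
    have h5 := lap_eq_lap3_add U y
    rw [hl0] at h5
    simp only [hZ]
    rw [(pd_congr h1 3).eq_of_nhds, pd_const_mul, h3]
    linear_combination (-2 * y 3) * h5
  have hcZ : Continuous Z := ((continuous_coord 3).mul hc).add (continuous_const.mul hc3)
  have hZ0 : ∀ y ∈ B4p, Z y = 0 := fun y hy =>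
    continuous_eq_on_B4p hcZ.continuousOn continuousOn_const hintr hy
  obtain ⟨hn, hx3⟩ := mem_Nfb_diff.1 hx
  have hZd := (hasFDerivAt_mul_of_eq_zero (differentiableAt_coord 3 x) hc.continuousAt
    hx3).fun_add (((hl3 x).diff le_rfl).hasFDerivAt.const_mul 2)
  have hy : x + (1 - ‖x‖) • e4 3 ∈ B4p := by
    refine ⟨?_, ?_⟩
    · calc ‖x + (1 - ‖x‖) • e4 3‖ ≤ ‖x‖ + ‖(1 - ‖x‖) • e4 3‖ := norm_add_le _ _
        _ = 1 := by
          rw [norm_smul, norm_e4, Real.norm_of_nonneg (sub_nonneg.2 hn.le)]; ring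
    · simp [e4_apply, hx3, hn.le]
  have h1 := fderiv_inward_eq_zero (Nfb_subset_B4p hx.1) hy hZd.differentiableAt hZ0
  rw [map_smul, smul_eq_mul, hZd.fderiv] at h1
  have h2 := (mul_eq_zero.1 h1).resolve_left (sub_pos.2 hn).ne'
  have h3 : pd 3 (fun y : E4 => y 3) x = 1 := by simp [pd_coord]
  simp only [ContinuousLinearMap.add_apply, ContinuousLinearMap.smul_apply, smul_eq_mul] at h2
  rw [← pd, ← pd, h3] at h2
  simp only [P3N, muN_eq]
  rw [lap3_pd hω.contDiffAt]
  linarith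

/-- The defining function `(1 - ‖y‖²) / 2` of the unit ball. -/
def rhoBar (y : E4) : ℝ := 1 / 2 + (-1 / 2) * ‖y‖ ^ 2

theorem contDiff_rhoBar {n : WithTop ℕ∞} : ContDiff ℝ n rhoBar :=
  contDiff_const.add (contDiff_const.mul (contDiff_norm_sq ℝ))

theorem pd_rhoBar (i : Fin 4) (x : E4) : pd i rhoBar x = -x i := by
  have hns : DifferentiableAt ℝ (fun y : E4 => -1 / 2 * ‖y‖ ^ 2) x :=
    ((contDiff_const (n := 1)).mul (contDiff_norm_sq ℝ)).contDiffAt.diff le_rfl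
  have : rhoBar = fun y : E4 => 1 / 2 + (-1 / 2) * ‖y‖ ^ 2 := rfl
  rw [this, pd_add (differentiableAt_const _) hns, pd_const, pd_const_mul, pd_norm_sq]
  ring

theorem Dr_rhoBar (x : E4) : Dr rhoBar x = -‖x‖ ^ 2 := by
  rw [Dr_eq_sum, norm_sq_eq_sum, ← Finset.sum_neg_distrib]
  exact Finset.sum_congr rfl fun i _ => by rw [pd_rhoBar]; ring

theorem lap_rhoBar (x : E4) : lap rhoBar x = -4 := by
  have : ∀ i, pd i rhoBar = fun y => (-1) * y i := fun i => by ext y; rw [pd_rhoBar]; ring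
  simp only [lap_eq, this, pd_const_mul, pd_coord]
  simp

theorem lap_rhoBar_mul {H : E4 → ℝ} {x : E4} (hH : ContDiffAt ℝ 2 H x) (hl : lap H x = 0) :
    lap (fun y => rhoBar y * H y) x = (-4) * H x + (-2) * Dr H x := by
  rw [lap_mul contDiff_rhoBar.contDiffAt hH, hl, lap_rhoBar, Dr_eq_sum]
  simp only [pd_rhoBar, Finset.mul_sum]
  have : ∑ i, 2 * (-x i * pd i H x) = ∑ i, (-2) * (x i * pd i H x) :=
    Finset.sum_congr rfl fun i _ => by ring
  rw [this]; ring

theorem biharmonic_rhoBar_mul {H ω : E4 → ℝ} {x : E4}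
    (hH : ∀ᶠ y in 𝓝 x, ContDiffAt ℝ 4 H y ∧ lap H y = 0)
    (hω : ω =ᶠ[𝓝 x] fun y => rhoBar y * H y) : lap (lap ω) x = 0 := by
  have h1 : lap ω =ᶠ[𝓝 x] fun y => (-4) * H y + (-2) * Dr H y := by
    filter_upwards [lap_congr hω, hH] with y h1 h2
    rw [h1, lap_rhoBar_mul (h2.1.of_le (by norm_num)) h2.2]
  have h2 : lap H =ᶠ[𝓝 x] fun _ => 0 := hH.mono fun y hy => hy.2
  have h4 := hH.self_of_nhds.1
  have h3 : Dr (fun _ : E4 => (0 : ℝ)) x = 0 := by simp [Dr]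
  rw [(lap_congr h1).eq_of_nhds, lap_add (contDiffAt_const.mul (h4.of_le (by norm_num)))
    (contDiffAt_const.mul (h4.Dr (by norm_num))), lap_const_mul, lap_const_mul,
    lap_Dr (h4.of_le (by norm_num)), (Dr_congr h2).eq_of_nhds, h2.eq_of_nhds, h3]
  ring

theorem P3M_rhoBar_mul_harmonic {ω H : E4 → ℝ} (hω : ContDiff ℝ 3 ω)
    (hH : ∀ y ∈ Bp, ContDiffAt ℝ 4 H y ∧ lap H y = 0) (hωH : ∀ y ∈ Bp, ω y = rhoBar y * H y)
    (h0 : ∀ y ∈ Mhs, ω y = 0) {x : E4} (hx : x ∈ Mhs \ Sig) : P3M ω x = 0 := by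
  have hl : ∀ y, ContDiffAt ℝ 1 (lap ω) y := fun y => hω.contDiffAt.lap (by norm_num)
  have hD : ∀ y, ContDiffAt ℝ 2 (Dr ω) y := fun y => hω.contDiffAt.Dr (by norm_num)
  have hDD : ∀ y, ContDiffAt ℝ 1 (Dr (Dr ω)) y := fun y => (hD y).Dr (by norm_num)
  have hc : Continuous (Dr (lap ω)) := by
    have : ContDiff ℝ 0 (Dr (lap ω)) := contDiff_iff_contDiffAt.2 fun y => (hl y).Dr (by norm_num)
    exact this.continuous
  set G : E4 → ℝ := fun y => ‖y‖ ^ 2 * lap ω y + ((-1) * Dr (Dr ω) y + (-2) * Dr ω y) with hG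
  have hn2 : ∀ y, DifferentiableAt ℝ (fun z : E4 => ‖z‖ ^ 2) y := fun y =>
    (contDiff_norm_sq ℝ (n := 1)).contDiffAt.diff le_rfl
  have dl : ∀ y, DifferentiableAt ℝ (lap ω) y := fun y => (hl y).diff le_rfl
  have d1 : ∀ y, DifferentiableAt ℝ (fun z => (-2) * Dr ω z) y := fun y =>
    ((hD y).diff (by norm_num)).const_mul _
  have d2 : ∀ y, DifferentiableAt ℝ (fun z => (-1) * Dr (Dr ω) z) y := fun y =>
    ((hDD y).diff le_rfl).const_mul _
  have hGd : ∀ y, DifferentiableAt ℝ G y := fun y =>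
    ((hn2 y).fun_mul (dl y)).fun_add ((d2 y).fun_add (d1 y))
  set Z : E4 → ℝ := fun y => rhoBar y * Dr (lap ω) y + (-2) * G y with hZ
  have hcZ : Continuous Z := ((contDiff_rhoBar (n := 0)).continuous.mul hc).add
    (continuous_const.mul (continuous_iff_continuousAt.2 fun y => (hGd y).continuousAt))
  have hintr : ∀ y ∈ Bp, Z y = 0 := by
    intro y hy
    have hev : ω =ᶠ[𝓝 y] fun z => rhoBar z * H z := by
      filter_upwards [isOpen_Bp.mem_nhds hy] with z hz using hωH z hz
    have hevH : ∀ᶠ z in 𝓝 y, ContDiffAt ℝ 4 H z ∧ lap H z = 0 := by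
      filter_upwards [isOpen_Bp.mem_nhds hy] with z hz using hH z hz
    obtain ⟨h4, hl0⟩ := hH y hy
    have dH := h4.diff (by norm_num)
    have dDH := (h4.Dr (m := 1) (by norm_num)).diff le_rfl
    have dr : ∀ z, DifferentiableAt ℝ rhoBar z := fun z =>
      (contDiff_rhoBar (n := 1)).contDiffAt.diff le_rfl
    have h1 : lap ω =ᶠ[𝓝 y] fun z => (-4) * H z + (-2) * Dr H z := by
      filter_upwards [lap_congr hev, hevH] with z h1 h2
      rw [h1, lap_rhoBar_mul (h2.1.of_le (by norm_num)) h2.2]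
    have h2 : Dr ω =ᶠ[𝓝 y] fun z => rhoBar z * Dr H z + H z * ((-1) * ‖z‖ ^ 2) := by
      filter_upwards [Dr_congr hev, hevH] with z h1 h2
      rw [h1, Dr_mul (dr z) (h2.1.diff (by norm_num)), Dr_rhoBar]
      ring
    have h3 : Dr (Dr ω) y = rhoBar y * Dr (Dr H) y + Dr H y * (-‖y‖ ^ 2) +
        (H y * ((-1) * (2 * ‖y‖ ^ 2)) + (-1) * ‖y‖ ^ 2 * Dr H y) := by
      rw [(Dr_congr h2).eq_of_nhds, Dr_add ((dr y).fun_mul dDH)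
        (dH.fun_mul ((hn2 y).const_mul _)), Dr_mul (dr y) dDH,
        Dr_mul dH ((hn2 y).const_mul _), Dr_const_mul, Dr_norm_sq, Dr_rhoBar]
    simp only [hZ, hG]
    rw [(Dr_congr h1).eq_of_nhds, Dr_add (dH.const_mul _) (dDH.const_mul _), Dr_const_mul,
      Dr_const_mul, h1.eq_of_nhds, h3, h2.eq_of_nhds]
    ring
  have hZ0 : ∀ y ∈ B4p, Z y = 0 := fun y hy =>
    continuous_eq_on_B4p hcZ.continuousOn continuousOn_const hintr hy
  obtain ⟨hn, hx3⟩ := mem_Mhs_diff.1 hx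
  have hr0 : rhoBar x = 0 := by rw [rhoBar, hn]; norm_num
  have hZd := (hasFDerivAt_mul_of_eq_zero ((contDiff_rhoBar (n := 1)).contDiffAt.diff le_rfl)
    hc.continuousAt hr0).fun_add ((hGd x).hasFDerivAt.const_mul (-2))
  have h1 := Dr_eq_zero_of_eq_zero_on_B4p (Mhs_subset_B4p hx.1) hZd.differentiableAt hZ0
  rw [Dr, hZd.fderiv] at h1
  simp only [ContinuousLinearMap.add_apply, ContinuousLinearMap.smul_apply, smul_eq_mul] at h1
  rw [← Dr, ← Dr, Dr_rhoBar, hn] at h1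
  have h2 : Dr G x = lap ω x * 2 + Dr (lap ω) x - Dr (Dr (Dr ω)) x - 2 * Dr (Dr ω) x := by
    rw [hG, Dr_add ((hn2 x).fun_mul (dl x)) ((d2 x).fun_add (d1 x)), Dr_mul (hn2 x) (dl x),
      Dr_add (d2 x) (d1 x), Dr_const_mul, Dr_const_mul, Dr_norm_sq, hn]
    ring
  have h3 : sphLap ω x = 0 := by
    rw [sphLap_congr (g := fun _ => 0) hn, sphLap_zero]
    filter_upwards [(isOpen_lt continuous_const (continuous_coord 3)).mem_nhds hx3] with y hy hy1
    exact h0 y ⟨hy1, le_of_lt hy⟩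
  have h4 : muM ω = fun y => (-1) * Dr ω y := by ext y; rw [muM_eq]; ring
  rw [P3M, h3, h4, sphLap_const_mul, sphLap_eq hn (hD x), lap_Dr hω.contDiffAt, muM_eq]
  rw [h2] at h1
  simp only
  linarith

/-! ### Zonal functions on the sphere -/

theorem pd_zonal {f : ℝ → ℝ} {x : E4} (hf : DifferentiableAt ℝ f (x 3)) (i : Fin 4) :
    pd i (fun y => f (y 3)) x = deriv f (x 3) * if 3 = i then 1 else 0 := by
  have h := hf.hasDerivAt.comp_hasFDerivAt x (differentiableAt_coord 3 x).hasFDerivAt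
  have h2 : (fun y : E4 => f (y 3)) = f ∘ fun y => y 3 := rfl
  rw [pd, h2, h.fderiv, ← pd_coord i 3 x]
  rfl

theorem Dr_zonal {f : ℝ → ℝ} {x : E4} (hf : DifferentiableAt ℝ f (x 3)) :
    Dr (fun y => f (y 3)) x = x 3 * deriv f (x 3) := by
  rw [Dr_eq_sum]
  simp [pd_zonal hf]

theorem ContDiffAt.deriv_one {f : ℝ → ℝ} {t : ℝ} (hf : ContDiffAt ℝ 2 f t) :
    ContDiffAt ℝ 1 (deriv f) t := by
  have h := (hf.fderiv_right (m := 1) (by norm_num)).clm_apply (contDiffAt_const (c := (1 : ℝ)))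
  exact h

theorem sphLap_zonal {f : ℝ → ℝ} {x : E4} (hx : ‖x‖ = 1) (hf : ContDiffAt ℝ 2 f (x 3)) :
    sphLap (fun y => f (y 3)) x =
      (1 - x 3 ^ 2) * deriv (deriv f) (x 3) - 3 * x 3 * deriv f (x 3) := by
  have hF : ContDiffAt ℝ 2 (fun y : E4 => f (y 3)) x :=
    ContDiffAt.comp (g := f) (f := fun y : E4 => y 3) x hf (contDiffAt_coord 3 x)
  have hev : ∀ᶠ y : E4 in 𝓝 x, DifferentiableAt ℝ f (y 3) := by
    have := (hf.eventually (by simp)).mono fun t ht => ht.differentiableAt (by norm_num)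
    exact (continuous_coord 3).continuousAt.eventually this
  have hd : DifferentiableAt ℝ (deriv f) (x 3) := hf.deriv_one.differentiableAt one_ne_zero
  have hd' : DifferentiableAt ℝ (fun y : E4 => deriv f (y 3)) x :=
    DifferentiableAt.comp (g := deriv f) (f := fun y : E4 => y 3) x hd (differentiableAt_coord 3 x)
  have h1 : lap (fun y : E4 => f (y 3)) x = deriv (deriv f) (x 3) := by
    have hi : ∀ i, pd i (pd i fun y : E4 => f (y 3)) x =
        if 3 = i then deriv (deriv f) (x 3) else 0 := fun i => by
      have : pd i (fun y : E4 => f (y 3)) =ᶠ[𝓝 x]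
          fun y => (if 3 = i then 1 else 0) * deriv f (y 3) := by
        filter_upwards [hev] with y hy
        rw [pd_zonal hy i, mul_comm]
      rw [(pd_congr this i).eq_of_nhds, pd_const_mul, pd_zonal hd]
      split_ifs <;> simp
    rw [lap_eq, Finset.sum_congr rfl fun i _ => hi i]
    simp
  have h2 : Dr (Dr fun y : E4 => f (y 3)) x =
      x 3 * (x 3 * deriv (deriv f) (x 3)) + deriv f (x 3) * x 3 := by
    have : Dr (fun y : E4 => f (y 3)) =ᶠ[𝓝 x] fun y => y 3 * deriv f (y 3) := by
      filter_upwards [hev] with y hy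
      exact Dr_zonal hy
    rw [(Dr_congr this).eq_of_nhds, Dr_mul (differentiableAt_coord 3 x) hd', Dr_zonal hd, Dr_coord]
  rw [sphLap_eq hx hF, h1, h2, Dr_zonal hev.self_of_nhds]
  ring

theorem pd_sub_Dr_congr {f g : E4 → ℝ} {x : E4} (hx : ‖x‖ = 1) (hf : DifferentiableAt ℝ f x)
    (hg : DifferentiableAt ℝ g x) (h : ∀ᶠ y in 𝓝 x, ‖y‖ = 1 → f y = g y) (i : Fin 4) :
    pd i f x - x i * Dr f x = pd i g x - x i * Dr g x := by
  have hx0 : x ≠ 0 := norm_ne_zero_iff.1 (by rw [hx]; exact one_ne_zero)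
  have hN : ‖x‖⁻¹ • x = x := by simp [hx]
  have hc : ContinuousAt (fun y : E4 => ‖y‖⁻¹ • y) x := (hasFDerivAt_normalize hx0).continuousAt
  have hev : (fun y => f (‖y‖⁻¹ • y)) =ᶠ[𝓝 x] fun y => g (‖y‖⁻¹ • y) := by
    rw [← hN] at h
    filter_upwards [hc.eventually h, isOpen_ne.mem_nhds hx0] with y h1 h2
    exact h1 (by rw [norm_smul, norm_inv, norm_norm, inv_mul_cancel₀ (norm_ne_zero_iff.2 h2)])
  have h1 := (pd_congr hev i).eq_of_nhds
  rw [pd_comp_normalize hx0 (by rwa [hN]), pd_comp_normalize hx0 (by rwa [hN]), hN, hx] at h1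
  simpa using h1

theorem P3M_coord_mul_harmonic {U ω : E4 → ℝ} {e : ℝ → ℝ} {x : E4} (hx : ‖x‖ = 1)
    (hU : ContDiffAt ℝ 4 U x) (hl : ∀ᶠ y in 𝓝 x, lap U y = 0)
    (hω : ω =ᶠ[𝓝 x] fun y => y 3 * U y) (he : ContDiffAt ℝ 2 e (x 3))
    (hE : ∀ᶠ y in 𝓝 x, ‖y‖ = 1 → U y + Dr U y = e (y 3)) :
    P3M ω x = -3 * (1 - x 3 ^ 2) * deriv e (x 3) + 6 * x 3 * e (x 3)
      - x 3 * (1 - x 3 ^ 2) * deriv (deriv e) (x 3) + 3 * x 3 ^ 2 * deriv e (x 3) := by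
  have hU4 : ∀ᶠ y in 𝓝 x, ContDiffAt ℝ 4 U y := hU.eventually (by simp)
  have hω2 : ContDiffAt ℝ 2 ω x :=
    ((contDiffAt_coord 3 x).mul (hU.of_le (by norm_num))).congr_of_eventuallyEq hω
  have hU2 : ContDiffAt ℝ 2 U x := hU.of_le (by norm_num)
  have dU := hU.diff (by norm_num)
  have dDU := (hU.Dr (m := 1) (by norm_num)).diff le_rfl
  have dc := differentiableAt_coord 3 x
  have h1 : lap ω =ᶠ[𝓝 x] fun y => 2 * pd 3 U y := by
    filter_upwards [lap_congr hω, hU4, hl] with y h1 h2 h3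
    rw [h1, lap_coord_mul (h2.of_le (by norm_num)) h3]
  have h2 : Dr ω =ᶠ[𝓝 x] fun y => y 3 * (U y + Dr U y) := by
    filter_upwards [Dr_congr hω, hU4] with y h1 h2
    rw [h1, Dr_mul (differentiableAt_coord 3 y) (h2.diff (by norm_num)), Dr_coord]
    ring
  have h3 : muM ω = fun y => (-1) * Dr ω y := by ext y; rw [muM_eq]; ring
  have h4 : sphLap (Dr ω) x = sphLap (fun y => (fun t => t * e t) (y 3)) x := by
    refine sphLap_congr hx ?_
    filter_upwards [h2, hE] with y h5 h6 h7
    rw [h5, h6 h7]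
  have hte : ContDiffAt ℝ 2 (fun t => t * e t) (x 3) := contDiffAt_id.mul he
  have hev : ∀ᶠ t in 𝓝 (x 3), DifferentiableAt ℝ e t :=
    (he.eventually (by simp)).mono fun t ht => ht.differentiableAt (by norm_num)
  have h5 : deriv (fun t => t * e t) =ᶠ[𝓝 (x 3)] fun t => e t + t * deriv e t := by
    filter_upwards [hev] with t ht
    have := ((hasDerivAt_id t).fun_mul ht.hasDerivAt).deriv
    simpa using this
  have hde : DifferentiableAt ℝ (deriv e) (x 3) := he.deriv_one.differentiableAt one_ne_zero
  have h6 : deriv (deriv fun t => t * e t) (x 3) =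
      deriv e (x 3) + (deriv e (x 3) + x 3 * deriv (deriv e) (x 3)) := by
    rw [h5.deriv_eq]
    have := (hev.self_of_nhds.hasDerivAt.fun_add
      ((hasDerivAt_id (x 3)).fun_mul hde.hasDerivAt)).deriv
    simpa using this
  have h7 := pd_sub_Dr_congr (f := fun y => U y + Dr U y) (g := fun y => e (y 3)) hx
    (dU.fun_add dDU)
    (DifferentiableAt.comp (g := e) (f := fun y : E4 => y 3) x hev.self_of_nhds dc) hE 3
  rw [pd_add dU dDU, Dr_add dU dDU, pd_zonal hev.self_of_nhds, Dr_zonal hev.self_of_nhds,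
    if_pos rfl] at h7
  have h8 := pd_Dr hU2 3
  rw [P3M, h3, sphLap_const_mul, h4, sphLap_zonal hx hte, h6, h5.eq_of_nhds, sphLap_eq hx hω2,
    h1.eq_of_nhds, (Dr_congr h2).eq_of_nhds, h2.eq_of_nhds, muM_eq]
  simp only
  rw [(Dr_congr h1).eq_of_nhds, Dr_const_mul, Dr_mul dc (dU.fun_add dDU), Dr_add dU dDU, Dr_coord,
    hE.self_of_nhds hx]
  have h9 := hE.self_of_nhds hx
  linear_combination h8 - h7

section

open MeasureTheory

/-- Smooth blending of two functions along disjoint closed sets. -/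
theorem exists_contDiff_glue {E : Type*} [NormedAddCommGroup E] [NormedSpace ℝ E]
    [FiniteDimensional ℝ E] {n : ℕ∞} {s t : Set E} (hs : IsClosed s) (ht : IsClosed t)
    (hd : Disjoint s t) {f g : E → ℝ} (hf : ∀ x ∉ s, ContDiffAt ℝ n f x)
    (hg : ∀ x ∉ t, ContDiffAt ℝ n g x) :
    ∃ F : E → ℝ, ContDiff ℝ n F ∧ (∀ x ∈ s, F =ᶠ[𝓝 x] g) ∧ (∀ x ∈ t, F =ᶠ[𝓝 x] f) ∧
      ∀ x, f x = g x → F x = f x := by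
  obtain ⟨χ, h0, h1, -⟩ :=
    exists_contMDiffMap_zero_one_nhds_of_isClosed (n := n) (modelWithCornersSelf ℝ E) hs ht hd
  have hχ : ContDiff ℝ n χ := χ.contMDiff.contDiff
  rw [eventually_nhdsSet_iff_forall] at h0 h1
  have hsE : ∀ x ∈ s, (fun y => g y + χ y * (f y - g y)) =ᶠ[𝓝 x] g := fun x hx => by
    filter_upwards [h0 x hx] with y hy
    rw [hy]; ring
  have htE : ∀ x ∈ t, (fun y => g y + χ y * (f y - g y)) =ᶠ[𝓝 x] f := fun x hx => by
    filter_upwards [h1 x hx] with y hy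
    rw [hy]; ring
  refine ⟨fun y => g y + χ y * (f y - g y), contDiff_iff_contDiffAt.2 fun x => ?_, hsE, htE,
    fun x hx => by simp [hx]⟩
  by_cases hxs : x ∈ s
  · exact (hg x fun hxt => hd.le_bot ⟨hxs, hxt⟩).congr_of_eventuallyEq (hsE x hxs)
  · by_cases hxt : x ∈ t
    · exact (hf x hxs).congr_of_eventuallyEq (htE x hxt)
    · exact (hg x hxt).add (hχ.contDiffAt.mul ((hf x hxs).sub (hg x hxt)))

theorem exists_contDiff_extension {E : Type*} [NormedAddCommGroup E] [NormedSpace ℝ E]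
    [FiniteDimensional ℝ E] {n : ℕ∞} {U K : Set E} (hU : IsOpen U) (hK : IsClosed K)
    (hKU : K ⊆ U) {f : E → ℝ} (hf : ∀ x ∈ U, ContDiffAt ℝ n f x) :
    ∃ F : E → ℝ, ContDiff ℝ n F ∧ ∀ x ∈ K, F =ᶠ[𝓝 x] f := by
  obtain ⟨F, h1, -, h2, -⟩ := exists_contDiff_glue (n := n) (f := f) (g := fun _ => 0)
    hU.isClosed_compl hK (Set.disjoint_left.2 fun x hx hxK => hx (hKU hxK))
    (fun x hx => hf x (by simpa using hx)) (fun x _ => contDiffAt_const)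
  exact ⟨F, h1, h2⟩

section ParametricIntegral

set_option linter.unusedSectionVars false

variable {X Z F : Type} [NormedAddCommGroup X] [NormedSpace ℝ X] [ProperSpace X]
  [NormedAddCommGroup Z] [NormedSpace ℝ Z] [MeasurableSpace Z] [BorelSpace Z]
  [NormedAddCommGroup F] [NormedSpace ℝ F]

theorem continuousOn_slice {K : X → Z → F} {C : Set Z} {x : X}
    (h : ∀ ζ ∈ C, ContinuousAt (Function.uncurry K) (x, ζ)) : ContinuousOn (K x) C := by
  intro ζ hζ
  have h2 : ContinuousAt (fun ζ : Z => (x, ζ)) ζ := by fun_prop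
  exact (ContinuousAt.comp (g := Function.uncurry K) (h ζ hζ) h2).continuousWithinAt

theorem fderiv_slice {K : X → Z → F} {x : X} {ζ : Z}
    (h : DifferentiableAt ℝ (Function.uncurry K) (x, ζ)) :
    HasFDerivAt (fun y => K y ζ) ((fderiv ℝ (Function.uncurry K) (x, ζ)).comp
      (ContinuousLinearMap.inl ℝ X Z)) x := by
  have h2 : HasFDerivAt (fun y : X => (y, ζ)) (ContinuousLinearMap.inl ℝ X Z) x :=
    hasFDerivAt_prodMk_left x ζ
  exact HasFDerivAt.comp x (g := Function.uncurry K) h.hasFDerivAt h2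

theorem contDiffAt_fderiv_slice {n m : WithTop ℕ∞} {K : X → Z → F} {x : X} {ζ : Z}
    (h : ContDiffAt ℝ n (Function.uncurry K) (x, ζ)) (hm : m + 1 ≤ n) :
    ContDiffAt ℝ m (Function.uncurry fun x ζ => fderiv ℝ (fun y => K y ζ) x) (x, ζ) := by
  have h1 : ContDiffAt ℝ m (fun p : X × Z => (fderiv ℝ (Function.uncurry K) p).comp
      (ContinuousLinearMap.inl ℝ X Z)) (x, ζ) :=
    (h.fderiv_right hm).clm_comp contDiffAt_const
  have hn1 : 1 ≤ n := le_trans (by simp) hm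
  refine h1.congr_of_eventuallyEq ?_
  have he := (h.of_le hn1).eventually (by simp)
  filter_upwards [he] with p hp
  exact (fderiv_slice (hp.differentiableAt one_ne_zero)).fderiv

theorem hasFDerivAt_integral_slice {μ : Measure Z} [IsFiniteMeasureOnCompacts μ] {U : Set X}
    (hU : IsOpen U) {C : Set Z} (hC : IsCompact C) {h : Z → ℝ} (hh : ContinuousOn h C)
    {K : X → Z → F}
    (hK : ∀ x ∈ U, ∀ ζ ∈ C, ContDiffAt ℝ 1 (Function.uncurry K) (x, ζ)) {x : X} (hx : x ∈ U) :
    HasFDerivAt (fun x => ∫ ζ in C, h ζ • K x ζ ∂μ)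
      (∫ ζ in C, h ζ • fderiv ℝ (fun y => K y ζ) x ∂μ) x := by
  obtain ⟨ε, hε, hεU⟩ := Metric.nhds_basis_closedBall.mem_iff.1 (hU.mem_nhds hx)
  have hcont : ∀ y ∈ U, ContinuousOn (fun ζ => h ζ • K y ζ) C := fun y hy =>
    hh.smul (continuousOn_slice fun ζ hζ => (hK y hy ζ hζ).continuousAt)
  have hK' : ∀ y ∈ U, ∀ ζ ∈ C, ContinuousAt
      (Function.uncurry fun x ζ => fderiv ℝ (fun y => K y ζ) x) (y, ζ) := fun y hy ζ hζ =>
    (contDiffAt_fderiv_slice (m := 0) (hK y hy ζ hζ) (by simp)).continuousAt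
  have hcont' : ∀ y ∈ U, ContinuousOn (fun ζ => h ζ • fderiv ℝ (fun y => K y ζ) y) C :=
    fun y hy => hh.smul (continuousOn_slice (hK' y hy))
  have hcomp : IsCompact (Metric.closedBall x ε ×ˢ C) := (isCompact_closedBall x ε).prod hC
  obtain ⟨B, hB⟩ := hcomp.exists_bound_of_continuousOn
    (f := fun p : X × Z => h p.2 • fderiv ℝ (fun y => K y p.2) p.1) (by
      intro p hp
      have h1 : ContinuousWithinAt (fun q : X × Z => h q.2) (Metric.closedBall x ε ×ˢ C) p :=
        (hh p.2 hp.2).comp continuous_snd.continuousWithinAt fun q hq => hq.2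
      exact h1.smul (hK' p.1 (hεU hp.1) p.2 hp.2).continuousWithinAt)
  have hmeasC : MeasurableSet C := hC.isClosed.measurableSet
  refine hasFDerivAt_integral_of_dominated_of_fderiv_le (𝕜 := ℝ) (bound := fun _ => B)
    (F' := fun y ζ => h ζ • fderiv ℝ (fun y => K y ζ) y) (Metric.closedBall_mem_nhds x hε)
    ?_ ?_ ?_ ?_ ?_ ?_
  · filter_upwards [hU.mem_nhds hx] with y hy
    exact ((hcont y hy).integrableOn_compact hC).aestronglyMeasurable
  · exact (hcont x hx).integrableOn_compact hC
  · exact ((hcont' x hx).integrableOn_compact hC).aestronglyMeasurable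
  · filter_upwards [ae_restrict_mem hmeasC] with ζ hζ y hy
    exact hB (y, ζ) ⟨hy, hζ⟩
  · exact integrableOn_const hC.measure_lt_top.ne
  · filter_upwards [ae_restrict_mem hmeasC] with ζ hζ y hy
    have := fderiv_slice ((hK y (hεU hy) ζ hζ).differentiableAt one_ne_zero)
    exact this.differentiableAt.hasFDerivAt.const_smul (h ζ)

theorem contDiffOn_integral_slice_nat {μ : Measure Z} [IsFiniteMeasureOnCompacts μ] {U : Set X}
    (hU : IsOpen U) {C : Set Z} (hC : IsCompact C) {h : Z → ℝ} (hh : ContinuousOn h C) (n : ℕ) :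
    ∀ {F : Type} [NormedAddCommGroup F] [NormedSpace ℝ F] {K : X → Z → F},
    (∀ x ∈ U, ∀ ζ ∈ C, ContDiffAt ℝ (⊤ : ℕ∞) (Function.uncurry K) (x, ζ)) →
    ContDiffOn ℝ n (fun x => ∫ ζ in C, h ζ • K x ζ ∂μ) U := by
  induction n with
  | zero =>
    intro F _ _ K hK
    refine contDiffOn_zero.2 fun x hx => ?_
    exact (hasFDerivAt_integral_slice hU hC hh (fun x hx ζ hζ => (hK x hx ζ hζ).of_le
      (by exact_mod_cast le_top)) hx).continuousAt.continuousWithinAt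
  | succ n ih =>
    intro F _ _ K hK
    have hd : ∀ x ∈ U, HasFDerivAt (fun x => ∫ ζ in C, h ζ • K x ζ ∂μ)
      (∫ ζ in C, h ζ • fderiv ℝ (fun y => K y ζ) x ∂μ) x := fun x hx =>
      hasFDerivAt_integral_slice hU hC hh (fun x hx ζ hζ => (hK x hx ζ hζ).of_le
        (by exact_mod_cast le_top)) hx
    push_cast
    refine (contDiffOn_succ_iff_fderiv_of_isOpen hU).2 ⟨fun x hx =>
      (hd x hx).differentiableAt.differentiableWithinAt, by simp, ?_⟩
    refine (ih (K := fun x ζ => fderiv ℝ (fun y => K y ζ) x) fun x hx ζ hζ => ?_).congr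
      fun x hx => (hd x hx).fderiv
    exact contDiffAt_fderiv_slice (hK x hx ζ hζ) (by simp)

theorem contDiffOn_integral_slice {μ : Measure Z} [IsFiniteMeasureOnCompacts μ] {U : Set X}
    (hU : IsOpen U) {C : Set Z} (hC : IsCompact C) {h : Z → ℝ} (hh : ContinuousOn h C)
    {K : X → Z → F}
    (hK : ∀ x ∈ U, ∀ ζ ∈ C, ContDiffAt ℝ (⊤ : ℕ∞) (Function.uncurry K) (x, ζ)) :
    ContDiffOn ℝ (⊤ : ℕ∞) (fun x => ∫ ζ in C, h ζ • K x ζ ∂μ) U :=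
  contDiffOn_infty.2 fun n => contDiffOn_integral_slice_nat hU hC hh n hK

end ParametricIntegral

section ParametricIntegralScalar

variable {Z : Type} [NormedAddCommGroup Z] [NormedSpace ℝ Z] [MeasurableSpace Z] [BorelSpace Z]
  {μ : Measure Z} [IsFiniteMeasureOnCompacts μ] {U : Set E4} {C : Set Z} {h : Z → ℝ}
  {K : E4 → Z → ℝ}

theorem fderiv_integral_slice_apply (hU : IsOpen U) (hC : IsCompact C) (hh : ContinuousOn h C)
    (hK : ∀ x ∈ U, ∀ ζ ∈ C, ContDiffAt ℝ (⊤ : ℕ∞) (Function.uncurry K) (x, ζ)) {x : E4}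
    (hx : x ∈ U) (v : E4) :
    fderiv ℝ (fun x => ∫ ζ in C, h ζ * K x ζ ∂μ) x v =
      ∫ ζ in C, h ζ * fderiv ℝ (fun y => K y ζ) x v ∂μ := by
  have h1 := hasFDerivAt_integral_slice (μ := μ) hU hC hh (fun x hx ζ hζ => (hK x hx ζ hζ).of_le
    (by exact_mod_cast le_top)) hx
  simp only [smul_eq_mul] at h1
  rw [h1.fderiv, ContinuousLinearMap.integral_apply]
  · rfl
  · refine ContinuousOn.integrableOn_compact hC ?_
    refine hh.smul (continuousOn_slice (K := fun x ζ => fderiv ℝ (fun y => K y ζ) x)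
      fun ζ hζ => ?_)
    exact (contDiffAt_fderiv_slice (m := 0) (hK x hx ζ hζ) (by simp)).continuousAt

theorem contDiffAt_pd_slice (hK : ∀ x ∈ U, ∀ ζ ∈ C,
      ContDiffAt ℝ (⊤ : ℕ∞) (Function.uncurry K) (x, ζ)) (i : Fin 4) :
    ∀ x ∈ U, ∀ ζ ∈ C, ContDiffAt ℝ (⊤ : ℕ∞)
      (Function.uncurry fun x ζ => pd i (fun y => K y ζ) x) (x, ζ) := fun x hx ζ hζ =>
  (contDiffAt_fderiv_slice (m := (⊤ : ℕ∞)) (hK x hx ζ hζ) (by simp)).clm_apply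
    contDiffAt_const

theorem lap_integral_slice (hU : IsOpen U) (hC : IsCompact C) (hh : ContinuousOn h C)
    (hK : ∀ x ∈ U, ∀ ζ ∈ C, ContDiffAt ℝ (⊤ : ℕ∞) (Function.uncurry K) (x, ζ)) {x : E4}
    (hx : x ∈ U) :
    lap (fun x => ∫ ζ in C, h ζ * K x ζ ∂μ) x =
      ∫ ζ in C, h ζ * lap (fun y => K y ζ) x ∂μ := by
  simp only [lap_eq, Finset.mul_sum]
  rw [integral_finsetSum]
  · refine Finset.sum_congr rfl fun i _ => ?_
    have h1 : pd i (fun x => ∫ ζ in C, h ζ * K x ζ ∂μ) =ᶠ[𝓝 x]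
        fun x => ∫ ζ in C, h ζ * pd i (fun y => K y ζ) x ∂μ := by
      filter_upwards [hU.mem_nhds hx] with y hy
      exact fderiv_integral_slice_apply hU hC hh hK hy (e4 i)
    rw [(pd_congr h1 i).self_of_nhds]
    exact fderiv_integral_slice_apply hU hC hh (contDiffAt_pd_slice hK i) hx (e4 i)
  · intro i _
    refine ContinuousOn.integrableOn_compact hC ?_
    exact hh.mul (continuousOn_slice fun ζ hζ =>
      (contDiffAt_pd_slice (contDiffAt_pd_slice hK i) i x hx ζ hζ).continuousAt)

end ParametricIntegralScalar

end

section

open MeasureTheory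

theorem pd_inv {Q : E4 → ℝ} {x : E4} (hQ : DifferentiableAt ℝ Q x) (h0 : Q x ≠ 0) (i : Fin 4) :
    pd i (fun y => (Q y)⁻¹) x = -((Q x)⁻¹ ^ 2 * pd i Q x) := by
  have h := (hasDerivAt_inv h0).comp_hasFDerivAt x hQ.hasFDerivAt
  rw [pd, show (fun y => (Q y)⁻¹) = Inv.inv ∘ Q from rfl, h.fderiv]
  simp [pd]

theorem pd_inv_sq {Q : E4 → ℝ} {x : E4} (hQ : DifferentiableAt ℝ Q x) (h0 : Q x ≠ 0)
    (i : Fin 4) : pd i (fun y => (Q y)⁻¹ ^ 2) x = -(2 * (Q x)⁻¹ ^ 3 * pd i Q x) := by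
  have hd : DifferentiableAt ℝ (fun y => (Q y)⁻¹) x := hQ.inv h0
  have : (fun y => (Q y)⁻¹ ^ 2) = fun y => (Q y)⁻¹ * (Q y)⁻¹ := by ext y; ring
  rw [this, pd_mul hd hd, pd_inv hQ h0]
  ring

theorem lap_inv {Q : E4 → ℝ} {x : E4} (hQ : ContDiffAt ℝ 2 Q x) (h0 : Q x ≠ 0) :
    lap (fun y => (Q y)⁻¹) x =
      2 * (Q x)⁻¹ ^ 3 * ∑ i, pd i Q x ^ 2 - (Q x)⁻¹ ^ 2 * lap Q x := by
  simp only [lap_eq, Finset.mul_sum, ← Finset.sum_sub_distrib]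
  refine Finset.sum_congr rfl fun i _ => ?_
  have h1 : pd i (fun y => (Q y)⁻¹) =ᶠ[𝓝 x] fun y => -((Q y)⁻¹ ^ 2 * pd i Q y) := by
    filter_upwards [hQ.eventually (by simp), hQ.continuousAt.eventually_ne h0] with y h1 h2
    exact pd_inv (h1.diff (by norm_num)) h2 i
  have hd : DifferentiableAt ℝ (fun y => (Q y)⁻¹ ^ 2) x :=
    ((hQ.diff (by norm_num)).inv h0).pow 2
  rw [(pd_congr h1 i).self_of_nhds, pd_neg, pd_mul hd ((hQ.pd (m := 1) (by norm_num) i).diff le_rfl),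
    pd_inv_sq (hQ.diff (by norm_num)) h0]
  ring

/-- The quadratic polynomial `‖σ x + e₄‖² = σ²‖x‖² + 2σ x₄ + 1`. -/
def segQ (x : E4) (σ : ℝ) : ℝ := σ ^ 2 * ‖x‖ ^ 2 + 2 * σ * x 3 + 1

theorem coord_sq_le_norm_sq (x : E4) (i : Fin 4) : x i ^ 2 ≤ ‖x‖ ^ 2 := by
  rw [norm_sq_eq_sum, sq]
  exact Finset.single_le_sum (f := fun i => x i * x i) (fun j _ => mul_self_nonneg _)
    (Finset.mem_univ i)

theorem segQ_pos {x : E4} (hx : -1 < x 3) {σ : ℝ} (hσ : σ ∈ Icc (0 : ℝ) 1) : 0 < segQ x σ := by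
  have h1 : σ ^ 2 * x 3 ^ 2 ≤ σ ^ 2 * ‖x‖ ^ 2 :=
    mul_le_mul_of_nonneg_left (coord_sq_le_norm_sq x 3) (sq_nonneg σ)
  have h2 : 0 < 1 + σ * x 3 := by
    rcases le_or_gt 0 (x 3) with h | h
    · have := mul_nonneg hσ.1 h
      linarith
    · nlinarith [mul_nonneg (sub_nonneg.2 hσ.2) (neg_nonneg.2 h.le)]
  have h3 : 0 < (1 + σ * x 3) ^ 2 := by positivity
  unfold segQ
  nlinarith

theorem contDiff_segQ {n : WithTop ℕ∞} : ContDiff ℝ n (Function.uncurry segQ) := by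
  have h1 : ContDiff ℝ n fun p : E4 × ℝ => ‖p.1‖ ^ 2 := (contDiff_norm_sq ℝ).comp contDiff_fst
  have h2 : ContDiff ℝ n fun p : E4 × ℝ => p.1 3 := (contDiff_coord 3).comp contDiff_fst
  exact ((((contDiff_snd.pow 2).mul h1).add ((contDiff_const.mul contDiff_snd).mul h2)).add
    contDiff_const)

theorem contDiff_segQ_left {n : WithTop ℕ∞} (σ : ℝ) : ContDiff ℝ n fun x => segQ x σ :=
  (contDiff_segQ (n := n)).comp (contDiff_id.prodMk contDiff_const)

theorem pd_segQ (σ : ℝ) (i : Fin 4) (x : E4) :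
    pd i (fun y => segQ y σ) x = 2 * σ ^ 2 * x i + 2 * σ * if 3 = i then 1 else 0 := by
  have h1 : DifferentiableAt ℝ (fun y : E4 => ‖y‖ ^ 2) x :=
    (contDiff_norm_sq ℝ (n := 1)).contDiffAt.diff le_rfl
  have h2 := differentiableAt_coord 3 x
  unfold segQ
  rw [pd_add ((h1.const_mul _).fun_add (h2.const_mul _)) (differentiableAt_const _),
    pd_add (h1.const_mul _) (h2.const_mul _), pd_const_mul, pd_const_mul, pd_const, pd_norm_sq,
    pd_coord]
  ring

theorem lap_segQ (σ : ℝ) (x : E4) : lap (fun y => segQ y σ) x = 8 * σ ^ 2 := by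
  have h : ∀ i : Fin 4, pd i (fun y => segQ y σ) =
      fun y => 2 * σ ^ 2 * y i + 2 * σ * if 3 = i then 1 else 0 := fun i => by
    ext y; exact pd_segQ σ i y
  simp only [lap_eq, h]
  have : ∀ i : Fin 4, pd i (fun y : E4 => 2 * σ ^ 2 * y i + 2 * σ * if 3 = i then 1 else 0) x =
      2 * σ ^ 2 := fun i => by
    rw [pd_add ((differentiableAt_coord i x).const_mul _) (differentiableAt_const _),
      pd_const_mul, pd_const, pd_coord]
    simp
  simp only [this, Finset.sum_const, Finset.card_univ, Fintype.card_fin, nsmul_eq_mul]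
  push_cast
  ring

theorem lap_inv_segQ {σ : ℝ} {x : E4} (h0 : segQ x σ ≠ 0) :
    lap (fun y => (segQ y σ)⁻¹) x = 0 := by
  rw [lap_inv (contDiff_segQ_left σ).contDiffAt h0, lap_segQ]
  have : ∑ i, pd i (fun y => segQ y σ) x ^ 2 = 4 * σ ^ 2 * segQ x σ := by
    simp only [pd_segQ]
    simp only [Fin.sum_univ_four, segQ, norm_sq_eq_sum]
    simp
    ring
  rw [this]
  field_simp
  ring

theorem Dr_inv_segQ {σ : ℝ} {x : E4} (h0 : segQ x σ ≠ 0) :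
    (segQ x σ)⁻¹ + Dr (fun y => (segQ y σ)⁻¹) x = (1 - σ ^ 2 * ‖x‖ ^ 2) * (segQ x σ)⁻¹ ^ 2 := by
  have : ∑ i, x i * pd i (fun y => segQ y σ) x = 2 * (σ ^ 2 * ‖x‖ ^ 2 + σ * x 3) := by
    simp only [pd_segQ, Fin.sum_univ_four, norm_sq_eq_sum]
    simp
    ring
  rw [Dr_eq_sum]
  simp only [pd_inv ((contDiff_segQ_left (n := 1) σ).contDiffAt.diff le_rfl) h0]
  have h2 : ∑ i, x i * -((segQ x σ)⁻¹ ^ 2 * pd i (fun y => segQ y σ) x) =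
      -((segQ x σ)⁻¹ ^ 2 * ∑ i, x i * pd i (fun y => segQ y σ) x) := by
    rw [Finset.mul_sum, ← Finset.sum_neg_distrib]
    exact Finset.sum_congr rfl fun i _ => by ring
  rw [h2, this]
  have h3 : segQ x σ = σ ^ 2 * ‖x‖ ^ 2 + 2 * σ * x 3 + 1 := rfl
  field_simp
  rw [h3]
  ring

/-- The weight of the superposition `refU`. -/
def refWeight (σ : ℝ) : ℝ := -2 * ((1 - σ ^ 2) / (1 + σ ^ 2))

theorem continuous_refWeight : Continuous refWeight := by
  unfold refWeight
  refine continuous_const.mul ((by fun_prop : Continuous fun σ : ℝ => 1 - σ ^ 2).div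
    (by fun_prop) fun σ => by positivity)

/-- The harmonic factor of the reference solution. -/
def refU (x : E4) : ℝ := ∫ σ in Icc (0 : ℝ) 1, refWeight σ * (segQ x σ)⁻¹

theorem isOpen_above : IsOpen {x : E4 | -1 < x 3} := isOpen_lt continuous_const (continuous_coord 3)

theorem contDiffAt_segQ_inv {x : E4} (hx : -1 < x 3) {σ : ℝ} (hσ : σ ∈ Icc (0 : ℝ) 1) :
    ContDiffAt ℝ (⊤ : ℕ∞) (Function.uncurry fun x σ => (segQ x σ)⁻¹) (x, σ) :=
  contDiff_segQ.contDiffAt.inv (segQ_pos hx hσ).ne'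

theorem contDiffAt_refU {x : E4} (hx : -1 < x 3) : ContDiffAt ℝ (⊤ : ℕ∞) refU x :=
  (contDiffOn_integral_slice (μ := volume) (K := fun x σ => (segQ x σ)⁻¹) isOpen_above
    isCompact_Icc continuous_refWeight.continuousOn fun _ hx _ hσ =>
      contDiffAt_segQ_inv hx hσ).contDiffAt (isOpen_above.mem_nhds hx)

theorem lap_refU {x : E4} (hx : -1 < x 3) : lap refU x = 0 := by
  have h := lap_integral_slice (μ := volume) (K := fun x σ => (segQ x σ)⁻¹) isOpen_above
    isCompact_Icc continuous_refWeight.continuousOn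
    (fun _ hx _ hσ => contDiffAt_segQ_inv hx hσ) hx
  unfold refU
  rw [h]
  refine setIntegral_eq_zero_of_forall_eq_zero fun σ hσ => ?_
  rw [lap_inv_segQ (segQ_pos hx hσ).ne', mul_zero]

/-- The trace of `(1 + D) refU` on the unit sphere as a function of the height. -/
def refE (t : ℝ) : ℝ :=
  ∫ σ in Icc (0 : ℝ) 1, (refWeight σ * (1 - σ ^ 2)) * (σ ^ 2 + 2 * σ * t + 1)⁻¹ ^ 2

theorem refU_add_Dr {x : E4} (hx : -1 < x 3) (hn : ‖x‖ = 1) :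
    refU x + Dr refU x = refE (x 3) := by
  have h := fderiv_integral_slice_apply (μ := volume) (K := fun x σ => (segQ x σ)⁻¹) isOpen_above
    isCompact_Icc continuous_refWeight.continuousOn
    (fun _ hx _ hσ => contDiffAt_segQ_inv hx hσ) hx x
  have h2 : Dr refU x = ∫ σ in Icc (0 : ℝ) 1,
      refWeight σ * fderiv ℝ (fun y => (segQ y σ)⁻¹) x x := h
  have hc : ∀ y ∈ {x : E4 | -1 < x 3}, ContinuousOn (fun σ => (segQ y σ)⁻¹) (Icc 0 1) :=
    fun y hy => continuousOn_slice (K := fun x σ => (segQ x σ)⁻¹) fun σ hσ =>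
      (contDiffAt_segQ_inv hy hσ).continuousAt
  have hc' : ContinuousOn (fun σ => fderiv ℝ (fun y => (segQ y σ)⁻¹) x x) (Icc 0 1) := by
    refine ContinuousOn.clm_apply ?_ continuousOn_const
    exact continuousOn_slice (K := fun x σ => fderiv ℝ (fun y => (segQ y σ)⁻¹) x) fun σ hσ =>
      (contDiffAt_fderiv_slice (m := 0) (contDiffAt_segQ_inv hx hσ) (by simp)).continuousAt
  rw [h2, refU, ← integral_add]
  · refine setIntegral_congr_fun measurableSet_Icc fun σ hσ => ?_
    have h3 := Dr_inv_segQ (segQ_pos hx hσ).ne'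
    have h4 : segQ x σ = σ ^ 2 + 2 * σ * x 3 + 1 := by rw [segQ, hn]; ring
    simp only [Dr, hn] at h3
    simp only
    rw [← mul_add, h3, h4]
    ring
  · exact (continuous_refWeight.continuousOn.mul (hc x hx)).integrableOn_compact isCompact_Icc
  · exact (continuous_refWeight.continuousOn.mul hc').integrableOn_compact isCompact_Icc

end

section

open MeasureTheory

theorem heightQ_pos {t : ℝ} (ht : -1 < t) {σ : ℝ} (hσ : σ ∈ Icc (0 : ℝ) 1) :
    0 < σ ^ 2 + 2 * σ * t + 1 := by
  rcases le_or_gt 1 t with h | h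
  · have := mul_nonneg hσ.1 (by linarith : 0 ≤ t)
    nlinarith [sq_nonneg σ]
  · have h1 : 0 < 1 - t ^ 2 := by nlinarith
    nlinarith [sq_nonneg (σ + t)]

theorem contDiff_heightQ {n : WithTop ℕ∞} :
    ContDiff ℝ n (Function.uncurry fun t σ : ℝ => σ ^ 2 + 2 * σ * t + 1) := by
  have : ContDiff ℝ n fun p : ℝ × ℝ => p.2 ^ 2 + 2 * p.2 * p.1 + 1 := by fun_prop
  exact this

theorem contDiffAt_heightQ_pow {t : ℝ} (ht : -1 < t) {σ : ℝ} (hσ : σ ∈ Icc (0 : ℝ) 1) (k : ℕ) :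
    ContDiffAt ℝ (⊤ : ℕ∞)
      (Function.uncurry fun t σ : ℝ => (σ ^ 2 + 2 * σ * t + 1)⁻¹ ^ k) (t, σ) :=
  (contDiff_heightQ.contDiffAt.inv (by exact (heightQ_pos ht hσ).ne')).pow k

theorem hasDerivAt_integral_heightQ {h : ℝ → ℝ} (hh : Continuous h) (k : ℕ) {t : ℝ} (ht : -1 < t) :
    HasDerivAt (fun t => ∫ σ in Icc (0 : ℝ) 1, h σ * (σ ^ 2 + 2 * σ * t + 1)⁻¹ ^ k)
      (∫ σ in Icc (0 : ℝ) 1, (h σ * (-(2 * k) * σ)) * (σ ^ 2 + 2 * σ * t + 1)⁻¹ ^ (k + 1)) t := by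
  have h1 := hasFDerivAt_integral_slice (μ := volume) (C := Icc (0 : ℝ) 1) (h := h)
    (K := fun t σ : ℝ => (σ ^ 2 + 2 * σ * t + 1)⁻¹ ^ k) isOpen_Ioi isCompact_Icc hh.continuousOn
    (fun x hx ζ hζ => (contDiffAt_heightQ_pow hx hζ k).of_le (by exact_mod_cast le_top)) ht
  have h2 := h1.hasDerivAt
  simp only [smul_eq_mul] at h2
  refine h2.congr_deriv ?_
  have hc : ContinuousOn (fun σ => h σ • fderiv ℝ
      (fun t : ℝ => (σ ^ 2 + 2 * σ * t + 1)⁻¹ ^ k) t) (Icc 0 1) :=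
    hh.continuousOn.smul (continuousOn_slice
      (K := fun t σ => fderiv ℝ (fun t : ℝ => (σ ^ 2 + 2 * σ * t + 1)⁻¹ ^ k) t) fun σ hσ =>
      (contDiffAt_fderiv_slice (m := 0) (contDiffAt_heightQ_pow ht hσ k) (by simp)).continuousAt)
  rw [ContinuousLinearMap.integral_apply (hc.integrableOn_compact isCompact_Icc)]
  refine setIntegral_congr_fun measurableSet_Icc fun σ hσ => ?_
  have hQ := (heightQ_pos ht hσ).ne'
  have hd : HasDerivAt (fun t : ℝ => (σ ^ 2 + 2 * σ * t + 1)) (2 * σ) t := by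
    simpa using (((hasDerivAt_id t).const_mul (2 * σ)).const_add (σ ^ 2)).add_const 1
  have hd2 := (hd.fun_inv hQ).fun_pow k
  symm
  simp only [smul_apply, smul_eq_mul, fderiv_eq_smul_deriv, hd2.deriv, one_mul]
  rcases k with _ | k
  · simp
  · simp only [Nat.add_sub_cancel]
    push_cast
    simp only [div_eq_mul_inv, ← inv_pow]
    ring

theorem contDiffAt_refE {t : ℝ} (ht : -1 < t) : ContDiffAt ℝ 2 refE t := by
  have h := contDiffOn_integral_slice (μ := volume) (C := Icc (0 : ℝ) 1)
    (h := fun σ => refWeight σ * (1 - σ ^ 2))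
    (K := fun t σ : ℝ => (σ ^ 2 + 2 * σ * t + 1)⁻¹ ^ 2) isOpen_Ioi isCompact_Icc
    (continuous_refWeight.mul (by fun_prop)).continuousOn
    (fun x hx ζ hζ => contDiffAt_heightQ_pow hx hζ 2)
  exact contDiffAt_infty.1 (h.contDiffAt (isOpen_Ioi.mem_nhds ht)) 2

theorem deriv_refE {t : ℝ} (ht : -1 < t) : deriv refE t =
    ∫ σ in Icc (0 : ℝ) 1, (refWeight σ * (1 - σ ^ 2) * (-(2 * (2 : ℕ)) * σ)) *
      (σ ^ 2 + 2 * σ * t + 1)⁻¹ ^ 3 :=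
  (hasDerivAt_integral_heightQ (continuous_refWeight.mul (by fun_prop)) 2 ht).deriv

theorem deriv_deriv_refE {t : ℝ} (ht : -1 < t) : deriv (deriv refE) t =
    ∫ σ in Icc (0 : ℝ) 1, (refWeight σ * (1 - σ ^ 2) * (-(2 * (2 : ℕ)) * σ) *
      (-(2 * (3 : ℕ)) * σ)) * (σ ^ 2 + 2 * σ * t + 1)⁻¹ ^ 4 := by
  have : deriv refE =ᶠ[𝓝 t] fun t => ∫ σ in Icc (0 : ℝ) 1,
      (refWeight σ * (1 - σ ^ 2) * (-(2 * (2 : ℕ)) * σ)) * (σ ^ 2 + 2 * σ * t + 1)⁻¹ ^ 3 := by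
    filter_upwards [isOpen_Ioi.mem_nhds ht] with s hs
    exact deriv_refE hs
  rw [this.deriv_eq]
  exact (hasDerivAt_integral_heightQ ((continuous_refWeight.mul (by fun_prop)).mul
    (by fun_prop)) 3 ht).deriv

theorem refE_zero : refE 0 = -(π / 4) := by
  have hd : ∀ σ ∈ uIcc (0 : ℝ) 1, HasDerivAt
      (fun σ => -2 * (1 / 2 * arctan σ + σ * (1 - σ ^ 2) / (2 * (1 + σ ^ 2) ^ 2)))
      ((refWeight σ * (1 - σ ^ 2)) * (σ ^ 2 + 2 * σ * 0 + 1)⁻¹ ^ 2) σ := by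
    intro σ _
    have hp : (1 + σ ^ 2) ≠ 0 := by positivity
    have h1 : HasDerivAt (fun σ : ℝ => σ * (1 - σ ^ 2)) (1 - 3 * σ ^ 2) σ :=
      ((hasDerivAt_id σ).mul ((hasDerivAt_pow 2 σ).const_sub 1)).congr_deriv (by simp; ring)
    have h2 : HasDerivAt (fun σ : ℝ => 2 * (1 + σ ^ 2) ^ 2) (8 * σ * (1 + σ ^ 2)) σ :=
      ((((hasDerivAt_pow 2 σ).const_add 1).pow 2).const_mul 2).congr_deriv (by simp; ring)
    have h3 := ((((hasDerivAt_arctan σ).const_mul (1 / 2)).add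
      (h1.div h2 (by positivity))).const_mul (-2))
    refine h3.congr_deriv ?_
    have h4 : σ ^ 2 + 2 * σ * 0 + 1 = 1 + σ ^ 2 := by ring
    rw [h4, refWeight]
    field_simp
    ring
  have hcont : ContinuousOn (fun σ : ℝ => (refWeight σ * (1 - σ ^ 2)) *
      (σ ^ 2 + 2 * σ * 0 + 1)⁻¹ ^ 2) (uIcc 0 1) := by
    refine ((continuous_refWeight.mul (by fun_prop)).mul
      ((Continuous.inv₀ (by fun_prop) fun σ => ?_).pow 2)).continuousOn
    have : 0 < σ ^ 2 + 1 := by positivity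
    simpa using this.ne'
  unfold refE
  rw [integral_Icc_eq_integral_Ioc, ← intervalIntegral.integral_of_le zero_le_one,
    intervalIntegral.integral_eq_sub_of_hasDerivAt hd hcont.intervalIntegrable]
  simp

theorem refE_operator {t : ℝ} (ht : -1 < t) :
    (-3) * (1 - t ^ 2) * deriv refE t + 6 * t * refE t - t * (1 - t ^ 2) * deriv (deriv refE) t +
      3 * t ^ 2 * deriv refE t = -2 := by
  have hintr : ∀ {h : ℝ → ℝ} (_ : Continuous h) (k : ℕ), IntegrableOn
      (fun σ => h σ * (σ ^ 2 + 2 * σ * t + 1)⁻¹ ^ k) (Icc (0 : ℝ) 1) := fun hh k =>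
    (hh.continuousOn.mul (continuousOn_slice
      (K := fun t σ : ℝ => (σ ^ 2 + 2 * σ * t + 1)⁻¹ ^ k) fun σ hσ =>
      (contDiffAt_heightQ_pow ht hσ k).continuousAt)).integrableOn_compact isCompact_Icc
  have c0 : Continuous fun σ => refWeight σ * (1 - σ ^ 2) := continuous_refWeight.mul (by fun_prop)
  have c1 : Continuous fun σ => refWeight σ * (1 - σ ^ 2) * (-(2 * (2 : ℕ)) * σ) :=
    c0.mul (by fun_prop)
  have c2 : Continuous fun σ => refWeight σ * (1 - σ ^ 2) * (-(2 * (2 : ℕ)) * σ) *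
      (-(2 * (3 : ℕ)) * σ) := c1.mul (by fun_prop)
  have i0 := (hintr c0 2).const_mul (6 * t)
  have i1 := (hintr c1 3).const_mul ((-3) * (1 - t ^ 2))
  have i1' := (hintr c1 3).const_mul (3 * t ^ 2)
  have i2 := (hintr c2 4).const_mul (t * (1 - t ^ 2))
  have i3 := (i1.fun_add i0).sub' i2
  rw [deriv_refE ht, deriv_deriv_refE ht, refE]
  simp only [← integral_const_mul]
  rw [← integral_add i1 i0, ← integral_sub (i1.fun_add i0) i2,
    ← integral_add i3 i1']
  have hd : ∀ σ ∈ uIcc (0 : ℝ) 1, HasDerivAt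
      (fun σ => 2 * ((1 - σ ^ 2) ^ 3 / (σ ^ 2 + 2 * σ * t + 1) ^ 3))
      (-12 * (1 - σ ^ 2) ^ 2 * (2 * σ + t * (1 + σ ^ 2)) * (σ ^ 2 + 2 * σ * t + 1)⁻¹ ^ 4) σ := by
    intro σ hσ
    rw [uIcc_of_le zero_le_one] at hσ
    have hQ := (heightQ_pos ht hσ).ne'
    have h1 : HasDerivAt (fun σ : ℝ => (1 - σ ^ 2) ^ 3) (-6 * σ * (1 - σ ^ 2) ^ 2) σ :=
      (((hasDerivAt_pow 2 σ).const_sub 1).pow 3).congr_deriv (by simp; ring)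
    have h0 : HasDerivAt (fun σ : ℝ => σ ^ 2 + 2 * σ * t + 1) (2 * σ + 2 * t) σ :=
      ((((hasDerivAt_pow 2 σ).add (((hasDerivAt_id σ).const_mul 2).mul_const t))).add_const
        1).congr_deriv (by simp)
    have h2 := (h1.div (h0.pow 3) (pow_ne_zero 3 hQ)).const_mul 2
    refine h2.congr_deriv ?_
    simp only [Pi.pow_apply]
    obtain ⟨q, hq⟩ : ∃ q, q = σ ^ 2 + 2 * σ * t + 1 := ⟨_, rfl⟩
    rw [← hq] at hQ ⊢
    field_simp
    rw [hq]
    push_cast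
    ring
  have hcont : ContinuousOn (fun σ : ℝ => (-12 * (1 - σ ^ 2) ^ 2 * (2 * σ + t * (1 + σ ^ 2))) *
      (σ ^ 2 + 2 * σ * t + 1)⁻¹ ^ 4) (uIcc 0 1) := by
    rw [uIcc_of_le zero_le_one]
    exact ContinuousOn.mul (by fun_prop) (continuousOn_slice
      (K := fun t σ : ℝ => (σ ^ 2 + 2 * σ * t + 1)⁻¹ ^ 4) fun σ hσ =>
      (contDiffAt_heightQ_pow ht hσ 4).continuousAt)
  have hF := intervalIntegral.integral_eq_sub_of_hasDerivAt hd hcont.intervalIntegrable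
  rw [intervalIntegral.integral_of_le zero_le_one, ← integral_Icc_eq_integral_Ioc] at hF
  refine Eq.trans (setIntegral_congr_fun measurableSet_Icc fun σ hσ => ?_) (hF.trans (by simp))
  have hQ := (heightQ_pos ht hσ).ne'
  have hp : (1 + σ ^ 2) ≠ 0 := by positivity
  obtain ⟨q, hq⟩ : ∃ q, q = σ ^ 2 + 2 * σ * t + 1 := ⟨_, rfl⟩
  simp only [refWeight]
  rw [← hq] at hQ ⊢
  field_simp
  rw [hq]
  push_cast
  ring

end

theorem nuM_eq_pd {f : E4 → ℝ} {p : E4} (hf : DifferentiableAt ℝ f p) : nuM f p = pd 3 f p := by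
  have h1 : HasDerivAt (fun t : ℝ => Real.sin t • p + Real.cos t • e4 3) (-e4 3) (π / 2) := by
    refine (((Real.hasDerivAt_sin (π / 2)).smul_const p).fun_add
      ((Real.hasDerivAt_cos (π / 2)).smul_const (e4 3))).congr_deriv ?_
    simp
  have h2 : Real.sin (π / 2) • p + Real.cos (π / 2) • e4 3 = p := by simp
  have h3 := HasFDerivAt.comp_hasDerivAt (f := fun t : ℝ => Real.sin t • p + Real.cos t • e4 3)
    (π / 2) (by rw [h2]; exact hf.hasFDerivAt) h1
  rw [nuM]
  refine (congrArg _ h3.deriv).trans ?_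
  simp [pd]

theorem nuN_eq_Dr {f : E4 → ℝ} {p : E4} (hf : DifferentiableAt ℝ f p) : nuN f p = -Dr f p := by
  have h1 : HasDerivAt (fun r : ℝ => r • p) p 1 := by
    simpa using (hasDerivAt_id (1 : ℝ)).smul_const p
  have h3 := HasFDerivAt.comp_hasDerivAt (f := fun r : ℝ => r • p) (1 : ℝ)
    (by rw [one_smul]; exact hf.hasFDerivAt) h1
  rw [nuN]
  exact congrArg _ h3.deriv

theorem exists_reference_solution : ∃ ω : E4 → ℝ, ContDiff ℝ (⊤ : ℕ∞) ω ∧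
    (∀ x ∈ Bp, lap (lap ω) x = 0) ∧ (∀ x ∈ Mhs \ Sig, P3M ω x = -2) ∧
    (∀ x ∈ Nfb \ Sig, P3N ω x = 0) ∧ (∀ x ∈ Nfb, ω x = 0) ∧
    (∀ p ∈ Sig, pd 3 (muM ω) p = π / 4) ∧
    (∀ p ∈ Sig, -Dr (muN ω) p - muN ω p = π / 4) := by
  obtain ⟨ω, hω, he⟩ := exists_contDiff_extension (n := ⊤) (f := fun y : E4 => y 3 * refU y)
    isOpen_above isCompact_B4p.isClosed (fun x hx => lt_of_lt_of_le (by norm_num) hx.2)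
    (fun x hx => (contDiffAt_coord 3 x).mul (contDiffAt_refU hx))
  have hab : ∀ {x : E4}, x ∈ B4p → -1 < x 3 := fun hx => lt_of_lt_of_le (by norm_num) hx.2
  have hev : ∀ {x : E4}, x ∈ B4p → ∀ᶠ y in 𝓝 x, -1 < y 3 := fun hx =>
    isOpen_above.mem_nhds (hab hx)
  have hU : ∀ {x : E4} (n : ℕ), -1 < x 3 → ContDiffAt ℝ n refU x := fun n hx =>
    contDiffAt_infty.1 (contDiffAt_refU hx) n
  have hS : ∀ {p : E4}, p ∈ Sig → p ∈ B4p := fun hp => ⟨hp.1.le, hp.2.ge⟩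
  refine ⟨ω, hω, fun x hx => ?_, fun x hx => ?_, fun x hx => ?_, fun x hx => ?_, fun p hp => ?_,
    fun p hp => ?_⟩
  · exact biharmonic_coord_mul ((hev (Bp_subset_B4p hx)).mono fun y hy => ⟨hU 4 hy, lap_refU hy⟩)
      (he x (Bp_subset_B4p hx))
  · have hxB := Mhs_subset_B4p hx.1
    rw [P3M_coord_mul_harmonic hx.1.1 (hU 4 (hab hxB)) ((hev hxB).mono fun y hy => lap_refU hy)
      (he x hxB) (contDiffAt_refE (hab hxB)) ((hev hxB).mono fun y hy h => refU_add_Dr hy h)]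
    exact refE_operator (hab hxB)
  · refine P3N_coord_mul_harmonic (U := refU) (contDiff_infty.1 hω 3)
      (fun y hy => ⟨hU 4 (hab (Bp_subset_B4p hy)), lap_refU (hab (Bp_subset_B4p hy))⟩)
      (fun y hy => (he y (Bp_subset_B4p hy)).eq_of_nhds) (fun y h1 h2 => ?_) hx
    rw [(he y ⟨h1.le, h2.ge⟩).eq_of_nhds]
    simp [h2]
  · rw [(he x (Nfb_subset_B4p hx)).eq_of_nhds]
    simp [hx.2]
  · have h1 : muM ω =ᶠ[𝓝 p] fun y => -(y 3 * (refU y + Dr refU y)) := by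
      filter_upwards [Dr_congr (he p (hS hp)), hev (hS hp)] with y h1 h2
      rw [muM_eq]
      simp only
      rw [h1, Dr_mul (differentiableAt_coord 3 y) ((hU 1 h2).diff le_rfl), Dr_coord]
      ring
    have hd : DifferentiableAt ℝ (fun y => refU y + Dr refU y) p :=
      ((hU 2 (hab (hS hp))).diff (by norm_num)).fun_add
        (((hU 2 (hab (hS hp))).Dr (m := 1) (by norm_num)).diff le_rfl)
    rw [(pd_congr h1 3).eq_of_nhds, pd_neg, pd_mul (differentiableAt_coord 3 p) hd, pd_coord, hp.2,
      refU_add_Dr (hab (hS hp)) hp.1, hp.2, refE_zero]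
    simp
  · have h1 : muN ω =ᶠ[𝓝 p] fun y => refU y + y 3 * pd 3 refU y := by
      filter_upwards [pd_congr (he p (hS hp)) 3, hev (hS hp)] with y h1 h2
      rw [muN_eq, h1, pd_mul (differentiableAt_coord 3 y) ((hU 1 h2).diff le_rfl), pd_coord]
      simp [add_comm]
    have hd := ((hU 2 (hab (hS hp))).pd (m := 1) (by norm_num) 3).diff le_rfl
    have hd1 := (hU 2 (hab (hS hp))).diff (by norm_num)
    rw [(Dr_congr h1).eq_of_nhds, h1.eq_of_nhds, Dr_add hd1 ((differentiableAt_coord 3 p).fun_mul hd),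
      Dr_mul (differentiableAt_coord 3 p) hd, Dr_coord, hp.2]
    have := refU_add_Dr (hab (hS hp)) hp.1
    rw [hp.2, refE_zero] at this
    linarith

/-- The reflection-dilation `(x', t) ↦ (x', -(j + 1) t)`. -/
def dilRefl (j : Fin 4) : E4 →L[ℝ] E4 :=
  ContinuousLinearMap.id ℝ E4 -
    (((j : ℝ) + 2) • (EuclideanSpace.proj 3 : E4 →L[ℝ] ℝ)).smulRight (e4 3)

theorem dilRefl_apply (j : Fin 4) (x : E4) (i : Fin 4) :
    dilRefl j x i = (if i = 3 then -((j : ℝ) + 1) else 1) * x i := by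
  rw [dilRefl]
  simp only [sub_apply, ContinuousLinearMap.id_apply,
    ContinuousLinearMap.smulRight_apply, smul_apply, PiLp.sub_apply,
    PiLp.smul_apply, e4_apply, PiLp.proj_apply, smul_eq_mul]
  split_ifs with h
  · rw [h]; ring
  · ring

theorem dilRefl_of_eq_zero (j : Fin 4) {x : E4} (hx : x 3 = 0) : dilRefl j x = x := by
  ext i
  rw [dilRefl_apply]
  split_ifs with h
  · rw [h, hx, mul_zero]
  · rw [one_mul]

/-- Hestenes extension of a function on the upper half-space. -/
def hestenes (a : Fin 4 → ℝ) (v : E4 → ℝ) (x : E4) : ℝ :=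
  if 0 ≤ x 3 then v x else ∑ j, a j * v (dilRefl j x)

theorem continuous_hestenes {a : Fin 4 → ℝ} (ha : ∑ j, a j = 1) {v : E4 → ℝ} (hv : Continuous v) :
    Continuous (hestenes a v) := by
  refine Continuous.if_le hv ?_ continuous_const (continuous_coord 3) fun x hx => ?_
  · exact continuous_finsetSum _ fun j _ => continuous_const.mul (hv.comp (dilRefl j).continuous)
  · simp_rw [dilRefl_of_eq_zero _ hx.symm]
    rw [← Finset.sum_mul, ha, one_mul]

theorem hasFDerivAt_of_hyperplane {f : E4 → ℝ} {G : E4 → E4 →L[ℝ] ℝ} (hf : Continuous f)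
    (hG : Continuous G) (h : ∀ x : E4, x 3 ≠ 0 → HasFDerivAt f (G x) x) (x : E4) :
    HasFDerivAt f (G x) x := by
  by_cases hx : x 3 = 0
  · have key : ∀ s : Set E4, IsOpen s → Convex ℝ s → (∀ y ∈ s, y 3 ≠ 0) →
        HasFDerivWithinAt f (G x) (closure s) x := by
      intro s ho hs hn
      refine hasFDerivWithinAt_closure_of_tendsto_fderiv
        (fun y hy => (h y (hn y hy)).differentiableAt.differentiableWithinAt) hs ho
        (fun y _ => hf.continuousAt.continuousWithinAt) ?_
      refine (hG.continuousAt.continuousWithinAt (s := s)).tendsto.congr' ?_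
      filter_upwards [self_mem_nhdsWithin] with y hy using (h y (hn y hy)).fderiv.symm
    have hlin : IsLinearMap ℝ fun y : E4 => y 3 := ⟨fun _ _ => rfl, fun _ _ => rfl⟩
    have h1 := key {y | 0 < y 3} (isOpen_lt continuous_const (continuous_coord 3))
      (convex_halfSpace_gt hlin 0) fun y hy => ne_of_gt hy
    have h2 := key {y | y 3 < 0} (isOpen_lt (continuous_coord 3) continuous_const)
      (convex_halfSpace_lt hlin 0) fun y hy => ne_of_lt hy
    have h3 := h1.union h2
    rw [← closure_union] at h3
    have h4 : closure ({y : E4 | 0 < y 3} ∪ {y | y 3 < 0}) = univ := by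
      refine eq_univ_of_forall fun y => ?_
      by_cases hy : y 3 = 0
      · have hc : Filter.Tendsto (fun s : ℝ => y + s • e4 3) (𝓝[>] 0) (𝓝 y) := by
          have : ContinuousAt (fun s : ℝ => y + s • e4 3) 0 := by fun_prop
          simpa using this.tendsto.mono_left (nhdsWithin_le_nhds (s := Ioi 0))
        refine mem_closure_of_tendsto hc ?_
        filter_upwards [self_mem_nhdsWithin] with s hs
        exact Or.inl (by simpa [e4_apply, hy] using hs)
      · exact subset_closure ((lt_or_gt_of_ne hy).symm)
    rwa [h4, hasFDerivWithinAt_univ] at h3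
  · exact h x hx

/-- All derivatives of `u` of order at most `n` extend continuously from the open upper
half-space to its closure. -/
def ExtC : ℕ → (E4 → ℝ) → Prop
  | 0, u => ∃ v : E4 → ℝ, Continuous v ∧ ∀ x, 0 < x 3 → u x = v x
  | n + 1, u => (∃ v : E4 → ℝ, Continuous v ∧ ∀ x, 0 < x 3 → u x = v x) ∧ ∀ i, ExtC n (pd i u)

theorem isOpen_upper : IsOpen {x : E4 | 0 < x 3} := isOpen_lt continuous_const (continuous_coord 3)

theorem pd_congr_upper {u v : E4 → ℝ} (h : ∀ x, 0 < x 3 → u x = v x) (i : Fin 4) :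
    ∀ x, 0 < x 3 → pd i u x = pd i v x := fun _ hx =>
  (pd_congr (Filter.eventually_of_mem (isOpen_upper.mem_nhds hx) h) i).eq_of_nhds

theorem ExtC.zero {n : ℕ} {u : E4 → ℝ} (h : ExtC n u) : ExtC 0 u := by
  cases n with
  | zero => exact h
  | succ n => exact h.1

theorem ExtC.congr {n : ℕ} : ∀ {u v : E4 → ℝ}, ExtC n u → (∀ x, 0 < x 3 → v x = u x) →
    ExtC n v := by
  induction n with
  | zero =>
    rintro u v ⟨w, hw, h1⟩ h2
    exact ⟨w, hw, fun x hx => (h2 x hx).trans (h1 x hx)⟩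
  | succ n ih =>
    rintro u v ⟨⟨w, hw, h1⟩, h3⟩ h2
    exact ⟨⟨w, hw, fun x hx => (h2 x hx).trans (h1 x hx)⟩, fun i =>
      ih (h3 i) (pd_congr_upper h2 i)⟩

theorem contDiff_hestenes {n : ℕ} : ∀ {u v : E4 → ℝ} {a : Fin 4 → ℝ},
    (∀ x : E4, 0 < x 3 → ContDiffAt ℝ (⊤ : ℕ∞) u x) → ExtC n u → Continuous v →
    (∀ x, 0 < x 3 → u x = v x) → (∀ k ≤ n, ∑ j, a j * (-((j : ℝ) + 1)) ^ k = 1) →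
    ContDiff ℝ n (hestenes a v) := by
  induction n with
  | zero =>
    intro u v a _ _ hv _ ha
    have := ha 0 le_rfl
    simp only [pow_zero, mul_one] at this
    simpa using continuous_hestenes this hv
  | succ n ih =>
    intro u v a hu hE hv huv ha
    choose w hw huw using fun i => (hE.2 i).zero
    let b : Fin 4 → Fin 4 → ℝ := fun i j => a j * if i = 3 then -((j : ℝ) + 1) else 1
    have hb : ∀ i, ∀ k ≤ n, ∑ j, b i j * (-((j : ℝ) + 1)) ^ k = 1 := by
      intro i k hk
      by_cases hi : i = 3
      · refine (Finset.sum_congr rfl fun j _ => ?_).trans (ha (k + 1) (by omega))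
        simp only [b, hi, if_true]
        ring
      · refine (Finset.sum_congr rfl fun j _ => ?_).trans (ha k (by omega))
        simp only [b, hi, if_false, mul_one]
    have hw' : ∀ i, ContDiff ℝ n (hestenes (b i) (w i)) := fun i =>
      ih (fun x hx => (hu x hx).pd (m := (⊤ : ℕ∞)) (by exact_mod_cast le_top) i) (hE.2 i) (hw i) (huw i) (hb i)
    have hG : ContDiff ℝ n fun x => ∑ i, hestenes (b i) (w i) x •
        (EuclideanSpace.proj i : E4 →L[ℝ] ℝ) :=
      ContDiff.sum fun i _ => (hw' i).smul contDiff_const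
    have ha0 : ∑ j, a j = 1 := by simpa using ha 0 (by omega)
    push_cast
    refine contDiff_succ_iff_hasFDerivAt.2 ⟨_, hG, hasFDerivAt_of_hyperplane
      (continuous_hestenes ha0 hv) hG.continuous fun x hx => ?_⟩
    have hsum : ∀ {y : E4}, 0 < y 3 → HasFDerivAt v
        (∑ i, w i y • (EuclideanSpace.proj i : E4 →L[ℝ] ℝ)) y := by
      intro y hy
      have h1 := ((hu y hy).diff (by exact_mod_cast le_top)).hasFDerivAt
      have h2 : fderiv ℝ u y = ∑ i, w i y • (EuclideanSpace.proj i : E4 →L[ℝ] ℝ) := by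
        ext z
        rw [fderiv_eq_sum_pd]
        simp [← huw _ y hy, mul_comm]
      rw [h2] at h1
      exact h1.congr_of_eventuallyEq (Filter.eventually_of_mem (isOpen_upper.mem_nhds hy)
        fun z hz => (huv z hz).symm)
    rcases lt_or_gt_of_ne hx with hx | hx
    · have hL : ∀ j : Fin 4, 0 < dilRefl j x 3 := fun j => by
        rw [dilRefl_apply, if_pos rfl]
        nlinarith [(Nat.cast_nonneg (j : ℕ) : (0 : ℝ) ≤ (j : ℕ))]
      have h1 : HasFDerivAt (fun y => ∑ j, a j * v (dilRefl j y))
          (∑ j, a j • ((∑ i, w i (dilRefl j x) • (EuclideanSpace.proj i : E4 →L[ℝ] ℝ)).comp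
            (dilRefl j))) x :=
        HasFDerivAt.fun_sum fun j _ => ((hsum (hL j)).comp x (dilRefl j).hasFDerivAt).const_mul _
      refine (h1.congr_of_eventuallyEq ?_).congr_fderiv ?_
      · filter_upwards [(isOpen_lt (continuous_coord 3) continuous_const).mem_nhds hx] with y hy
        exact if_neg (not_le.2 hy)
      · ext z
        simp only [sum_apply, smul_apply,
          ContinuousLinearMap.comp_apply, PiLp.proj_apply, smul_eq_mul, hestenes,
          if_neg (not_le.2 hx), dilRefl_apply, Finset.mul_sum, Finset.sum_mul]
        rw [Finset.sum_comm]
        refine Finset.sum_congr rfl fun i _ => Finset.sum_congr rfl fun j _ => ?_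
        simp only [b]
        ring
    · refine ((hsum hx).congr_of_eventuallyEq ?_).congr_fderiv ?_
      · filter_upwards [isOpen_upper.mem_nhds hx] with y hy using if_pos (le_of_lt hy)
      · simp [hestenes, if_pos (le_of_lt hx)]

theorem exists_contDiff_three_of_extC {u v : E4 → ℝ}
    (hu : ∀ x : E4, 0 < x 3 → ContDiffAt ℝ (⊤ : ℕ∞) u x) (hE : ExtC 3 u) (hv : Continuous v)
    (huv : ∀ x, 0 < x 3 → u x = v x) :
    ∃ F : E4 → ℝ, ContDiff ℝ 3 F ∧ ∀ x : E4, 0 ≤ x 3 → F x = v x := by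
  refine ⟨hestenes ![10, -20, 15, -4] v, contDiff_hestenes (n := 3) hu hE hv huv ?_, fun x hx =>
    if_pos hx⟩
  intro k hk
  interval_cases k <;> simp [Fin.sum_univ_four] <;> norm_num

section

open MeasureTheory

abbrev E3 := EuclideanSpace ℝ (Fin 3)

/-- The coordinate vectors of `ℝ³`. -/
def e3 (i : Fin 3) : E3 := EuclideanSpace.single i 1

/-- The inclusion `ℝ³ → ℝ³ × {0}`. -/
def flat : E3 →L[ℝ] E4 :=
  ∑ i : Fin 3, (EuclideanSpace.proj i : E3 →L[ℝ] ℝ).smulRight (e4 i.castSucc)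

/-- The projection `(x', t) ↦ x'`. -/
def horiz : E4 →L[ℝ] E3 :=
  ∑ i : Fin 3, (EuclideanSpace.proj i.castSucc : E4 →L[ℝ] ℝ).smulRight (e3 i)

theorem e3_apply (i j : Fin 3) : e3 i j = if j = i then 1 else 0 := by
  simp [e3]

theorem flat_castSucc (ζ : E3) (i : Fin 3) : flat ζ i.castSucc = ζ i := by
  simp [flat, e4_apply, sum_apply]

theorem flat_three (ζ : E3) : flat ζ 3 = 0 := by
  have : ∀ i : Fin 3, (3 : Fin 4) ≠ i.castSucc := by decide
  simp [flat, e4_apply, sum_apply, this]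

theorem horiz_apply (x : E4) (i : Fin 3) : horiz x i = x i.castSucc := by
  simp [horiz, e3_apply, sum_apply]

theorem E4_ext {x y : E4} (h : ∀ i : Fin 3, x i.castSucc = y i.castSucc) (h3 : x 3 = y 3) :
    x = y := by
  ext i
  exact Fin.lastCases (motive := fun i => x i = y i) h3 h i

theorem horiz_flat (ζ : E3) : horiz (flat ζ) = ζ := by
  ext i
  rw [horiz_apply, flat_castSucc]

theorem e4_three_castSucc (i : Fin 3) : e4 3 i.castSucc = 0 := by
  have : ∀ i : Fin 3, i.castSucc ≠ (3 : Fin 4) := by decide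
  rw [e4_apply, if_neg (this i)]

theorem flat_horiz_add (x : E4) : flat (horiz x) + x 3 • e4 3 = x := by
  refine E4_ext (fun i => ?_) ?_
  · simp [flat_castSucc, horiz_apply, e4_three_castSucc]
  · simp [flat_three, e4_apply]

theorem horiz_e4_three : horiz (e4 3) = 0 := by
  ext i
  rw [horiz_apply, e4_three_castSucc]
  rfl

theorem flat_e3 (i : Fin 3) : flat (e3 i) = e4 i.castSucc := by
  refine E4_ext (fun j => ?_) ?_
  · rw [flat_castSucc, e3_apply, e4_apply]
    simp
  · have : ∀ i : Fin 3, (3 : Fin 4) ≠ i.castSucc := by decide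
    rw [flat_three, e4_apply, if_neg (this i)]

theorem norm_sq_eq_horiz (x : E4) : ‖x‖ ^ 2 = ‖horiz x‖ ^ 2 + x 3 ^ 2 := by
  rw [EuclideanSpace.norm_sq_eq, EuclideanSpace.norm_sq_eq, Fin.sum_univ_castSucc]
  simp only [Real.norm_eq_abs, sq_abs, horiz_apply]
  rfl

theorem norm_flat (ζ : E3) : ‖flat ζ‖ = ‖ζ‖ := by
  have := norm_sq_eq_horiz (flat ζ)
  rw [horiz_flat, flat_three] at this
  exact (sq_eq_sq₀ (norm_nonneg _) (norm_nonneg _)).1 (by linarith)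

theorem norm_horiz_le (x : E4) : ‖horiz x‖ ≤ ‖x‖ := by
  refine (sq_le_sq₀ (norm_nonneg _) (norm_nonneg _)).1 ?_
  rw [norm_sq_eq_horiz x]
  nlinarith

theorem sub_flat_three (x : E4) (ζ : E3) : (x - flat ζ) 3 = x 3 := by
  simp [flat_three]

theorem ne_zero_of_pos {x : E4} (hx : 0 < x 3) : x ≠ 0 := by
  rintro rfl
  simp at hx

theorem sub_flat_ne_zero {x : E4} (hx : 0 < x 3) (ζ : E3) : x - flat ζ ≠ 0 :=
  ne_zero_of_pos (by rwa [sub_flat_three])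

/-- The potential with kernel `K` of a density `h` on the hyperplane. -/
def potential (K : E4 → ℝ) (h : E3 → ℝ) (x : E4) : ℝ := ∫ ζ, h ζ * K (x - flat ζ)

section Potential

variable {K K' : E4 → ℝ} {h h' : E3 → ℝ}

theorem potential_eq_setIntegral (K : E4 → ℝ) (h : E3 → ℝ) :
    potential K h = fun x => ∫ ζ in tsupport h, h ζ * K (x - flat ζ) := by
  funext x
  refine (setIntegral_eq_integral_of_forall_compl_eq_zero fun ζ hζ => ?_).symm
  rw [image_eq_zero_of_notMem_tsupport hζ, zero_mul]

theorem contDiffAt_kernel (hK : ∀ y ≠ 0, ContDiffAt ℝ (⊤ : ℕ∞) K y) :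
    ∀ x ∈ {x : E4 | 0 < x 3}, ∀ ζ ∈ tsupport h, ContDiffAt ℝ (⊤ : ℕ∞)
      (Function.uncurry fun (x : E4) (ζ : E3) => K (x - flat ζ)) (x, ζ) := by
  intro x hx ζ _
  have h1 : ContDiffAt ℝ (⊤ : ℕ∞) (fun p : E4 × E3 => p.1 - flat p.2) (x, ζ) := by fun_prop
  exact (hK _ (sub_flat_ne_zero hx ζ)).comp (x, ζ) (g := K) (f := fun p : E4 × E3 => p.1 - flat p.2) h1

theorem contDiffAt_potential (hK : ∀ y ≠ 0, ContDiffAt ℝ (⊤ : ℕ∞) K y) (hh : Continuous h)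
    (hc : HasCompactSupport h) {x : E4} (hx : 0 < x 3) :
    ContDiffAt ℝ (⊤ : ℕ∞) (potential K h) x := by
  rw [potential_eq_setIntegral]
  exact (contDiffOn_integral_slice isOpen_upper hc hh.continuousOn
    (contDiffAt_kernel hK)).contDiffAt (isOpen_upper.mem_nhds hx)

theorem pd_sub_const (i : Fin 4) (u : E4 → ℝ) (a x : E4) :
    pd i (fun y => u (y - a)) x = pd i u (x - a) := by
  rw [pd, fderiv_comp_sub]
  rfl

theorem pd_potential (hK : ∀ y ≠ 0, ContDiffAt ℝ (⊤ : ℕ∞) K y) (hh : Continuous h)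
    (hc : HasCompactSupport h) (i : Fin 4) {x : E4} (hx : 0 < x 3) :
    pd i (potential K h) x = potential (pd i K) h x := by
  rw [potential_eq_setIntegral, potential_eq_setIntegral]
  refine (fderiv_integral_slice_apply isOpen_upper hc hh.continuousOn
    (contDiffAt_kernel hK) hx (e4 i)).trans ?_
  refine integral_congr_ae (Filter.Eventually.of_forall fun ζ => ?_)
  exact congrArg _ (pd_sub_const i K (flat ζ) x)

theorem contDiffAt_pd_kernel (hK : ∀ y ≠ 0, ContDiffAt ℝ (⊤ : ℕ∞) K y) (i : Fin 4) :
    ∀ y ≠ 0, ContDiffAt ℝ (⊤ : ℕ∞) (pd i K) y := fun y hy => (hK y hy).pd (by simp) i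

theorem potential_congr (hK : ∀ y : E4, 0 < y 3 → K y = K' y) (h : E3 → ℝ) {x : E4}
    (hx : 0 < x 3) : potential K h x = potential K' h x :=
  integral_congr_ae (Filter.Eventually.of_forall fun ζ => by
    simp only
    rw [hK _ (by rwa [sub_flat_three])])

theorem continuous_kernel_slice (hK : ∀ y ≠ 0, ContDiffAt ℝ (⊤ : ℕ∞) K y) {x : E4}
    (hx : 0 < x 3) : Continuous fun ζ : E3 => K (x - flat ζ) :=
  continuous_iff_continuousAt.2 fun ζ =>
    ContinuousAt.comp (f := fun ζ : E3 => x - flat ζ) (hK _ (sub_flat_ne_zero hx ζ)).continuousAt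
      (by fun_prop)

theorem integrable_potential (hK : ∀ y ≠ 0, ContDiffAt ℝ (⊤ : ℕ∞) K y) (hh : Continuous h)
    (hc : HasCompactSupport h) {x : E4} (hx : 0 < x 3) :
    Integrable fun ζ => h ζ * K (x - flat ζ) :=
  (hh.mul (continuous_kernel_slice hK hx)).integrable_of_hasCompactSupport hc.mul_right

/-- Partial derivatives on `ℝ³`. -/
def pd3 (i : Fin 3) (h : E3 → ℝ) (ζ : E3) : ℝ := fderiv ℝ h ζ (e3 i)

theorem potential_pd_castSucc (hK : ∀ y ≠ 0, ContDiffAt ℝ (⊤ : ℕ∞) K y) (hh : ContDiff ℝ 1 h)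
    (hc : HasCompactSupport h) (i : Fin 3) {x : E4} (hx : 0 < x 3) :
    potential (pd i.castSucc K) h x = potential K (pd3 i h) x := by
  have hd : ∀ ζ, HasFDerivAt (fun ζ : E3 => K (x - flat ζ))
      ((fderiv ℝ K (x - flat ζ)).comp (-flat)) ζ := fun ζ =>
    HasFDerivAt.comp ζ (f := fun ζ : E3 => x - flat ζ)
      ((hK _ (sub_flat_ne_zero hx ζ)).diff (by exact_mod_cast le_top)).hasFDerivAt
      (flat.hasFDerivAt.const_sub x)
  have he : ∀ ζ, fderiv ℝ (fun ζ : E3 => K (x - flat ζ)) ζ (e3 i) =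
      -pd i.castSucc K (x - flat ζ) := fun ζ => by
    rw [(hd ζ).fderiv]
    simp [flat_e3, pd]
  have hc' : HasCompactSupport (pd3 i h) := hc.fderiv_apply (𝕜 := ℝ) (e3 i)
  have hh' : Continuous (pd3 i h) := (hh.continuous_fderiv (by simp)).clm_apply continuous_const
  have h1 := integral_mul_fderiv_eq_neg_fderiv_mul_of_integrable (μ := volume) (f := h)
    (g := fun ζ : E3 => K (x - flat ζ)) (v := e3 i)
    (integrable_potential hK hh' hc' hx) (by
      simp_rw [he, mul_neg]
      exact (integrable_potential (contDiffAt_pd_kernel hK i.castSucc) hh.continuous hc hx).neg)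
    (integrable_potential hK hh.continuous hc hx) (fun ζ _ => hh.contDiffAt.differentiableAt (by simp))
    (fun ζ _ => (hd ζ).differentiableAt)
  simp_rw [he, mul_neg, integral_neg, neg_inj] at h1
  exact h1

end Potential

end

section

open MeasureTheory

/-- The Newton kernel `|y|⁻²`. -/
def kerK (y : E4) : ℝ := (‖y‖ ^ 2)⁻¹

/-- The kernel `y₃² |y|⁻⁴`. -/
def kerW (y : E4) : ℝ := y 3 ^ 2 * ((‖y‖ ^ 2)⁻¹) ^ 2

theorem norm_sq_ne_zero {y : E4} (hy : y ≠ 0) : ‖y‖ ^ 2 ≠ 0 :=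
  pow_ne_zero 2 (norm_ne_zero_iff.2 hy)

theorem contDiffAt_kerK (y : E4) (hy : y ≠ 0) : ContDiffAt ℝ (⊤ : ℕ∞) kerK y :=
  (contDiff_norm_sq ℝ).contDiffAt.inv (norm_sq_ne_zero hy)

theorem contDiffAt_kerW (y : E4) (hy : y ≠ 0) : ContDiffAt ℝ (⊤ : ℕ∞) kerW y :=
  ((contDiff_coord 3).contDiffAt.pow 2).mul ((contDiffAt_kerK y hy).pow 2)

theorem pd_kerK (i : Fin 4) {y : E4} (hy : y ≠ 0) :
    pd i kerK y = -(2 * y i * ((‖y‖ ^ 2)⁻¹) ^ 2) := by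
  have h := pd_inv (Q := fun y : E4 => ‖y‖ ^ 2) (x := y)
    ((contDiff_norm_sq ℝ (n := 1)).contDiffAt.diff le_rfl) (norm_sq_ne_zero hy) i
  rw [pd_norm_sq] at h
  rw [show kerK = fun y : E4 => (‖y‖ ^ 2)⁻¹ from rfl, h]
  ring

theorem lap_kerK {y : E4} (hy : y ≠ 0) : lap kerK y = 0 := by
  have h := lap_inv (Q := fun y : E4 => ‖y‖ ^ 2) (x := y)
    (contDiff_norm_sq ℝ).contDiffAt (norm_sq_ne_zero hy)
  rw [show kerK = fun y : E4 => (‖y‖ ^ 2)⁻¹ from rfl, h, lap_norm_sq]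
  have hs : ∑ i, pd i (fun y : E4 => ‖y‖ ^ 2) y ^ 2 = 4 * ‖y‖ ^ 2 := by
    rw [norm_sq_eq_sum, Finset.mul_sum]
    exact Finset.sum_congr rfl fun i _ => by rw [pd_norm_sq]; ring
  rw [hs]
  field_simp [norm_ne_zero_iff.2 hy]
  ring

theorem kerW_eq {y : E4} (hy : y ≠ 0) : kerW y = y 3 * (-(1 / 2) * pd 3 kerK y) := by
  rw [pd_kerK 3 hy, kerW]
  ring

theorem eventually_ne_zero {y : E4} (hy : y ≠ 0) : ∀ᶠ z in 𝓝 y, z ≠ 0 :=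
  isOpen_ne.mem_nhds hy

theorem pd_kerW (i : Fin 4) {y : E4} (hy : y ≠ 0) :
    pd i kerW y = 2 * y 3 * (if 3 = i then 1 else 0) * ((‖y‖ ^ 2)⁻¹) ^ 2 -
      4 * y 3 ^ 2 * y i * ((‖y‖ ^ 2)⁻¹) ^ 3 := by
  have h := pd_inv_sq (Q := fun y : E4 => ‖y‖ ^ 2) (x := y)
    ((contDiff_norm_sq ℝ (n := 1)).contDiffAt.diff le_rfl) (norm_sq_ne_zero hy) i
  rw [pd_norm_sq] at h
  have hd := ((contDiffAt_kerK y hy).pow 2).diff ENat.LEInfty.out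
  have hc : DifferentiableAt ℝ (fun y : E4 => y 3) y := differentiableAt_coord 3 y
  have h2 : pd i (fun y : E4 => y 3 ^ 2) y = 2 * y 3 * (if 3 = i then 1 else 0) := by
    simp_rw [pow_two]
    rw [pd_mul hc hc, pd_coord]
    ring
  have h3 : pd i kerW y = _ := pd_mul (i := i) (hc.fun_pow 2) hd
  rw [h3, h2]
  change _ * pd i (fun y => (‖y‖ ^ 2)⁻¹ ^ 2) y + (‖y‖ ^ 2)⁻¹ ^ 2 * _ = _
  rw [h]
  ring

theorem lap_pd_kerK {y : E4} (hy : y ≠ 0) (i : Fin 4) : lap (pd i kerK) y = 0 := by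
  rw [lap_pd ((contDiffAt_kerK y hy).of_le ENat.LEInfty.out)]
  have h : lap kerK =ᶠ[𝓝 y] fun _ => (0 : ℝ) := (eventually_ne_zero hy).mono fun z hz => lap_kerK hz
  rw [(pd_congr h i).eq_of_nhds, pd_const]

/-- The difference of the two kernels. -/
def kerT (y : E4) : ℝ := kerK y + -1 * kerW y

theorem contDiffAt_kerT (y : E4) (hy : y ≠ 0) : ContDiffAt ℝ (⊤ : ℕ∞) kerT y :=
  (contDiffAt_kerK y hy).add (contDiffAt_const.mul (contDiffAt_kerW y hy))

theorem pd_kerT (i : Fin 4) {y : E4} (hy : y ≠ 0) :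
    pd i kerT y = pd i kerK y + -1 * pd i kerW y := by
  have h1 := (contDiffAt_kerK y hy).diff ENat.LEInfty.out
  have h2 := (contDiffAt_kerW y hy).diff ENat.LEInfty.out
  rw [show kerT = fun y => kerK y + (fun y => -1 * kerW y) y from rfl,
    pd_add h1 (h2.const_mul _), pd_const_mul]

theorem pd_three_pd_three_kerW {y : E4} (hy : y ≠ 0) :
    pd 3 (pd 3 kerW) y = ∑ j : Fin 3, pd j.castSucc (pd j.castSucc kerT) y := by
  have hk := (contDiffAt_kerK y hy).of_le (m := 2) ENat.LEInfty.out
  have hw := (contDiffAt_kerW y hy).of_le (m := 2) ENat.LEInfty.out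
  have h1 : lap kerT y = -lap kerW y := by
    rw [show kerT = fun y => kerK y + (fun y => -1 * kerW y) y from rfl,
      lap_add hk (contDiffAt_const.mul hw), lap_const_mul, lap_kerK hy]
    ring
  have h2 : lap kerW y = -pd 3 (pd 3 kerK) y := by
    have h : kerW =ᶠ[𝓝 y] fun y => y 3 * (fun y => -(1 / 2) * pd 3 kerK y) y :=
      (eventually_ne_zero hy).mono fun z hz => kerW_eq hz
    have hd := contDiffAt_pd_kernel contDiffAt_kerK 3 y hy
    rw [(lap_congr h).eq_of_nhds, lap_coord_mul, pd_const_mul]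
    · ring
    · exact contDiffAt_const.mul (hd.of_le ENat.LEInfty.out)
    · rw [lap_const_mul, lap_pd_kerK hy, mul_zero]
  have h3 : pd 3 (pd 3 kerT) y = pd 3 (pd 3 kerK) y + -1 * pd 3 (pd 3 kerW) y := by
    have h : pd 3 kerT =ᶠ[𝓝 y] fun y => pd 3 kerK y + (fun y => -1 * pd 3 kerW y) y :=
      (eventually_ne_zero hy).mono fun z hz => pd_kerT 3 hz
    have h1 := (contDiffAt_pd_kernel contDiffAt_kerK 3 y hy).diff ENat.LEInfty.out
    have h2 := (contDiffAt_pd_kernel contDiffAt_kerW 3 y hy).diff ENat.LEInfty.out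
    rw [(pd_congr h 3).eq_of_nhds, pd_add h1 (h2.const_mul _), pd_const_mul]
  rw [lap_eq, Fin.sum_univ_castSucc] at h1
  change _ + pd 3 (pd 3 kerT) y = _ at h1
  linarith

end

section

open MeasureTheory

theorem integrable_inv_one_add_norm_sq_sq :
    Integrable fun y : E3 => ((1 + ‖y‖ ^ 2) ^ 2)⁻¹ := by
  have h := integrable_rpow_neg_one_add_norm_sq (E := E3) (μ := volume) (r := 4)
    (by simp; norm_num)
  refine h.congr (Filter.Eventually.of_forall fun y => ?_)
  have h1 : (0 : ℝ) ≤ 1 + ‖y‖ ^ 2 := by positivity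
  simp only
  rw [show (-4 / 2 : ℝ) = -(2 : ℕ) by norm_num, Real.rpow_neg h1, Real.rpow_natCast]

theorem flat_add_e4_three_coord (y : E3) : (flat y + e4 3) 3 = 1 := by
  simp [flat_three, e4_apply]

theorem norm_sq_flat_add (y : E3) (t : ℝ) : ‖flat y + t • e4 3‖ ^ 2 = ‖y‖ ^ 2 + t ^ 2 := by
  rw [norm_sq_eq_horiz, map_add, map_smul, horiz_flat, horiz_e4_three]
  simp [flat_three, e4_apply]

theorem norm_sq_flat_add_e4_three (y : E3) : ‖flat y + e4 3‖ ^ 2 = 1 + ‖y‖ ^ 2 := by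
  have := norm_sq_flat_add y 1
  rw [one_smul] at this
  linarith

theorem flat_add_e4_three_ne_zero (y : E3) : flat y + e4 3 ≠ 0 := fun h => by
  have := flat_add_e4_three_coord y
  rw [h] at this
  simp at this

/-- The potential of a kernel homogeneous of degree `-3`, after rescaling the density. -/
def scaled (K : E4 → ℝ) (h : E3 → ℝ) (x : E4) : ℝ :=
  ∫ y, h (horiz x - x 3 • y) * K (flat y + e4 3)

theorem potential_eq_scaled {K : E4 → ℝ} (hK : ∀ t > 0, ∀ y ≠ 0, K (t • y) = (t ^ 3)⁻¹ * K y)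
    (h : E3 → ℝ) {x : E4} (hx : 0 < x 3) : potential K h x = scaled K h x := by
  have h1 := integral_sub_left_eq_self (fun ζ => h ζ * K (x - flat ζ)) (volume : Measure E3)
    (horiz x)
  have h2 := Measure.integral_comp_smul (volume : Measure E3)
    (fun z => h (horiz x - z) * K (x - flat (horiz x - z))) (x 3)
  have h3 : 0 < x 3 ^ 3 := by positivity
  rw [h1, finrank_euclideanSpace_fin, abs_of_pos (inv_pos.2 h3), smul_eq_mul,
    eq_inv_mul_iff_mul_eq₀ h3.ne', ← integral_const_mul] at h2
  rw [potential, ← h2, scaled]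
  refine integral_congr_ae (Filter.Eventually.of_forall fun y => ?_)
  have h4 : x - flat (horiz x - x 3 • y) = x 3 • (flat y + e4 3) := by
    conv_lhs => lhs; rw [← flat_horiz_add x]
    rw [map_sub, map_smul, smul_add]
    abel
  simp only
  rw [h4, hK _ hx _ (flat_add_e4_three_ne_zero y)]
  field_simp

theorem continuous_scaled {K : E4 → ℝ} {h : E3 → ℝ} {C : ℝ}
    (hKb : ∀ y : E3, |K (flat y + e4 3)| ≤ C * ((1 + ‖y‖ ^ 2) ^ 2)⁻¹)
    (hKc : Continuous fun y : E3 => K (flat y + e4 3)) (hh : Continuous h)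
    (hc : HasCompactSupport h) : Continuous (scaled K h) := by
  obtain ⟨M, hM⟩ := hh.bounded_above_of_compact_support hc
  refine continuous_of_dominated (bound := fun y => M * (C * ((1 + ‖y‖ ^ 2) ^ 2)⁻¹))
    (fun x => ?_) (fun x => Filter.Eventually.of_forall fun y => ?_)
    ((integrable_inv_one_add_norm_sq_sq.const_mul C).const_mul M)
    (Filter.Eventually.of_forall fun y => ?_)
  · exact ((hh.comp (by fun_prop)).mul hKc).aestronglyMeasurable
  · rw [norm_mul]
    exact mul_le_mul (hM _) (hKb y) (abs_nonneg _) ((norm_nonneg _).trans (hM 0))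
  · have := continuous_coord 3
    exact (hh.comp (by fun_prop)).mul continuous_const

theorem extC_zero_scaled {K : E4 → ℝ} {h : E3 → ℝ} {C : ℝ}
    (hK : ∀ t > 0, ∀ y ≠ 0, K (t • y) = (t ^ 3)⁻¹ * K y)
    (hKb : ∀ y : E3, |K (flat y + e4 3)| ≤ C * ((1 + ‖y‖ ^ 2) ^ 2)⁻¹)
    (hKc : Continuous fun y : E3 => K (flat y + e4 3)) (hh : Continuous h)
    (hc : HasCompactSupport h) : ExtC 0 (potential K h) :=
  ⟨scaled K h, continuous_scaled hKb hKc hh hc, fun _ hx => potential_eq_scaled hK h hx⟩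

theorem abs_coord_le (y : E4) (i : Fin 4) : |y i| ≤ ‖y‖ := PiLp.norm_apply_le y i

theorem continuous_kernel_flat {K : E4 → ℝ} (hK : ∀ y ≠ 0, ContDiffAt ℝ (⊤ : ℕ∞) K y) :
    Continuous fun y : E3 => K (flat y + e4 3) :=
  continuous_iff_continuousAt.2 fun y =>
    ContinuousAt.comp (f := fun y : E3 => flat y + e4 3)
      (hK _ (flat_add_e4_three_ne_zero y)).continuousAt (by fun_prop)


theorem inv_norm_sq_smul (t : ℝ) (y : E4) :
    (‖t • y‖ ^ 2)⁻¹ = (t ^ 2)⁻¹ * (‖y‖ ^ 2)⁻¹ := by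
  rw [norm_smul, mul_pow, mul_inv, Real.norm_eq_abs, sq_abs]

theorem pd_kerK_smul (i : Fin 4) {t : ℝ} (ht : 0 < t) {y : E4} (hy : y ≠ 0) :
    pd i kerK (t • y) = (t ^ 3)⁻¹ * pd i kerK y := by
  rw [pd_kerK i hy, pd_kerK i (smul_ne_zero ht.ne' hy), inv_norm_sq_smul]
  simp only [PiLp.smul_apply, smul_eq_mul]
  field_simp

theorem pd_kerW_smul (i : Fin 4) {t : ℝ} (ht : 0 < t) {y : E4} (hy : y ≠ 0) :
    pd i kerW (t • y) = (t ^ 3)⁻¹ * pd i kerW y := by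
  rw [pd_kerW i hy, pd_kerW i (smul_ne_zero ht.ne' hy), inv_norm_sq_smul]
  simp only [PiLp.smul_apply, smul_eq_mul]
  generalize (‖y‖ ^ 2)⁻¹ = q
  field_simp

section

variable {h : E3 → ℝ}

theorem pd_three_kerK_flat (y : E3) :
    pd 3 kerK (flat y + e4 3) = -2 * ((1 + ‖y‖ ^ 2) ^ 2)⁻¹ := by
  rw [pd_kerK 3 (flat_add_e4_three_ne_zero y), norm_sq_flat_add_e4_three,
    flat_add_e4_three_coord, inv_pow]
  ring

theorem extC_zero_pd_three_kerK (hh : Continuous h) (hc : HasCompactSupport h) :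
    ExtC 0 (potential (pd 3 kerK) h) := by
  refine extC_zero_scaled (C := 2) (fun t ht y hy => pd_kerK_smul 3 ht hy) (fun y => ?_)
    (continuous_kernel_flat (contDiffAt_pd_kernel contDiffAt_kerK 3)) hh hc
  rw [pd_three_kerK_flat, abs_mul, abs_of_pos (by positivity : 0 < ((1 + ‖y‖ ^ 2) ^ 2)⁻¹)]
  norm_num

theorem extC_zero_pd_kerW (i : Fin 4) (hh : Continuous h) (hc : HasCompactSupport h) :
    ExtC 0 (potential (pd i kerW) h) := by
  refine extC_zero_scaled (C := 6) (fun t ht y hy => pd_kerW_smul i ht hy) (fun y => ?_)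
    (continuous_kernel_flat (contDiffAt_pd_kernel contDiffAt_kerW i)) hh hc
  rw [pd_kerW i (flat_add_e4_three_ne_zero y), flat_add_e4_three_coord,
    norm_sq_flat_add_e4_three]
  have h1 : |(flat y + e4 3) i| ≤ 1 + ‖y‖ ^ 2 := by
    have h2 := abs_coord_le (flat y + e4 3) i
    have h3 := norm_sq_flat_add_e4_three y
    nlinarith [sq_nonneg (‖flat y + e4 3‖ - 1), sq_nonneg ‖y‖]
  generalize (flat y + e4 3) i = a at h1
  have hQ : 0 < 1 + ‖y‖ ^ 2 := by positivity
  generalize 1 + ‖y‖ ^ 2 = Q at h1 hQ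
  have h4 : |4 * 1 ^ 2 * a * Q⁻¹ ^ 3| ≤ 4 * (Q ^ 2)⁻¹ := by
    rw [abs_mul, abs_of_pos (by positivity : 0 < Q⁻¹ ^ 3), abs_mul]
    calc |4 * 1 ^ 2| * |a| * Q⁻¹ ^ 3 ≤ |4 * 1 ^ 2| * Q * Q⁻¹ ^ 3 := by gcongr
      _ = 4 * (Q ^ 2)⁻¹ := by norm_num; field_simp
  refine (abs_sub _ _).trans ?_
  have h5 : |2 * 1 * (if 3 = i then 1 else 0) * Q⁻¹ ^ 2| ≤ 2 * (Q ^ 2)⁻¹ := by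
    split_ifs
    · rw [inv_pow, abs_of_pos (by positivity)]
      linarith
    · simp
      positivity
  linarith

theorem extC_zero_kerW (hh : Continuous h) (hc : HasCompactSupport h) :
    ExtC 0 (potential kerW h) := by
  obtain ⟨v, hv, h1⟩ := extC_zero_pd_three_kerK hh hc
  refine ⟨fun x => x 3 * (-(1 / 2) * v x), (continuous_coord 3).mul (continuous_const.mul hv),
    fun x hx => ?_⟩
  simp only
  rw [← h1 x hx, potential, potential, ← integral_const_mul, ← integral_const_mul]
  refine integral_congr_ae (Filter.Eventually.of_forall fun ζ => ?_)
  simp only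
  rw [kerW_eq (sub_flat_ne_zero hx ζ), sub_flat_three]
  ring

/-- The odd part of the convolution with the kernel `∂ⱼ|y|⁻²`. -/
def oddPotential (j : Fin 3) (h : E3 → ℝ) (x : E4) : ℝ :=
  ∫ z, (1 / 2) * (h (horiz x - z) - h (horiz x + z)) * pd j.castSucc kerK (flat z + x 3 • e4 3)

theorem flat_add_smul_ne_zero_of_left {z : E3} (hz : z ≠ 0) (t : ℝ) : flat z + t • e4 3 ≠ 0 :=
  fun h => hz (by
    have := congrArg horiz h
    simpa [horiz_flat, horiz_e4_three] using this)

theorem flat_add_smul_ne_zero_of_right (z : E3) {t : ℝ} (ht : 0 < t) : flat z + t • e4 3 ≠ 0 :=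
  ne_zero_of_pos (by simpa [flat_three, e4_apply] using ht)

theorem pd_kerK_flat (j : Fin 3) {z : E3} {t : ℝ} (h : flat z + t • e4 3 ≠ 0) :
    pd j.castSucc kerK (flat z + t • e4 3) = -(2 * z j * ((‖z‖ ^ 2 + t ^ 2)⁻¹) ^ 2) := by
  rw [pd_kerK _ h, norm_sq_flat_add]
  simp [flat_castSucc, e4_three_castSucc]

theorem potential_eq_oddPotential (hh : Continuous h) (hc : HasCompactSupport h) (j : Fin 3)
    {x : E4} (hx : 0 < x 3) :
    potential (pd j.castSucc kerK) h x = oddPotential j h x := by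
  have hi := integrable_potential (contDiffAt_pd_kernel contDiffAt_kerK j.castSucc) hh hc hx
  have h1 := integral_sub_left_eq_self (fun ζ => h ζ * pd j.castSucc kerK (x - flat ζ))
    (volume : Measure E3) (horiz x)
  have h2 := integral_add_left_eq_self (μ := (volume : Measure E3))
    (fun ζ => h ζ * pd j.castSucc kerK (x - flat ζ)) (horiz x)
  have i1 := hi.comp_sub_left (horiz x)
  have i2 := hi.comp_add_left (horiz x)
  rw [← potential] at h1 h2
  have h3 : potential (pd j.castSucc kerK) h x = (1 / 2) * (potential (pd j.castSucc kerK) h x +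
      potential (pd j.castSucc kerK) h x) := by ring
  rw [h3]
  nth_rewrite 1 [← h1]
  rw [← h2, ← integral_add i1 i2, ← integral_const_mul, oddPotential]
  refine integral_congr_ae (Filter.Eventually.of_forall fun z => ?_)
  have h4 : x - flat (horiz x - z) = flat z + x 3 • e4 3 := by
    conv_lhs => lhs; rw [← flat_horiz_add x]
    rw [map_sub]
    abel
  have h5 : x - flat (horiz x + z) = flat (-z) + x 3 • e4 3 := by
    conv_lhs => lhs; rw [← flat_horiz_add x]
    rw [map_add, map_neg]
    abel
  simp only
  rw [h4, h5, pd_kerK_flat j (flat_add_smul_ne_zero_of_right z hx),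
    pd_kerK_flat j (flat_add_smul_ne_zero_of_right (-z) hx), norm_neg, PiLp.neg_apply]
  ring

theorem continuous_oddPotential {L : NNReal} (hL : LipschitzWith L h)
    (hc : HasCompactSupport h) (j : Fin 3) : Continuous (oddPotential j h) := by
  obtain ⟨R, hR⟩ := hc.isCompact.isBounded.subset_closedBall 0
  refine continuous_iff_continuousAt.2 fun x₀ => ?_
  have hz : ∀ᵐ z : E3, z ≠ 0 := by
    simp [ae_iff]
  have hmem : {x : E4 | ‖x - x₀‖ < 1} ∈ 𝓝 x₀ := by
    refine IsOpen.mem_nhds (isOpen_lt (by fun_prop) continuous_const) ?_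
    simp
  set R' := R + ‖x₀‖ + 2
  have hfin : Module.finrank ℝ E3 = 3 := finrank_euclideanSpace_fin
  have hpow : IntegrableOn (fun z : E3 => 2 * L * ‖z‖ ^ (-2 : ℝ)) (Metric.ball 0 R') := by
    refine integrableOn_ball_of_norm_le_rpow (C := 2 * L) (α := 2) (by rw [hfin]; norm_num)
      (by rw [hfin]; norm_num) (Filter.Eventually.of_forall fun z => ?_) ?_
    · rw [Real.norm_of_nonneg (by positivity)]
    · exact (Measurable.aestronglyMeasurable (by fun_prop))
  rw [← integrable_indicator_iff measurableSet_ball] at hpow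
  refine continuousAt_of_dominated (Filter.Eventually.of_forall fun x => ?_)
    (Filter.eventually_of_mem hmem fun x hx => ?_) hpow ?_
  · refine ((((hL.continuous.comp (by fun_prop)).sub (hL.continuous.comp
      (by fun_prop))).measurable.const_mul _).mul ?_).aestronglyMeasurable
    exact (measurable_fderiv_apply_const ℝ _ _).comp (by fun_prop)
  · filter_upwards [hz] with z hz0
    have hx' : ‖horiz x‖ < ‖x₀‖ + 1 := by
      have h1 := norm_horiz_le x
      have h2 := norm_le_norm_add_norm_sub' x x₀
      have h3 : ‖x - x₀‖ < 1 := hx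
      linarith
    by_cases hzR : z ∈ Metric.ball (0 : E3) R'
    · rw [indicator_of_mem hzR, pd_kerK_flat j (flat_add_smul_ne_zero_of_left hz0 _)]
      have hn : 0 < ‖z‖ := norm_pos_iff.2 hz0
      have h1 : |h (horiz x - z) - h (horiz x + z)| ≤ L * (2 * ‖z‖) := by
        have := hL.norm_sub_le (horiz x - z) (horiz x + z)
        rw [show horiz x - z - (horiz x + z) = -((2 : ℝ) • z) by module, norm_neg, norm_smul,
          Real.norm_eq_abs, Real.norm_eq_abs, abs_two] at this
        exact this
      have h2 : |z j| ≤ ‖z‖ := PiLp.norm_apply_le z j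
      have h3 : (‖z‖ ^ 2 + x 3 ^ 2)⁻¹ ≤ (‖z‖ ^ 2)⁻¹ := by
        gcongr
        nlinarith
      have h4 : ‖z‖ ^ (-2 : ℝ) = (‖z‖ ^ 2)⁻¹ := by
        rw [Real.rpow_neg hn.le]
        norm_num
      rw [h4, Real.norm_eq_abs, abs_mul, abs_mul, abs_neg, abs_mul, abs_mul,
        abs_of_pos (by positivity : 0 < (‖z‖ ^ 2 + x 3 ^ 2)⁻¹ ^ 2), abs_two,
        abs_of_pos (by norm_num : (0 : ℝ) < 1 / 2)]
      calc 1 / 2 * |h (horiz x - z) - h (horiz x + z)| *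
            (2 * |z j| * (‖z‖ ^ 2 + x 3 ^ 2)⁻¹ ^ 2)
          ≤ 1 / 2 * (L * (2 * ‖z‖)) * (2 * ‖z‖ * (‖z‖ ^ 2)⁻¹ ^ 2) := by gcongr
        _ = 2 * L * (‖z‖ ^ 2)⁻¹ := by field_simp
    · have hz1 : R' ≤ ‖z‖ := by simpa using hzR
      have h0 : ∀ w : E3, R < ‖w‖ → h w = 0 := fun w hw =>
        image_eq_zero_of_notMem_tsupport fun hm => by
          have := hR hm
          rw [mem_closedBall_zero_iff] at this
          linarith
      have h1 := norm_sub_norm_le z (horiz x)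
      have h2 : ‖z‖ ≤ ‖horiz x + z‖ + ‖horiz x‖ := by
        have := norm_sub_le (horiz x + z) (horiz x)
        rwa [add_sub_cancel_left] at this
      rw [indicator_of_notMem hzR, h0, h0]
      · simp
      · linarith
      · rw [norm_sub_rev]
        linarith
  · filter_upwards [hz] with z hz0
    have hcK := (contDiffAt_pd_kernel contDiffAt_kerK j.castSucc _
      (flat_add_smul_ne_zero_of_left hz0 (x₀ 3))).continuousAt
    have hco := continuous_coord 3
    have hcc := hL.continuous
    have hf : ContinuousAt (fun x : E4 => flat z + x 3 • e4 3) x₀ := by fun_prop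
    exact ContinuousAt.mul (by fun_prop) (ContinuousAt.comp
      (f := fun x : E4 => flat z + x 3 • e4 3) hcK hf)

theorem extC_zero_pd_kerK {L : NNReal} (hL : LipschitzWith L h) (hc : HasCompactSupport h)
    (i : Fin 4) : ExtC 0 (potential (pd i kerK) h) := by
  induction i using Fin.lastCases with
  | last => exact extC_zero_pd_three_kerK hL.continuous hc
  | cast j => exact ⟨oddPotential j h, continuous_oddPotential hL hc j, fun x hx =>
      potential_eq_oddPotential hL.continuous hc j hx⟩

end

end

section

open MeasureTheory

/-- `Reg n h`: `h` has compact support and Lipschitz derivatives of order `n`. -/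
def Reg : ℕ → (E3 → ℝ) → Prop
  | 0, h => (∃ L, LipschitzWith L h) ∧ HasCompactSupport h
  | n + 1, h => ContDiff ℝ 1 h ∧ HasCompactSupport h ∧ ∀ j, Reg n (pd3 j h)

theorem Reg.zero {n : ℕ} {h : E3 → ℝ} (hr : Reg n h) : Reg 0 h := by
  cases n with
  | zero => exact hr
  | succ n =>
    obtain ⟨C, hC⟩ := ContDiff.lipschitzWith_of_hasCompactSupport hr.2.1 hr.1 one_ne_zero
    exact ⟨⟨C, hC⟩, hr.2.1⟩

theorem Reg.continuous {n : ℕ} {h : E3 → ℝ} (hr : Reg n h) : Continuous h :=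
  hr.zero.1.choose_spec.continuous

theorem Reg.hasCompactSupport {n : ℕ} {h : E3 → ℝ} (hr : Reg n h) : HasCompactSupport h :=
  hr.zero.2

theorem Reg.contDiff {n : ℕ} {h : E3 → ℝ} (hr : Reg (n + 1) h) : ContDiff ℝ 1 h := hr.1

theorem Reg.pd3 {n : ℕ} {h : E3 → ℝ} (hr : Reg (n + 1) h) (j : Fin 3) : Reg n (pd3 j h) :=
  hr.2.2 j

section

variable {K : E4 → ℝ} {h : E3 → ℝ}

theorem ExtC.add_const_mul {u v : E4 → ℝ} (hu : ExtC 0 u) (hv : ExtC 0 v) (c : ℝ) :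
    ExtC 0 fun x => u x + c * v x := by
  obtain ⟨u', hu, h1⟩ := hu
  obtain ⟨v', hv, h2⟩ := hv
  exact ⟨fun x => u' x + c * v' x, hu.add (continuous_const.mul hv), fun x hx => by
    simp only
    rw [h1 x hx, h2 x hx]⟩

theorem extC_zero_sum {ι : Type*} (s : Finset ι) {u : ι → E4 → ℝ} (hu : ∀ i ∈ s, ExtC 0 (u i)) :
    ExtC 0 fun x => ∑ i ∈ s, u i x := by
  choose! v hv h1 using hu
  exact ⟨fun x => ∑ i ∈ s, v i x, continuous_finsetSum s hv, fun x hx =>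
    Finset.sum_congr rfl fun i hi => h1 i hi x hx⟩

theorem extC_sum {n : ℕ} {ι : Type*} (s : Finset ι) : ∀ {u : ι → E4 → ℝ},
    (∀ i ∈ s, ∀ x : E4, 0 < x 3 → ContDiffAt ℝ (⊤ : ℕ∞) (u i) x) → (∀ i ∈ s, ExtC n (u i)) →
    ExtC n fun x => ∑ i ∈ s, u i x := by
  induction n with
  | zero => exact fun _ hu => extC_zero_sum s hu
  | succ n ih =>
    intro u hs hu
    refine ⟨extC_zero_sum s fun i hi => (hu i hi).zero, fun j => ?_⟩
    refine (ih (fun i hi x hx => (hs i hi x hx).pd (by simp) j) fun i hi => (hu i hi).2 j).congr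
      fun x hx => pd_sum (fun i hi => (hs i hi x hx).diff ENat.LEInfty.out) j

theorem extC_zero_pd_kerT (hr : Reg 0 h) (i : Fin 4) : ExtC 0 (potential (pd i kerT) h) := by
  have hh := hr.continuous
  obtain ⟨⟨L, hL⟩, hc⟩ := hr
  refine ((extC_zero_pd_kerK hL hc i).add_const_mul (extC_zero_pd_kerW i hh hc) (-1)).congr
    fun x hx => ?_
  rw [potential_congr (fun y hy => pd_kerT i (ne_zero_of_pos hy)) h hx]
  simp only [potential]
  rw [← integral_const_mul, ← integral_add
    (integrable_potential (contDiffAt_pd_kernel contDiffAt_kerK i) hh hc hx)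
    ((integrable_potential (contDiffAt_pd_kernel contDiffAt_kerW i) hh hc hx).const_mul _)]
  exact integral_congr_ae (Filter.Eventually.of_forall fun ζ => by simp only; ring)

/-- One step of the regularity induction for potentials. -/
theorem extC_potential_succ {n m : ℕ} (hK : ∀ y ≠ 0, ContDiffAt ℝ (⊤ : ℕ∞) K y)
    (hr : Reg (m + 1) h) (h0 : ExtC 0 (potential K h))
    (h1 : ∀ j, ExtC n (potential K (pd3 j h))) (h2 : ExtC n (potential (pd 3 K) h)) :
    ExtC (n + 1) (potential K h) := by
  have hp := fun (i : Fin 4) (x : E4) (hx : 0 < x 3) =>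
    pd_potential hK hr.continuous hr.hasCompactSupport i hx
  refine ⟨h0, fun i => ?_⟩
  induction i using Fin.lastCases with
  | last => exact h2.congr (hp 3)
  | cast j =>
    exact (h1 j).congr fun x hx => (hp _ x hx).trans
      (potential_pd_castSucc hK hr.contDiff hr.hasCompactSupport j hx)

theorem potential_pd_three_kerT {m : ℕ} (hr : Reg (m + 1) h) (j : Fin 3) {x : E4}
    (hx : 0 < x 3) :
    potential (pd 3 (pd j.castSucc kerT)) h x = potential (pd 3 kerT) (pd3 j h) x := by
  rw [← potential_pd_castSucc (contDiffAt_pd_kernel contDiffAt_kerT 3) hr.contDiff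
    hr.hasCompactSupport j hx]
  refine potential_congr (fun y hy => ?_) h hx
  exact pd_comm ((contDiffAt_kerT y (ne_zero_of_pos hy)).of_le ENat.LEInfty.out) _ _

theorem potential_pd_three_pd_three_kerW {m : ℕ} (hr : Reg (m + 1) h) {x : E4} (hx : 0 < x 3) :
    potential (pd 3 (pd 3 kerW)) h x =
      ∑ j : Fin 3, potential (pd j.castSucc kerT) (pd3 j h) x := by
  rw [potential_congr (fun y hy => pd_three_pd_three_kerW (ne_zero_of_pos hy)) h hx]
  have hT := fun j : Fin 3 => contDiffAt_pd_kernel (contDiffAt_pd_kernel contDiffAt_kerT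
    j.castSucc) j.castSucc
  simp_rw [← fun j : Fin 3 => potential_pd_castSucc (contDiffAt_pd_kernel contDiffAt_kerT
    j.castSucc) hr.contDiff hr.hasCompactSupport j hx, potential]
  rw [← integral_finsetSum _ fun j _ =>
    integrable_potential (hT j) hr.continuous hr.hasCompactSupport hx]
  simp_rw [Finset.mul_sum]

theorem extC_one_kerW {m : ℕ} (hr : Reg m h) : ExtC 1 (potential kerW h) :=
  ⟨extC_zero_kerW hr.continuous hr.hasCompactSupport, fun i =>
    (extC_zero_pd_kerW i hr.continuous hr.hasCompactSupport).congr fun _ hx =>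
      pd_potential contDiffAt_kerW hr.continuous hr.hasCompactSupport i hx⟩

theorem extC_one_pd_three_kerW {m : ℕ} (hr : Reg (m + 1) h) :
    ExtC 1 (potential (pd 3 kerW) h) :=
  extC_potential_succ (contDiffAt_pd_kernel contDiffAt_kerW 3) hr
    (extC_zero_pd_kerW 3 hr.continuous hr.hasCompactSupport)
    (fun j => extC_zero_pd_kerW 3 (hr.pd3 j).continuous (hr.pd3 j).hasCompactSupport)
    ((extC_zero_sum Finset.univ fun j _ => extC_zero_pd_kerT (hr.pd3 j).zero _).congr
      fun _ hx => potential_pd_three_pd_three_kerW hr hx)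

theorem extC_two_kerW {m : ℕ} (hr : Reg (m + 1) h) : ExtC 2 (potential kerW h) :=
  extC_potential_succ contDiffAt_kerW hr (extC_one_kerW hr).zero
    (fun j => extC_one_kerW (hr.pd3 j)) (extC_one_pd_three_kerW hr)

theorem extC_one_pd_kerT {m : ℕ} (hr : Reg (m + 1) h) (i : Fin 3) :
    ExtC 1 (potential (pd i.castSucc kerT) h) :=
  extC_potential_succ (contDiffAt_pd_kernel contDiffAt_kerT _) hr (extC_zero_pd_kerT hr.zero _)
    (fun j => extC_zero_pd_kerT (hr.pd3 j).zero _)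
    ((extC_zero_pd_kerT (hr.pd3 i).zero 3).congr fun _ hx => potential_pd_three_kerT hr i hx)

theorem extC_two_pd_three_kerW {m : ℕ} (hr : Reg (m + 2) h) :
    ExtC 2 (potential (pd 3 kerW) h) :=
  extC_potential_succ (contDiffAt_pd_kernel contDiffAt_kerW 3) hr
    (extC_zero_pd_kerW 3 hr.continuous hr.hasCompactSupport)
    (fun j => extC_one_pd_three_kerW (hr.pd3 j))
    ((extC_sum Finset.univ (fun j _ _ hx => contDiffAt_potential
      (contDiffAt_pd_kernel contDiffAt_kerT j.castSucc) (hr.pd3 j).continuous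
      (hr.pd3 j).hasCompactSupport hx) fun j _ => extC_one_pd_kerT (hr.pd3 j) j).congr
        fun _ hx => potential_pd_three_pd_three_kerW hr hx)

theorem extC_three_kerW {m : ℕ} (hr : Reg (m + 2) h) : ExtC 3 (potential kerW h) :=
  extC_potential_succ contDiffAt_kerW hr (extC_one_kerW hr).zero
    (fun j => extC_two_kerW (hr.pd3 j)) (extC_two_pd_three_kerW hr)

end

end

section

open MeasureTheory

theorem lap_potential {K : E4 → ℝ} {h : E3 → ℝ} (hK : ∀ y ≠ 0, ContDiffAt ℝ (⊤ : ℕ∞) K y)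
    (hl : ∀ y ≠ 0, lap K y = 0) (hh : Continuous h) (hc : HasCompactSupport h) {x : E4}
    (hx : 0 < x 3) : lap (potential K h) x = 0 := by
  have h1 : ∀ i, pd i (pd i (potential K h)) x = potential (pd i (pd i K)) h x := fun i => by
    rw [pd_congr_upper (fun y hy => pd_potential hK hh hc i hy) i x hx,
      pd_potential (contDiffAt_pd_kernel hK i) hh hc i hx]
  rw [lap_eq]
  simp_rw [h1, potential]
  rw [← integral_finsetSum _ fun i _ => integrable_potential
    (contDiffAt_pd_kernel (contDiffAt_pd_kernel hK i) i) hh hc hx]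
  refine integral_eq_zero_of_ae (Filter.Eventually.of_forall fun ζ => ?_)
  have h2 := hl _ (sub_flat_ne_zero hx ζ)
  rw [lap_eq] at h2
  simp only [Pi.zero_apply]
  rw [← Finset.mul_sum, h2, mul_zero]

theorem uniqueDiffOn_halfspace : UniqueDiffOn ℝ {x : E4 | 0 ≤ x 3} := by
  refine uniqueDiffOn_convex ?_ ⟨e4 3, ?_⟩
  · exact convex_halfSpace_ge (f := fun x : E4 => x 3) ⟨fun _ _ => rfl, fun _ _ => rfl⟩ 0
  · refine mem_interior.2 ⟨{x | 0 < x 3}, fun x (hx : 0 < x 3) => hx.le, isOpen_upper, ?_⟩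
    simp [e4_apply]

theorem fderiv_eq_of_eq_halfspace {u v : E4 → ℝ} {x : E4} (hu : DifferentiableAt ℝ u x)
    (hv : DifferentiableAt ℝ v x) (h : ∀ y : E4, 0 ≤ y 3 → u y = v y) (hx : 0 ≤ x 3) :
    fderiv ℝ u x = fderiv ℝ v x := by
  have h1 := uniqueDiffOn_halfspace x hx
  rw [← hu.fderivWithin h1, ← hv.fderivWithin h1]
  exact fderivWithin_congr h (h x hx)

/-- The total mass of the Poisson-type kernel `(1 + |y|²)⁻²`. -/
def kerMass : ℝ := ∫ y : E3, ((1 + ‖y‖ ^ 2) ^ 2)⁻¹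

theorem kerMass_pos : 0 < kerMass := by
  rw [kerMass, integral_pos_iff_support_of_nonneg (fun y => by positivity)
    integrable_inv_one_add_norm_sq_sq]
  have : Function.support (fun y : E3 => ((1 + ‖y‖ ^ 2) ^ 2)⁻¹) = Set.univ :=
    Set.eq_univ_of_forall fun y => by
      rw [Function.mem_support]
      positivity
  rw [this]
  simp

/-- The harmonic function on the half-space with boundary values `x₃⁻¹ · x₃ g`. -/
def halfU (g : E3 → ℝ) (x : E4) : ℝ := kerMass⁻¹ * (-(1 / 2)) * potential (pd 3 kerK) g x

theorem exists_halfspace_solution {m : ℕ} {g : E3 → ℝ} (hr : Reg (m + 2) g) :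
    ∃ F : E4 → ℝ, ContDiff ℝ 3 F ∧ (∀ x : E4, 0 < x 3 → F x = x 3 * halfU g x) ∧
      (∀ x : E4, x 3 = 0 → F x = 0) ∧ ∀ y, pd 3 F (flat y) = g y := by
  have hc := hr.continuous
  have hs := hr.hasCompactSupport
  have hK := contDiffAt_pd_kernel contDiffAt_kerK 3
  set V : E4 → ℝ := fun x => kerMass⁻¹ * (-(1 / 2)) * scaled (pd 3 kerK) g x with hV
  have hVc : Continuous V := by
    refine continuous_const.mul (continuous_scaled (C := 2) (fun y => ?_)
      (continuous_kernel_flat hK) hc hs)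
    rw [pd_three_kerK_flat, abs_mul, abs_of_pos (by positivity : 0 < ((1 + ‖y‖ ^ 2) ^ 2)⁻¹)]
    norm_num
  have hVU : ∀ x : E4, 0 < x 3 → halfU g x = V x := fun x hx => by
    rw [halfU, potential_eq_scaled (fun t ht y hy => pd_kerK_smul 3 ht hy) g hx]
  have hV0 : ∀ y, V (flat y) = g y := fun y => by
    have h1 : scaled (pd 3 kerK) g (flat y) = g y * (-2 * kerMass) := by
      simp only [scaled, flat_three, zero_smul, sub_zero, horiz_flat, pd_three_kerK_flat]
      rw [integral_const_mul, integral_const_mul, kerMass]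
    simp only [hV, h1]
    field_simp [kerMass_pos.ne']
  have huv : ∀ x : E4, 0 < x 3 → kerMass⁻¹ * potential kerW g x = x 3 * V x := fun x hx => by
    rw [← hVU x hx, halfU, potential, potential, ← integral_const_mul, ← integral_const_mul,
      ← integral_const_mul]
    refine integral_congr_ae (Filter.Eventually.of_forall fun ζ => ?_)
    simp only
    rw [kerW_eq (sub_flat_ne_zero hx ζ), sub_flat_three]
    ring
  have hWs : ∀ x : E4, 0 < x 3 → ContDiffAt ℝ (⊤ : ℕ∞) (potential kerW g) x := fun x hx =>
    contDiffAt_potential contDiffAt_kerW hc hs hx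
  obtain ⟨F, hF, hFv⟩ := exists_contDiff_three_of_extC hWs (extC_three_kerW hr)
    (v := fun x => kerMass * (x 3 * V x))
    (continuous_const.mul ((continuous_coord 3).mul hVc)) fun x hx => by
      simp only
      rw [← huv x hx, ← mul_assoc, mul_inv_cancel₀ kerMass_pos.ne', one_mul]
  have hF' : ∀ x : E4, 0 ≤ x 3 → kerMass⁻¹ * F x = x 3 * V x := fun x hx => by
    rw [hFv x hx, ← mul_assoc, inv_mul_cancel₀ kerMass_pos.ne', one_mul]
  have hsm : ContDiff ℝ 3 fun x => kerMass⁻¹ * F x := contDiff_const.mul hF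
  refine ⟨fun x => kerMass⁻¹ * F x, hsm, fun x hx => ?_, fun x hx => ?_, fun y => ?_⟩
  · simp only
    rw [hF' x hx.le, hVU x hx]
  · simp only
    rw [hF' x hx.ge, hx, zero_mul]
  · have h1 := hasFDerivAt_mul_of_eq_zero (differentiableAt_coord 3 (flat y)) hVc.continuousAt
      (flat_three y)
    have h2 := fderiv_eq_of_eq_halfspace (hsm.differentiable (by simp) (flat y))
      h1.differentiableAt hF' (flat_three y).ge
    have h3 : pd 3 (fun x : E4 => x 3) (flat y) = 1 := by
      rw [pd_coord, if_pos rfl]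
    rw [pd, h2, h1.fderiv, hV0]
    change g y * pd 3 (fun x : E4 => x 3) (flat y) = _
    rw [h3, mul_one]

theorem contDiffAt_halfU {g : E3 → ℝ} (hg : Continuous g) (hc : HasCompactSupport g) {x : E4}
    (hx : 0 < x 3) : ContDiffAt ℝ (⊤ : ℕ∞) (halfU g) x :=
  contDiffAt_const.mul (contDiffAt_potential (contDiffAt_pd_kernel contDiffAt_kerK 3) hg hc hx)

theorem lap_halfU {g : E3 → ℝ} (hg : Continuous g) (hc : HasCompactSupport g) {x : E4}
    (hx : 0 < x 3) : lap (halfU g) x = 0 := by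
  have h := lap_potential (contDiffAt_pd_kernel contDiffAt_kerK 3)
    (fun y hy => lap_pd_kerK hy 3) hg hc hx
  rw [show halfU g = fun x => kerMass⁻¹ * (-(1 / 2)) * potential (pd 3 kerK) g x from rfl,
    lap_const_mul, h, mul_zero]

end

section

variable {E F : Type*} [NormedAddCommGroup E] [NormedAddCommGroup F]

/-- Truncation of a function to the exterior of the unit ball. -/
def outer (f : E → F) : E → F := {y | 1 < ‖y‖}.indicator f

theorem outer_of_lt (f : E → F) {y : E} (hy : 1 < ‖y‖) : outer f y = f y :=
  indicator_of_mem (s := {y : E | 1 < ‖y‖}) hy f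

theorem outer_of_le (f : E → F) {y : E} (hy : ‖y‖ ≤ 1) : outer f y = 0 :=
  indicator_of_notMem (s := {y : E | 1 < ‖y‖}) (not_lt.2 hy) f

theorem hasCompactSupport_outer {f : E → F} (hc : HasCompactSupport f) :
    HasCompactSupport (outer f) :=
  hc.mono (by rw [outer, Set.support_indicator]; exact inter_subset_right)

end

section

variable {E F : Type*} [NormedAddCommGroup E] [InnerProductSpace ℝ E] [NormedAddCommGroup F]
  [NormedSpace ℝ F]

theorem norm_inv_smul_self {y : E} (hy : y ≠ 0) : ‖‖y‖⁻¹ • y‖ = 1 := by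
  rw [norm_smul, norm_inv, norm_norm, inv_mul_cancel₀ (norm_ne_zero_iff.2 hy)]

/-- A function vanishing on the unit sphere has a purely radial derivative there. -/
theorem fderiv_of_eq_zero_on_sphere {f : E → F} {y : E} (hy : ‖y‖ = 1)
    (hf : DifferentiableAt ℝ f y) (h0 : ∀ z : E, ‖z‖ = 1 → f z = 0) (v : E) :
    fderiv ℝ f y v = ⟪y, v⟫ • fderiv ℝ f y y := by
  have hy0 : y ≠ 0 := norm_ne_zero_iff.1 (by rw [hy]; exact one_ne_zero)
  have hN : ‖y‖⁻¹ • y = y := by rw [hy, inv_one, one_smul]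
  have h1 := HasFDerivAt.comp (g := f) (f := fun z : E => ‖z‖⁻¹ • z) y
    (by rw [hN]; exact hf.hasFDerivAt) (hasFDerivAt_normalize hy0)
  have h2 : f ∘ (fun z : E => ‖z‖⁻¹ • z) =ᶠ[𝓝 y] fun _ => 0 := by
    filter_upwards [isOpen_ne.mem_nhds hy0] with z hz
    exact h0 _ (norm_inv_smul_self hz)
  have h3 := h1.unique ((hasFDerivAt_const (0 : F) y).congr_of_eventuallyEq h2)
  have h4 := congrArg (fun L : E →L[ℝ] F => L v) h3
  simp [hy, map_smul] at h4
  rw [add_neg_eq_zero] at h4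
  exact h4

/-- A function vanishing on the unit sphere together with its first two radial derivatives
vanishes there to second order. -/
theorem fderiv_fderiv_eq_zero_on_sphere {f : E → ℝ} (hf : ContDiff ℝ 2 f)
    (h0 : ∀ z : E, ‖z‖ = 1 → f z = 0) (h1 : ∀ z : E, ‖z‖ = 1 → fderiv ℝ f z z = 0)
    (h2 : ∀ z : E, ‖z‖ = 1 → fderiv ℝ (fun w => fderiv ℝ f w w) z z = 0) :
    (∀ z : E, ‖z‖ = 1 → fderiv ℝ f z = 0) ∧
      ∀ z : E, ‖z‖ = 1 → fderiv ℝ (fderiv ℝ f) z = 0 := by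
  have h3 : ∀ z : E, ‖z‖ = 1 → fderiv ℝ f z = 0 := fun z hz => by
    ext v
    rw [fderiv_of_eq_zero_on_sphere hz (hf.differentiable (by simp) z) h0, h1 z hz]
    simp
  refine ⟨h3, fun z hz => ?_⟩
  have hd : ContDiff ℝ 1 (fderiv ℝ f) := hf.fderiv_right (by norm_num)
  have hdz := hd.differentiable (by simp) z
  have h4 : fderiv ℝ (fderiv ℝ f) z z z = 0 := by
    have h5 := (hdz.hasFDerivAt.clm_apply (hasFDerivAt_id z)).fderiv
    have h6 := h2 z hz
    simp only [id_eq] at h5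
    rw [h5] at h6
    simpa [h3 z hz] using h6
  have hsym : IsSymmSndFDerivAt ℝ f z :=
    hf.contDiffAt.isSymmSndFDerivAt (by simp)
  ext v w
  rw [fderiv_of_eq_zero_on_sphere hz hdz h3, smul_apply, hsym z w,
    fderiv_of_eq_zero_on_sphere hz hdz h3, smul_apply, h4]
  simp

theorem lipschitzWith_outer {f : E → F} {L : NNReal} (hf : LipschitzWith L f)
    (h0 : ∀ z : E, ‖z‖ = 1 → f z = 0) : LipschitzWith L (outer f) := by
  have key : ∀ y z : E, ‖y‖ ≤ 1 → 1 < ‖z‖ → ‖f z‖ ≤ L * ‖z - y‖ := fun y z hy hz => by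
    have hz0 : z ≠ 0 := norm_pos_iff.1 (one_pos.trans hz)
    have h1 := hf.norm_sub_le z (‖z‖⁻¹ • z)
    rw [h0 _ (norm_inv_smul_self hz0), sub_zero] at h1
    refine h1.trans (mul_le_mul_of_nonneg_left ?_ L.2)
    have h2 : z - ‖z‖⁻¹ • z = (1 - ‖z‖⁻¹) • z := by module
    have h3 : ‖z‖⁻¹ ≤ 1 := inv_le_one_of_one_le₀ hz.le
    rw [h2, norm_smul, Real.norm_of_nonneg (by linarith), sub_mul, one_mul,
      inv_mul_cancel₀ (norm_ne_zero_iff.2 hz0)]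
    have := norm_sub_norm_le z y
    linarith
  refine LipschitzWith.of_dist_le_mul fun y z => ?_
  rw [dist_eq_norm, dist_eq_norm]
  rcases le_or_gt ‖y‖ 1 with hy | hy <;> rcases le_or_gt ‖z‖ 1 with hz | hz
  · rw [outer_of_le f hy, outer_of_le f hz, sub_zero, norm_zero]
    positivity
  · rw [outer_of_le f hy, outer_of_lt f hz, zero_sub, norm_neg, norm_sub_rev]
    exact key y z hy hz
  · rw [outer_of_lt f hy, outer_of_le f hz, sub_zero]
    exact key z y hz hy
  · rw [outer_of_lt f hy, outer_of_lt f hz]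
    exact hf.norm_sub_le y z

theorem hasFDerivAt_outer {f : E → F} (hf : Differentiable ℝ f)
    (h0 : ∀ z : E, ‖z‖ = 1 → f z = 0) (h1 : ∀ z : E, ‖z‖ = 1 → fderiv ℝ f z = 0) (y : E) :
    HasFDerivAt (outer f) (outer (fderiv ℝ f) y) y := by
  rcases lt_trichotomy ‖y‖ 1 with hy | hy | hy
  · rw [outer_of_le _ hy.le]
    refine (hasFDerivAt_const (0 : F) y).congr_of_eventuallyEq ?_
    filter_upwards [(isOpen_lt continuous_norm continuous_const).mem_nhds hy] with z hz
    exact outer_of_le f (le_of_lt hz)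
  · rw [outer_of_le _ hy.le]
    have h2 := (hf y).hasFDerivAt
    rw [h1 y hy] at h2
    rw [hasFDerivAt_iff_isLittleO] at h2 ⊢
    refine Asymptotics.IsBigO.trans_isLittleO (Asymptotics.IsBigO.of_bound 1
      (Filter.Eventually.of_forall fun z => ?_)) h2
    simp only [outer_of_le f hy.le, h0 y hy, zero_apply, sub_zero, one_mul]
    rcases le_or_gt ‖z‖ 1 with hz | hz
    · rw [outer_of_le f hz, norm_zero]
      exact norm_nonneg _
    · rw [outer_of_lt f hz]
  · rw [outer_of_lt _ hy]
    refine (hf y).hasFDerivAt.congr_of_eventuallyEq ?_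
    filter_upwards [(isOpen_lt continuous_const continuous_norm).mem_nhds hy] with z hz
    exact outer_of_lt f hz

end

theorem contDiff_pd3 {f : E3 → ℝ} {n : WithTop ℕ∞} (hf : ContDiff ℝ (n + 1) f) (j : Fin 3) :
    ContDiff ℝ n (pd3 j f) := (hf.fderiv_right le_rfl).clm_apply contDiff_const

theorem hasCompactSupport_pd3 {f : E3 → ℝ} (hf : HasCompactSupport f) (j : Fin 3) :
    HasCompactSupport (pd3 j f) := hf.fderiv_apply (𝕜 := ℝ) (e3 j)

theorem reg_of_contDiff (n : ℕ) : ∀ {f : E3 → ℝ}, ContDiff ℝ (n + 1) f → HasCompactSupport f →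
    Reg n f := by
  induction n with
  | zero =>
    intro f hf hc
    obtain ⟨C, hC⟩ := hf.lipschitzWith_of_hasCompactSupport hc (by simp)
    exact ⟨⟨C, hC⟩, hc⟩
  | succ n ih =>
    intro f hf hc
    refine ⟨hf.of_le (by simp), hc, fun j => ih ?_ (hasCompactSupport_pd3 hc j)⟩
    have := contDiff_pd3 (n := n + 1) (by exact_mod_cast hf) j
    exact_mod_cast this

theorem reg_add {n : ℕ} : ∀ {f g : E3 → ℝ}, Reg n f → Reg n g → Reg n fun y => f y + g y := by
  induction n with
  | zero =>
    rintro f g ⟨⟨C, hC⟩, hc⟩ ⟨⟨D, hD⟩, hd⟩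
    exact ⟨⟨C + D, hC.add hD⟩, hc.add hd⟩
  | succ n ih =>
    rintro f g ⟨h1, h2, h3⟩ ⟨k1, k2, k3⟩
    refine ⟨h1.add k1, h2.add k2, fun j => ?_⟩
    have : pd3 j (fun y => f y + g y) = fun y => pd3 j f y + pd3 j g y := by
      funext y
      simp only [pd3]
      rw [fderiv_fun_add (h1.differentiable (by simp) y) (k1.differentiable (by simp) y)]
      rfl
    rw [this]
    exact ih (h3 j) (k3 j)

theorem reg_zero_outer {f : E3 → ℝ} (hf : ContDiff ℝ 1 f) (hc : HasCompactSupport f)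
    (h0 : ∀ z : E3, ‖z‖ = 1 → f z = 0) : Reg 0 (outer f) := by
  obtain ⟨C, hC⟩ := hf.lipschitzWith_of_hasCompactSupport hc (by simp)
  exact ⟨⟨C, lipschitzWith_outer hC h0⟩, hasCompactSupport_outer hc⟩

theorem reg_succ_outer {n : ℕ} {f : E3 → ℝ} (hf : ContDiff ℝ 2 f) (hc : HasCompactSupport f)
    (h0 : ∀ z : E3, ‖z‖ = 1 → f z = 0) (h1 : ∀ z : E3, ‖z‖ = 1 → fderiv ℝ f z = 0)
    (h2 : ∀ j, Reg n (outer (pd3 j f))) : Reg (n + 1) (outer f) := by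
  have hd := hasFDerivAt_outer (hf.differentiable (by simp)) h0 h1
  have hfd : fderiv ℝ (outer f) = outer (fderiv ℝ f) := funext fun y => (hd y).fderiv
  obtain ⟨C, hC⟩ := (hf.fderiv_right (m := 1) (by norm_num)).lipschitzWith_of_hasCompactSupport
    (hc.fderiv (𝕜 := ℝ)) (by simp)
  refine ⟨contDiff_one_iff_fderiv.2 ⟨fun y => (hd y).differentiableAt, ?_⟩,
    hasCompactSupport_outer hc, fun j => ?_⟩
  · rw [hfd]
    exact (lipschitzWith_outer hC h1).continuous
  · have : pd3 j (outer f) = outer (pd3 j f) := by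
      funext y
      rw [pd3, hfd]
      rcases le_or_gt ‖y‖ 1 with hy | hy
      · rw [outer_of_le _ hy, outer_of_le _ hy]
        rfl
      · rw [outer_of_lt _ hy, outer_of_lt _ hy]
        rfl
    rw [this]
    exact h2 j

/-- The exterior truncation of a function vanishing to second order on the sphere. -/
theorem reg_two_outer {f : E3 → ℝ} (hf : ContDiff ℝ 3 f) (hc : HasCompactSupport f)
    (h0 : ∀ z : E3, ‖z‖ = 1 → f z = 0) (h1 : ∀ z : E3, ‖z‖ = 1 → fderiv ℝ f z z = 0)
    (h2 : ∀ z : E3, ‖z‖ = 1 → fderiv ℝ (fun w => fderiv ℝ f w w) z z = 0) :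
    Reg 2 (outer f) := by
  have hf2 : ContDiff ℝ 2 f := hf.of_le (by norm_num)
  obtain ⟨h3, h4⟩ := fderiv_fderiv_eq_zero_on_sphere hf2 h0 h1 h2
  have hp : ∀ j, ContDiff ℝ 2 (pd3 j f) := fun j => contDiff_pd3 (by norm_num; exact hf) j
  have h5 : ∀ (j : Fin 3) (z : E3), ‖z‖ = 1 → fderiv ℝ (pd3 j f) z = 0 := fun j z hz => by
    have hd := ((hf2.fderiv_right (m := 1) (by norm_num)).differentiable (by simp) z).hasFDerivAt
    have := (hd.clm_apply (hasFDerivAt_const (e3 j) z)).fderiv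
    rw [show pd3 j f = fun y => fderiv ℝ f y (e3 j) from rfl, this, h4 z hz]
    ext v
    simp
  refine reg_succ_outer hf2 hc h0 h3 fun j => ?_
  have h6 : ∀ z : E3, ‖z‖ = 1 → pd3 j f z = 0 := fun z hz => by
    rw [pd3, h3 z hz]
    rfl
  refine reg_succ_outer (hp j) (hasCompactSupport_pd3 hc j) h6 (h5 j) fun k => ?_
  refine reg_zero_outer (contDiff_pd3 (by norm_num; exact hp j) k)
    (hasCompactSupport_pd3 (hasCompactSupport_pd3 hc j) k) fun z hz => ?_
  rw [pd3, h5 j z hz]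
  rfl

section

variable {E : Type*} [NormedAddCommGroup E] [InnerProductSpace ℝ E]

/-- Inversion in the unit sphere. -/
def inversion₀ (y : E) : E := (‖y‖ ^ 2)⁻¹ • y

/-- The transform `y ↦ |y|⁻² f(y / |y|²)`. -/
def kelvin (f : E → ℝ) (y : E) : ℝ := (‖y‖ ^ 2)⁻¹ * f (inversion₀ y)

theorem norm_inversion₀ (y : E) : ‖inversion₀ y‖ = ‖y‖⁻¹ := by
  rcases eq_or_ne y 0 with rfl | hy
  · simp [inversion₀]
  · rw [inversion₀, norm_smul, norm_inv, norm_pow, norm_norm]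
    field_simp [norm_ne_zero_iff.2 hy]

theorem inversion₀_inversion₀ (y : E) : inversion₀ (inversion₀ y) = y := by
  rcases eq_or_ne y 0 with rfl | hy
  · simp [inversion₀]
  · rw [inversion₀, norm_inversion₀, inversion₀, smul_smul, inv_pow, inv_inv,
      mul_inv_cancel₀ (pow_ne_zero 2 (norm_ne_zero_iff.2 hy)), one_smul]

theorem inversion₀_of_norm_eq_one {y : E} (hy : ‖y‖ = 1) : inversion₀ y = y := by
  rw [inversion₀, hy]
  norm_num

theorem kelvin_of_norm_eq_one (f : E → ℝ) {y : E} (hy : ‖y‖ = 1) : kelvin f y = f y := by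
  rw [kelvin, inversion₀_of_norm_eq_one hy, hy]
  norm_num

theorem contDiffAt_inv_norm_sq {n : WithTop ℕ∞} {y : E} (hy : y ≠ 0) :
    ContDiffAt ℝ n (fun y : E => (‖y‖ ^ 2)⁻¹) y :=
  (contDiff_norm_sq ℝ).contDiffAt.inv (pow_ne_zero 2 (norm_ne_zero_iff.2 hy))

theorem contDiffAt_inversion₀ {n : WithTop ℕ∞} {y : E} (hy : y ≠ 0) :
    ContDiffAt ℝ n (inversion₀ : E → E) y :=
  (contDiffAt_inv_norm_sq hy).smul contDiffAt_id

theorem contDiffAt_kelvin {n : WithTop ℕ∞} {f : E → ℝ} {y : E} (hy : y ≠ 0)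
    (hf : ContDiffAt ℝ n f (inversion₀ y)) : ContDiffAt ℝ n (kelvin f) y :=
  (contDiffAt_inv_norm_sq hy).mul (hf.comp y (contDiffAt_inversion₀ hy))

/-- The inversion reverses the radial field. -/
theorem fderiv_kelvin_self {f : E → ℝ} {y : E} (hy : y ≠ 0)
    (hf : DifferentiableAt ℝ f (inversion₀ y)) :
    fderiv ℝ (kelvin f) y y = -2 * kelvin f y - kelvin (fun w => fderiv ℝ f w w) y := by
  have hn : ‖y‖ ^ 2 ≠ 0 := pow_ne_zero 2 (norm_ne_zero_iff.2 hy)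
  have hi : HasFDerivAt (inversion₀ : E → E) (fderiv ℝ inversion₀ y) y :=
    ((contDiffAt_inversion₀ (n := 1) hy).differentiableAt (by simp)).hasFDerivAt
  have hg : HasFDerivAt (fun y : E => (‖y‖ ^ 2)⁻¹) _ y :=
    (hasDerivAt_inv hn).comp_hasFDerivAt y (hasStrictFDerivAt_norm_sq y).hasFDerivAt
  have h1 : fderiv ℝ (inversion₀ : E → E) y y = -inversion₀ y := by
    have := (hg.smul (hasFDerivAt_id y)).fderiv
    change fderiv ℝ (inversion₀ : E → E) y = _ at this
    rw [this]
    simp [inversion₀]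
    rw [← neg_smul, ← add_smul, ← neg_smul]
    congr 1
    field_simp
    ring
  have h2 := hg.mul (hf.hasFDerivAt.comp y hi)
  change HasFDerivAt (kelvin f) _ y at h2
  rw [h2.fderiv]
  simp [h1, kelvin]
  field_simp
  ring

end

/-- Splitting of a function on the unit ball into a part and the transform of another,
which is possible with the regularity `Reg 2` under a first order condition on the sphere. -/
theorem exists_kelvin_split {φ : E3 → ℝ} (hφ : ContDiff ℝ (⊤ : ℕ∞) φ)
    (hc : ∀ y : E3, ‖y‖ = 1 → fderiv ℝ φ y y = -φ y) :
    ∃ g : E3 → ℝ, Reg 2 g ∧ ∀ y : E3, y ≠ 0 → ‖y‖ ≤ 1 → g y + kelvin g y = φ y := by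
  let c : ContDiffBump (0 : E3) := ⟨2, 3, by norm_num, by norm_num⟩
  let b : ContDiffBump (0 : E3) := ⟨1 / 4, 1 / 2, by norm_num, by norm_num⟩
  have hbs : ContDiff ℝ (⊤ : ℕ∞) b := b.contDiff
  have hcs : ContDiff ℝ (⊤ : ℕ∞) c := c.contDiff
  let P : E3 → ℝ := fun y => c y * ((1 - b y) * φ y)
  let A : E3 → ℝ := fun y => c y * ((1 + b y) * φ y * 2⁻¹)
  let C : E3 → ℝ := fun y => kelvin P y * 2⁻¹ - A y
  have hP : ContDiff ℝ (⊤ : ℕ∞) P := hcs.mul ((contDiff_const.sub hbs).mul hφ)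
  have hA : ContDiff ℝ (⊤ : ℕ∞) A :=
    hcs.mul (((contDiff_const.add hbs).mul hφ).mul contDiff_const)
  have hAc : HasCompactSupport A := c.hasCompactSupport.mul_right
  have hb0 : ∀ y : E3, 1 / 2 ≤ ‖y‖ → b y = 0 := fun y hy =>
    b.zero_of_le_dist (by rw [dist_zero_right]; exact hy)
  have hb1 : ∀ y : E3, ‖y‖ ≤ 1 / 4 → b y = 1 := fun y hy =>
    b.one_of_mem_closedBall (by rw [mem_closedBall_zero_iff]; exact hy)
  have hc0 : ∀ y : E3, 3 ≤ ‖y‖ → c y = 0 := fun y hy =>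
    c.zero_of_le_dist (by rw [dist_zero_right]; exact hy)
  have hc1 : ∀ y : E3, ‖y‖ ≤ 2 → c y = 1 := fun y hy =>
    c.one_of_mem_closedBall (by rw [mem_closedBall_zero_iff]; exact hy)
  have hKfar : ∀ y : E3, 4 ≤ ‖y‖ → kelvin P y = 0 := fun y hy => by
    have : ‖inversion₀ y‖ ≤ 1 / 4 := by
      rw [norm_inversion₀, one_div]
      exact inv_anti₀ (by norm_num) hy
    simp only [kelvin, P, hb1 _ this]
    ring
  have hKnear : ∀ y : E3, ‖y‖ < 1 / 3 → kelvin P y = 0 := fun y hy => by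
    rcases eq_or_ne y 0 with rfl | hy0
    · simp [kelvin]
    have : 3 ≤ ‖inversion₀ y‖ := by
      rw [norm_inversion₀, le_inv_comm₀ (by norm_num) (norm_pos_iff.2 hy0), ← one_div]
      exact hy.le
    simp only [kelvin, P, hc0 _ this]
    ring
  have hK : ContDiff ℝ (⊤ : ℕ∞) (kelvin P) := contDiff_iff_contDiffAt.2 fun y => by
    rcases eq_or_ne y 0 with rfl | hy0
    · refine contDiffAt_const (c := (0 : ℝ)) |>.congr_of_eventuallyEq ?_
      filter_upwards [Metric.ball_mem_nhds (0 : E3) (show (0 : ℝ) < 1 / 3 by norm_num)] with y hy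
      exact hKnear y (mem_ball_zero_iff.1 hy)
    · exact contDiffAt_kelvin hy0 hP.contDiffAt
  have hKc : HasCompactSupport (kelvin P) :=
    HasCompactSupport.intro (isCompact_closedBall (0 : E3) 4) fun y hy =>
      hKfar y (by
        rw [mem_closedBall_zero_iff, not_le] at hy
        exact hy.le)
  have hC : ContDiff ℝ (⊤ : ℕ∞) C := (hK.mul contDiff_const).sub hA
  have hCc : HasCompactSupport C :=
    HasCompactSupport.intro (isCompact_closedBall (0 : E3) 4) fun y hy => by
      rw [mem_closedBall_zero_iff, not_le] at hy
      simp only [C, A, hKfar y hy.le, hc0 y (by linarith)]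
      ring
  have hinv : ∀ z : E3, ‖z‖ = 1 → ContinuousAt (inversion₀ : E3 → E3) z := fun z hz =>
    (contDiffAt_inversion₀ (n := 1) (norm_ne_zero_iff.1 (by rw [hz]; norm_num))).continuousAt
  have hPφ : ∀ z : E3, ‖z‖ = 1 → P =ᶠ[𝓝 z] φ := fun z hz => by
    filter_upwards [(isOpen_lt continuous_const continuous_norm).mem_nhds
      (show (1 / 2 : ℝ) < ‖z‖ by rw [hz]; norm_num),
      (isOpen_lt continuous_norm continuous_const).mem_nhds
      (show ‖z‖ < (2 : ℝ) by rw [hz]; norm_num)] with y h1 h2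
    simp only [P, hb0 y (le_of_lt h1), hc1 y (le_of_lt h2)]
    ring
  have hCe : ∀ z : E3, ‖z‖ = 1 → C =ᶠ[𝓝 z] fun y => 2⁻¹ * (kelvin φ y - φ y) := fun z hz => by
    have h4 : P =ᶠ[𝓝 (inversion₀ z)] φ := by
      rw [inversion₀_of_norm_eq_one hz]
      exact hPφ z hz
    filter_upwards [(isOpen_lt continuous_const continuous_norm).mem_nhds
      (show (1 / 2 : ℝ) < ‖z‖ by rw [hz]; norm_num),
      (isOpen_lt continuous_norm continuous_const).mem_nhds
      (show ‖z‖ < (2 : ℝ) by rw [hz]; norm_num), (hinv z hz).eventually h4] with y h1 h2 h3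
    simp only [C, A, kelvin, h3, hb0 y (le_of_lt h1), hc1 y (le_of_lt h2)]
    ring
  have hφd : ∀ y, DifferentiableAt ℝ φ y := fun y => hφ.differentiable (by simp) y
  have hD : ContDiff ℝ (⊤ : ℕ∞) fun w => fderiv ℝ φ w w :=
    (hφ.fderiv_right (m := (⊤ : ℕ∞)) (by simp)).clm_apply contDiff_id
  have hDd : ∀ y, DifferentiableAt ℝ (fun w => fderiv ℝ φ w w) y :=
    fun y => hD.differentiable (by simp) y
  have hKd : ∀ {f : E3 → ℝ}, ContDiff ℝ (⊤ : ℕ∞) f → ∀ z : E3, z ≠ 0 →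
      DifferentiableAt ℝ (kelvin f) z := fun hf z hz =>
    (contDiffAt_kelvin (n := (⊤ : ℕ∞)) hz hf.contDiffAt).differentiableAt (by simp)
  have hne : ∀ z : E3, ‖z‖ = 1 → z ≠ 0 := fun z hz => norm_ne_zero_iff.1 (by rw [hz]; norm_num)
  have hDC : ∀ z : E3, z ≠ 0 → fderiv ℝ (fun y => 2⁻¹ * (kelvin φ y - φ y)) z z =
      2⁻¹ * (-2 * kelvin φ z - kelvin (fun w => fderiv ℝ φ w w) z - fderiv ℝ φ z z) :=
    fun z hz => by
      rw [fderiv_const_mul ((hKd hφ z hz).fun_sub (hφd z)), fderiv_fun_sub (hKd hφ z hz) (hφd z)]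
      simp only [smul_apply, sub_apply, fderiv_kelvin_self hz (hφd _), smul_eq_mul]
  have hreg : Reg 2 (outer C) := by
    refine reg_two_outer (hC.of_le ENat.LEInfty.out) hCc (fun z hz => ?_) (fun z hz => ?_)
      fun z hz => ?_
    · rw [(hCe z hz).eq_of_nhds, kelvin_of_norm_eq_one _ hz]
      ring
    · rw [(hCe z hz).fderiv_eq, hDC z (hne z hz), kelvin_of_norm_eq_one _ hz,
        kelvin_of_norm_eq_one _ hz, hc z hz]
      ring
    · have h1 : (fun w => fderiv ℝ C w w) =ᶠ[𝓝 z] fun w => 2⁻¹ * (-2 * kelvin φ w -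
          kelvin (fun w => fderiv ℝ φ w w) w - fderiv ℝ φ w w) := by
        filter_upwards [(hCe z hz).eventuallyEq_nhds, isOpen_ne.mem_nhds (hne z hz)] with w h1 h2
        rw [h1.fderiv_eq, hDC w h2]
      have h2 := (hKd hφ z (hne z hz)).const_mul (-2 : ℝ)
      have h3 := h2.fun_sub (hKd hD z (hne z hz))
      rw [h1.fderiv_eq, fderiv_const_mul (h3.fun_sub (hDd z)), fderiv_fun_sub h3 (hDd z),
        fderiv_fun_sub h2 (hKd hD z (hne z hz)), fderiv_const_mul (hKd hφ z (hne z hz))]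
      simp only [smul_apply, sub_apply, smul_eq_mul, fderiv_kelvin_self (hne z hz) (hφd _),
        fderiv_kelvin_self (hne z hz) (hDd _), kelvin_of_norm_eq_one _ hz, hc z hz]
      ring
  refine ⟨fun y => A y + outer C y,
    reg_add (reg_of_contDiff 2 ((hA.of_le (m := 3) ENat.LEInfty.out).of_le (by norm_num)) hAc) hreg, fun y hy0 hy => ?_⟩
  have hA2 : ∀ y : E3, ‖y‖ ≤ 1 → A y = (1 + b y) * φ y * 2⁻¹ := fun y hy => by
    simp only [A, hc1 y (hy.trans (by norm_num)), one_mul]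
  have h1 : 1 ≤ ‖inversion₀ y‖ := by
    rw [norm_inversion₀]
    exact one_le_inv_iff₀.2 ⟨norm_pos_iff.2 hy0, hy⟩
  rcases h1.eq_or_lt with h1 | h1
  · have hy1 : ‖y‖ = 1 := by
      rw [norm_inversion₀] at h1
      rw [← inv_inv ‖y‖, ← h1, inv_one]
    rw [kelvin_of_norm_eq_one _ hy1]
    simp only [outer_of_le C hy, hA2 y hy, hb0 y (by rw [hy1]; norm_num)]
    ring
  · have hn : ‖y‖ ^ 2 ≠ 0 := pow_ne_zero 2 (norm_ne_zero_iff.2 hy0)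
    change A y + outer C y + (‖y‖ ^ 2)⁻¹ * (A (inversion₀ y) + outer C (inversion₀ y)) = φ y
    rw [outer_of_le C hy, outer_of_lt C h1, hA2 y hy]
    simp only [C, kelvin, norm_inversion₀, inversion₀_inversion₀, P, hc1 y (hy.trans (by norm_num))]
    field_simp
    ring

theorem inversion₀_apply (y : E4) (i : Fin 4) : inversion₀ y i = (‖y‖ ^ 2)⁻¹ * y i := rfl

theorem pd_kelvin {f : E4 → ℝ} {y : E4} (hy : y ≠ 0) (hf : DifferentiableAt ℝ f (inversion₀ y))
    (i : Fin 4) : pd i (kelvin f) y =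
      kerK y * (kelvin (pd i f) y - 2 * (y i * kelvin (fun z => f z + Dr f z) y)) := by
  have hn : ‖y‖ ^ 2 ≠ 0 := pow_ne_zero 2 (norm_ne_zero_iff.2 hy)
  have hg : HasFDerivAt (fun y : E4 => (‖y‖ ^ 2)⁻¹) _ y :=
    (hasDerivAt_inv hn).comp_hasFDerivAt y (hasStrictFDerivAt_norm_sq y).hasFDerivAt
  have hi := hg.smul (hasFDerivAt_id y)
  have h2 := hg.mul (hf.hasFDerivAt.comp y hi)
  change HasFDerivAt (kelvin f) _ y at h2
  have hD : Dr f (inversion₀ y) = (‖y‖ ^ 2)⁻¹ * fderiv ℝ f (inversion₀ y) y := by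
    rw [Dr]
    conv_lhs => rw [show ∀ L : E4 →L[ℝ] ℝ, L (inversion₀ y) = (‖y‖ ^ 2)⁻¹ * L y from
      fun L => L.map_smul _ _]
  change fderiv ℝ (kelvin f) y (e4 i) = _
  rw [h2.fderiv]
  have h3 : fderiv ℝ f (inversion₀ y) (e4 i) = pd i f (inversion₀ y) := rfl
  simp only [add_apply, smul_apply, ContinuousLinearMap.comp_apply, smul_eq_mul, innerSL_apply_apply,
    ContinuousLinearMap.smulRight_apply, map_add, map_smul, id_eq, inner_e4, kelvin, hD, kerK,
    ContinuousLinearMap.id_apply]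
  change _ + (_ : ℝ) * _ = _
  simp only [h3, Function.comp_apply]
  field_simp
  ring

/-- The Kelvin transform commutes with the Laplacian up to a conformal factor. -/
theorem lap_kelvin {f : E4 → ℝ} {y : E4} (hy : y ≠ 0) (hf : ContDiffAt ℝ 2 f (inversion₀ y)) :
    lap (kelvin f) y = (‖y‖ ^ 2)⁻¹ ^ 2 * kelvin (lap f) y := by
  have hn : ‖y‖ ^ 2 ≠ 0 := pow_ne_zero 2 (norm_ne_zero_iff.2 hy)
  set z := inversion₀ y with hz
  have hG : ContDiffAt ℝ 1 (fun z => f z + Dr f z) z :=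
    (hf.of_le (by norm_num)).add (hf.Dr (by norm_num))
  have hfi : ∀ i, ContDiffAt ℝ 1 (pd i f) z := fun i => hf.pd (by norm_num) i
  have hdiff : ∀ {g : E4 → ℝ}, ContDiffAt ℝ 1 g z → DifferentiableAt ℝ (kelvin g) y :=
    fun hg => (contDiffAt_kelvin hy hg).diff le_rfl
  have hk : DifferentiableAt ℝ kerK y := (contDiffAt_inv_norm_sq (n := 1) hy).diff le_rfl
  have h2 : ∀ i, pd i (pd i (kelvin f)) y =
      kerK y * (kerK y * (kelvin (pd i (pd i f)) y -
          2 * (y i * kelvin (fun z => pd i f z + Dr (pd i f) z) y)) -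
        2 * (y i * (kerK y * (kelvin (pd i fun z => f z + Dr f z) y - 2 * (y i *
          kelvin (fun z => (f z + Dr f z) + Dr (fun z => f z + Dr f z) z) y))) +
          kelvin (fun z => f z + Dr f z) y)) +
      (kelvin (pd i f) y - 2 * (y i * kelvin (fun z => f z + Dr f z) y)) *
        (-(2 * y i * (‖y‖ ^ 2)⁻¹ ^ 2)) := fun i => by
    have h1 : pd i (kelvin f) =ᶠ[𝓝 y] fun y =>
        kerK y * (kelvin (pd i f) y - 2 * (y i * kelvin (fun z => f z + Dr f z) y)) := by
      have h3 : ∀ᶠ w in 𝓝 z, DifferentiableAt ℝ f w := by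
        filter_upwards [hf.eventually (by simp)] with w hw using hw.diff (by norm_num)
      filter_upwards [((contDiffAt_inversion₀ (n := 1) hy).continuousAt).eventually h3,
        isOpen_ne.mem_nhds hy] with w h4 h5
      exact pd_kelvin h5 h4 i
    have d1 := (differentiableAt_coord i y).fun_mul (hdiff hG)
    rw [(pd_congr h1 i).eq_of_nhds, pd_mul hk ((hdiff (hfi i)).fun_sub (d1.const_mul 2)),
      pd_sub (hdiff (hfi i)) (d1.const_mul 2), pd_const_mul,
      pd_mul (differentiableAt_coord i y) (hdiff hG), pd_coord, if_pos rfl, pd_kerK i hy,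
      pd_kelvin hy ((hfi i).diff le_rfl), pd_kelvin hy (hG.diff le_rfl), mul_one]
  have hsum : ∀ h : Fin 4 → E4 → ℝ,
      ∑ i, y i * kelvin (h i) y = ‖y‖ ^ 2 * kelvin (fun z => ∑ i, z i * h i z) y := fun h => by
    simp only [kelvin, Finset.mul_sum]
    refine Finset.sum_congr rfl fun i _ => ?_
    rw [inversion₀_apply]
    field_simp
  have s1 : ∑ i, y i * kelvin (pd i f) y = ‖y‖ ^ 2 * kelvin (Dr f) y := by
    rw [hsum]
    simp only [← Dr_eq_sum]
  have s2 : ∑ i, y i * kelvin (pd i fun z => f z + Dr f z) y =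
      ‖y‖ ^ 2 * kelvin (Dr fun z => f z + Dr f z) y := by
    rw [hsum]
    simp only [← Dr_eq_sum]
  have hDDr : Dr (fun z => f z + Dr f z) z = Dr f z + Dr (Dr f) z := by
    rw [Dr_eq_sum, Dr_eq_sum f, Dr_eq_sum (Dr f), ← Finset.sum_add_distrib]
    refine Finset.sum_congr rfl fun i _ => ?_
    rw [pd_add (hf.diff (by norm_num)) ((hf.Dr (m := 1) (by norm_num)).diff le_rfl), mul_add]
  have s3 : ∑ i, y i * kelvin (fun z => pd i f z + Dr (pd i f) z) y =
      ‖y‖ ^ 2 * kelvin (Dr (Dr f)) y := by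
    rw [hsum, kelvin, kelvin, ← hz, Dr_eq_sum (Dr f)]
    simp only [← pd_Dr hf]
  have s4 : kelvin (lap f) y = ∑ i, kelvin (pd i (pd i f)) y := by
    simp only [kelvin, lap_eq, Finset.mul_sum]
  have s5 := norm_sq_eq_sum y
  have e1 : kelvin (fun z => f z + Dr f z) y = kelvin f y + kelvin (Dr f) y := by
    simp only [kelvin, mul_add]
  have e2 : kelvin (Dr fun z => f z + Dr f z) y = kelvin (Dr f) y + kelvin (Dr (Dr f)) y := by
    rw [kelvin, ← hz, hDDr, kelvin, kelvin, mul_add]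
  have e3' : kelvin (fun z => (f z + Dr f z) + Dr (fun z => f z + Dr f z) z) y =
      kelvin f y + 2 * kelvin (Dr f) y + kelvin (Dr (Dr f)) y := by
    simp only [kelvin, ← hz, hDDr]
    ring
  rw [lap_eq, s4]
  simp only [h2]
  rw [e2] at s2
  rw [e1, e3']
  simp only [Fin.sum_univ_four] at s1 s2 s3 s5 ⊢
  have hk2 : kerK y = (‖y‖ ^ 2)⁻¹ := rfl
  rw [hk2]
  generalize kelvin (pd 0 f) y = a0 at *
  generalize kelvin (pd 1 f) y = a1 at *
  generalize kelvin (pd 2 f) y = a2 at *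
  generalize kelvin (pd 3 f) y = a3 at *
  set r := (‖y‖ ^ 2)⁻¹ with hr
  have hrn : r * ‖y‖ ^ 2 = 1 := inv_mul_cancel₀ hn
  clear_value r
  linear_combination (-2 * r ^ 2) * s1 + (-2 * r ^ 2) * s2 + (-2 * r ^ 2) * s3 -
    r ^ 2 * (8 * kelvin f y + 12 * kelvin (Dr f) y + 4 * kelvin (Dr (Dr f)) y) * s5 +
    8 * r * (kelvin f y + kelvin (Dr f) y) * hrn

theorem pd_comp_affine (f : E4 → ℝ) (c : E4) (a : ℝ) {x : E4}
    (hf : DifferentiableAt ℝ f (c + a • x)) (i : Fin 4) :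
    pd i (fun y => f (c + a • y)) x = a * pd i f (c + a • x) := by
  have h : HasFDerivAt (fun y : E4 => c + a • y) (a • ContinuousLinearMap.id ℝ E4) x :=
    ((hasFDerivAt_id x).const_smul a).const_add c
  change fderiv ℝ (f ∘ fun y : E4 => c + a • y) x (e4 i) = _
  rw [(hf.hasFDerivAt.comp x h).fderiv]
  simp [pd]

theorem lap_comp_affine {f : E4 → ℝ} (c : E4) (a : ℝ) {x : E4}
    (hf : ContDiffAt ℝ 2 f (c + a • x)) :
    lap (fun y => f (c + a • y)) x = a ^ 2 * lap f (c + a • x) := by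
  rw [lap_eq, lap_eq, Finset.mul_sum]
  refine Finset.sum_congr rfl fun i _ => ?_
  have hc : ContinuousAt (fun y : E4 => c + a • y) x := by fun_prop
  have h : pd i (fun y => f (c + a • y)) =ᶠ[𝓝 x] fun y => a * pd i f (c + a • y) := by
    filter_upwards [hc.eventually (hf.eventually (by simp))] with y hy
    exact pd_comp_affine f c a (hy.diff (by norm_num)) i
  rw [(pd_congr h i).eq_of_nhds, pd_const_mul,
    pd_comp_affine (pd i f) c a ((hf.pd (m := 1) (by norm_num) i).diff le_rfl)]
  ring

section

open MeasureTheory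

theorem inversion₀_flat (y : E3) : inversion₀ (flat y) = flat (inversion₀ y) := by
  rw [inversion₀, inversion₀, map_smul, norm_flat]

/-- Near the origin, the inverted half-space solution extends smoothly. -/
theorem exists_smooth_inverted {g : E3 → ℝ} (hg : Continuous g) (hc : HasCompactSupport g) :
    ∃ (ε : ℝ) (V : E4 → ℝ), 0 < ε ∧ (∀ x, ‖x‖ < ε → ContDiffAt ℝ (⊤ : ℕ∞) V x) ∧
      (∀ x : E4, x 3 = 0 → V x = 0) ∧
      ∀ x : E4, 0 < x 3 → V x = inversion₀ x 3 * halfU g (inversion₀ x) := by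
  obtain ⟨R, hR, hRg⟩ := (IsCompact.isBounded hc).exists_pos_norm_le
  let q : E4 → E3 → ℝ := fun x ζ => 1 - 2 * ⟪x, flat ζ⟫ + ‖x‖ ^ 2 * ‖ζ‖ ^ 2
  let K : E4 → E3 → ℝ := fun x ζ => (q x ζ ^ 2)⁻¹
  have hq : ∀ x ∈ {x : E4 | ‖x‖ < R⁻¹}, ∀ ζ ∈ tsupport g, q x ζ ≠ 0 := fun x hx ζ hζ => by
    have h1 : ‖x‖ * ‖ζ‖ < 1 := by
      calc ‖x‖ * ‖ζ‖ ≤ ‖x‖ * R := mul_le_mul_of_nonneg_left (hRg ζ hζ) (norm_nonneg _)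
        _ < R⁻¹ * R := mul_lt_mul_of_pos_right hx hR
        _ = 1 := inv_mul_cancel₀ hR.ne'
    have h2 := real_inner_le_norm x (flat ζ)
    rw [norm_flat] at h2
    have h3 : 0 < (1 - ‖x‖ * ‖ζ‖) ^ 2 := pow_pos (by linarith) 2
    have : 0 < q x ζ := by
      simp only [q]
      nlinarith
    exact this.ne'
  have hK : ∀ x ∈ {x : E4 | ‖x‖ < R⁻¹}, ∀ ζ ∈ tsupport g, ContDiffAt ℝ (⊤ : ℕ∞)
      (Function.uncurry K) (x, ζ) := fun x hx ζ hζ => by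
    have h1 : ContDiff ℝ (⊤ : ℕ∞) fun p : E4 × E3 => q p.1 p.2 := by
      simp only [q]
      exact (contDiff_const.sub (contDiff_const.mul (contDiff_fst.inner ℝ
        (flat.contDiff.comp contDiff_snd)))).add
        (((contDiff_norm_sq ℝ).comp contDiff_fst).mul ((contDiff_norm_sq ℝ).comp contDiff_snd))
    exact (h1.pow 2).contDiffAt.inv (pow_ne_zero 2 (hq x hx ζ hζ))
  refine ⟨R⁻¹, fun x => x 3 ^ 2 * (kerMass⁻¹ * ∫ ζ in tsupport g, g ζ • K x ζ), inv_pos.2 hR, ?_, ?_, ?_⟩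

  · intro x hx
    have hU : IsOpen {x : E4 | ‖x‖ < R⁻¹} := isOpen_lt continuous_norm continuous_const
    exact ((contDiff_coord 3).pow 2).contDiffAt.mul (contDiffAt_const.mul
      ((contDiffOn_integral_slice hU hc hg.continuousOn hK).contDiffAt (hU.mem_nhds hx)))
  · intro x hx
    simp only [hx]
    ring
  · intro x hx
    have hx0 : x ≠ 0 := ne_zero_of_pos hx
    have hn : ‖x‖ ^ 2 ≠ 0 := pow_ne_zero 2 (norm_ne_zero_iff.2 hx0)
    have hpos : 0 < inversion₀ x 3 := by
      rw [inversion₀_apply]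
      positivity
    have hker : ∀ ζ : E3, pd 3 kerK (inversion₀ x - flat ζ) = -2 * x 3 * ‖x‖ ^ 2 * K x ζ :=
      fun ζ => by
        have h1 : ‖inversion₀ x - flat ζ‖ ^ 2 = (‖x‖ ^ 2)⁻¹ * q x ζ := by
          rw [norm_sub_sq_real, norm_inversion₀, norm_flat, inversion₀, real_inner_smul_left]
          simp only [q]
          field_simp
        rw [pd_kerK 3 (sub_flat_ne_zero hpos ζ), h1, sub_flat_three, inversion₀_apply]
        simp only [K]
        rw [mul_inv, inv_inv, ← inv_pow]
        field_simp
    rw [halfU, potential_eq_setIntegral]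
    simp only [hker, smul_eq_mul]
    have h2 : ∀ ζ, g ζ * (-2 * x 3 * ‖x‖ ^ 2 * K x ζ) = (-2 * x 3 * ‖x‖ ^ 2) * (g ζ * K x ζ) :=
      fun ζ => by ring
    simp only [h2]
    rw [integral_const_mul, inversion₀_apply]
    field_simp

/-- Two functions continuous at a point of the hyperplane which agree above it agree there. -/
theorem eq_of_eq_upper {u v : E4 → ℝ} {y : E3} (hu : ContinuousAt u (flat y))
    (hv : ContinuousAt v (flat y)) (h : ∀ᶠ x in 𝓝[{x : E4 | 0 < x 3}] (flat y), u x = v x) :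
    u (flat y) = v (flat y) := by
  have hcl : flat y ∈ closure {x : E4 | 0 < x 3} := by
    have h1 : Filter.Tendsto (fun t : ℝ => flat y + t • e4 3) (𝓝[>] 0) (𝓝 (flat y)) := by
      have : Continuous fun t : ℝ => flat y + t • e4 3 := by fun_prop
      have h2 := this.tendsto 0
      rw [zero_smul, add_zero] at h2
      exact h2.mono_left nhdsWithin_le_nhds
    refine mem_closure_of_tendsto h1 ?_
    filter_upwards [self_mem_nhdsWithin] with t ht
    have : (flat y + t • e4 3) 3 = t := by
      rw [PiLp.add_apply, PiLp.smul_apply, flat_three, e4_apply]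
      simp
    change 0 < (flat y + t • e4 3) 3
    rw [this]
    exact ht
  have := mem_closure_iff_nhdsWithin_neBot.1 hcl
  exact tendsto_nhds_unique_of_eventuallyEq (hu.tendsto.mono_left nhdsWithin_le_nhds)
    (hv.tendsto.mono_left nhdsWithin_le_nhds) h

/-- The solution with prescribed normal derivative on the flat face, even under inversion. -/
theorem exists_inversion_invariant {φ : E3 → ℝ} (hφ : ContDiff ℝ (⊤ : ℕ∞) φ)
    (hφc : ∀ y : E3, ‖y‖ = 1 → fderiv ℝ φ y y = -φ y) :
    ∃ ω U : E4 → ℝ, ContDiff ℝ 3 ω ∧ (∀ x : E4, 0 < x 3 → ContDiffAt ℝ (⊤ : ℕ∞) U x) ∧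
      (∀ x : E4, 0 < x 3 → lap U x = 0) ∧ (∀ x : E4, 0 < x 3 → ω x = x 3 * U x) ∧
      (∀ x : E4, 0 < x 3 → ω (inversion₀ x) = ω x) ∧ (∀ x : E4, x 3 = 0 → ω x = 0) ∧
      ∀ y : E3, ‖y‖ ≤ 1 → pd 3 ω (flat y) = φ y := by
  obtain ⟨g, hgr, hgφ⟩ := exists_kelvin_split hφ hφc
  have hg : Continuous g := hgr.continuous
  have hgc : HasCompactSupport g := hgr.hasCompactSupport
  obtain ⟨W, hW, hWU, hW0, hWg⟩ := exists_halfspace_solution (m := 0) hgr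
  obtain ⟨ε, V, hε, hV, hV0, hVU⟩ := exists_smooth_inverted hg hgc
  have hk : ∀ x : E4, x ≠ 0 → ContDiffAt ℝ 3 (kelvin W) x :=
    fun x hx => contDiffAt_kelvin hx hW.contDiffAt
  have hpos : ∀ x : E4, 0 < x 3 → 0 < inversion₀ x 3 := fun x hx => by
    rw [inversion₀_apply]
    have := norm_pos_iff.2 (ne_zero_of_pos hx)
    positivity
  obtain ⟨ω, hω, hωs, hωt, hωe⟩ := exists_contDiff_glue (n := 3) (s := {x : E4 | ε ≤ ‖x‖}) (t := {0})
    (isClosed_le continuous_const continuous_norm) isClosed_singleton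
    (by simpa using hε) (f := fun x => W x + V x) (g := fun x => W x + ‖x‖ ^ 2 * kelvin W x)
    (fun x hx => hW.contDiffAt.add ((hV x (not_le.1 hx)).of_le ENat.LEInfty.out))
    (fun x hx => hW.contDiffAt.add ((contDiff_norm_sq ℝ).contDiffAt.mul (hk x hx)))
  have hKW : ∀ x : E4, x ≠ 0 → ‖x‖ ^ 2 * kelvin W x = W (inversion₀ x) := fun x hx => by
    rw [kelvin, ← mul_assoc, mul_inv_cancel₀ (pow_ne_zero 2 (norm_ne_zero_iff.2 hx)), one_mul]
  have hg' : ∀ x : E4, 0 ≤ x 3 → x ≠ 0 → ω x = W x + W (inversion₀ x) := fun x hx hx0 => by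
    by_cases hxs : ε ≤ ‖x‖
    · rw [(hωs x hxs).eq_of_nhds, hKW x hx0]
    · have hVW : V x = W (inversion₀ x) := by
        rcases hx.eq_or_lt with h | h
        · rw [hV0 x h.symm, hW0 _ (by rw [inversion₀_apply, ← h, mul_zero])]
        · rw [hVU x h, hWU _ (hpos x h)]
      rw [hωe x (by simp only [hVW, hKW x hx0]), hVW]
  have hpd : ∀ y : E3, y ≠ 0 → ‖y‖ ≤ 1 → pd 3 ω (flat y) = φ y := fun y hy hy1 => by
    have hf0 : flat y ≠ 0 := norm_ne_zero_iff.1 (by rw [norm_flat]; exact norm_ne_zero_iff.2 hy)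
    have hn : ‖flat y‖ ^ 2 ≠ 0 := pow_ne_zero 2 (norm_ne_zero_iff.2 hf0)
    have hG : ContDiffAt ℝ 3 (fun x => W x + ‖x‖ ^ 2 * kelvin W x) (flat y) :=
      hW.contDiffAt.add ((contDiff_norm_sq ℝ).contDiffAt.mul (hk _ hf0))
    have h1 : pd 3 (fun x => W x + ‖x‖ ^ 2 * kelvin W x) (flat y) = φ y := by
      rw [pd_add (hW.contDiffAt.diff (by norm_num))
        (((contDiff_norm_sq ℝ).contDiffAt.mul (hk _ hf0)).diff (by norm_num)),
        pd_mul ((contDiff_norm_sq ℝ (n := 1)).contDiffAt.diff le_rfl) ((hk _ hf0).diff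
        (by norm_num)), pd_norm_sq, pd_kelvin hf0 (hW.contDiffAt.diff (by norm_num)), flat_three,
        hWg, kelvin, inversion₀_flat, hWg, norm_flat, ← hgφ y hy hy1, kerK, norm_flat]
      simp only [kelvin]
      rw [norm_flat] at hn
      field_simp
      ring
    rw [← h1]
    refine eq_of_eq_upper ((hω.contDiffAt.pd (m := 0) (by norm_num) 3).continuousAt)
      ((hG.pd (m := 0) (by norm_num) 3).continuousAt) ?_
    filter_upwards [self_mem_nhdsWithin] with x hx
    refine (pd_congr ?_ 3).eq_of_nhds
    filter_upwards [isOpen_upper.mem_nhds hx] with z hz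
    rw [hg' z (le_of_lt hz) (ne_zero_of_pos hz), hKW z (ne_zero_of_pos hz)]
  refine ⟨ω, fun x => halfU g x + kelvin (halfU g) x, hω, fun x hx => ?_, fun x hx => ?_,
    fun x hx => ?_, fun x hx => ?_, fun x hx => ?_, fun y hy => ?_⟩
  · exact (contDiffAt_halfU hg hgc hx).add
      (contDiffAt_kelvin (ne_zero_of_pos hx) (contDiffAt_halfU hg hgc (hpos x hx)))
  · have hu := contDiffAt_halfU hg hgc (hpos x hx)
    rw [lap_add ((contDiffAt_halfU hg hgc hx).of_le ENat.LEInfty.out)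
      ((contDiffAt_kelvin (ne_zero_of_pos hx) hu).of_le ENat.LEInfty.out),
      lap_kelvin (ne_zero_of_pos hx) (hu.of_le ENat.LEInfty.out), kelvin,
      lap_halfU hg hgc hx, lap_halfU hg hgc (hpos x hx)]
    ring
  · rw [hg' x hx.le (ne_zero_of_pos hx), hWU x hx, hWU _ (hpos x hx), inversion₀_apply]
    simp only [kelvin]
    ring
  · rw [hg' _ (hpos x hx).le (ne_zero_of_pos (hpos x hx)), hg' x hx.le (ne_zero_of_pos hx),
      inversion₀_inversion₀, add_comm]
  · rcases eq_or_ne x 0 with rfl | hx0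
    · rw [(hωt 0 rfl).eq_of_nhds, hW0 0 hx, hV0 0 hx, add_zero]
    · rw [hg' x hx.ge hx0, hW0 x hx, hW0 _ (by rw [inversion₀_apply, hx, mul_zero]), add_zero]
  · rcases eq_or_ne y 0 with rfl | hy0
    · have h1 : Filter.Tendsto (fun y : E3 => pd 3 ω (flat y)) (𝓝[≠] 0) (𝓝 (pd 3 ω (flat 0))) :=
        ((hω.contDiffAt.pd (m := 0) (by norm_num) 3).continuousAt.comp
          flat.continuous.continuousAt).tendsto.mono_left nhdsWithin_le_nhds
      have h2 : Filter.Tendsto φ (𝓝[≠] 0) (𝓝 (φ 0)) :=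
        hφ.continuous.continuousAt.tendsto.mono_left nhdsWithin_le_nhds
      refine tendsto_nhds_unique_of_eventuallyEq h1 h2 ?_
      filter_upwards [self_mem_nhdsWithin, mem_nhdsWithin_of_mem_nhds
        (Metric.closedBall_mem_nhds (0 : E3) one_pos)] with z h3 h4
      exact hpd z h3 (by rwa [mem_closedBall_zero_iff] at h4)
    · exact hpd y hy0 hy

end

theorem eq_flat_horiz {x : E4} (hx : x 3 = 0) : x = flat (horiz x) := by
  conv_lhs => rw [← flat_horiz_add x, hx, zero_smul, add_zero]

theorem fderiv_of_eq_zero_on_hyperplane {u : E4 → ℝ} (hu : Differentiable ℝ u)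
    (h0 : ∀ x : E4, x 3 = 0 → u x = 0) {x : E4} (hx : x 3 = 0) (v : E4) :
    fderiv ℝ u x v = v 3 * pd 3 u x := by
  have h1 : (fun y : E3 => u (flat y)) = fun _ => 0 := funext fun y => h0 _ (flat_three y)
  have h2 : fderiv ℝ u x (flat (horiz v)) = 0 := by
    have h3 := ((hu (flat (horiz x))).hasFDerivAt.comp (horiz x) flat.hasFDerivAt).unique
      (by rw [show u ∘ flat = fun _ => 0 from h1]; exact hasFDerivAt_const 0 _)
    have h4 := congrArg (fun L : E3 →L[ℝ] ℝ => L (horiz v)) h3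
    rw [← eq_flat_horiz hx] at h4
    exact h4
  conv_lhs => rw [← flat_horiz_add v, map_add, h2, zero_add, map_smul, smul_eq_mul]
  rfl

/-- A biharmonic function with prescribed normal derivative on the flat face, whose other
boundary data vanish. -/
theorem exists_flat_solution {φ : E3 → ℝ} (hφ : ContDiff ℝ (⊤ : ℕ∞) φ)
    (hφc : ∀ y : E3, ‖y‖ = 1 → fderiv ℝ φ y y = -φ y) :
    ∃ ω : E4 → ℝ, ContDiff ℝ 3 ω ∧ (∀ x ∈ Bp, ContDiffAt ℝ 4 ω x ∧ lap (lap ω) x = 0) ∧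
      (∀ x ∈ Mhs \ Sig, P3M ω x = 0) ∧ (∀ x ∈ Nfb \ Sig, P3N ω x = 0) ∧
      (∀ x ∈ Sig, ω x = 0) ∧ (∀ x ∈ Mhs, muM ω x = 0) ∧
      ∀ y : E3, ‖y‖ ≤ 1 → muN ω (flat y) = φ y := by
  obtain ⟨ω, U, hω, hU, hUl, hωU, hωi, hω0, hωφ⟩ := exists_inversion_invariant hφ hφc
  have hup : ∀ {x : E4}, 0 < x 3 → ∀ᶠ y in 𝓝 x, 0 < y 3 := fun hx => isOpen_upper.mem_nhds hx
  have hU4 : ∀ x : E4, 0 < x 3 → ContDiffAt ℝ 4 U x := fun x hx =>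
    (hU x hx).of_le ENat.LEInfty.out
  have he : ∀ {x : E4}, 0 < x 3 → ω =ᶠ[𝓝 x] fun y => y 3 * U y := fun hx =>
    (hup hx).mono fun y hy => hωU y hy
  have hD : ∀ x : E4, ‖x‖ = 1 → 0 < x 3 → Dr ω x = 0 := fun x hx hx3 => by
    have hx0 := ne_zero_of_pos hx3
    have h1 : ω =ᶠ[𝓝 x] fun y => ‖y‖ ^ 2 * kelvin ω y := by
      filter_upwards [hup hx3] with y hy
      rw [kelvin, ← mul_assoc, mul_inv_cancel₀
        (pow_ne_zero 2 (norm_ne_zero_iff.2 (ne_zero_of_pos hy))), one_mul, hωi y hy]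
    have hk : ContDiffAt ℝ 3 (kelvin ω) x := contDiffAt_kelvin hx0 hω.contDiffAt
    have h2 : Dr (kelvin ω) x = -2 * kelvin ω x - kelvin (Dr ω) x :=
      fderiv_kelvin_self hx0 (hω.differentiable (by norm_num) _)
    have h3 := (Dr_congr h1).eq_of_nhds
    rw [Dr_mul ((contDiff_norm_sq ℝ (n := 1)).contDiffAt.diff le_rfl) (hk.diff (by norm_num)), h2,
      Dr_norm_sq, kelvin_of_norm_eq_one _ hx, kelvin_of_norm_eq_one _ hx, hx] at h3
    linarith
  have hmu : Continuous (muM ω) := by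
    rw [muM_eq]
    exact ((hω.continuous_fderiv (by norm_num)).clm_apply continuous_id).neg
  refine ⟨ω, hω, fun x hx => ⟨?_, ?_⟩, fun x hx => ?_, fun x hx => ?_, fun x hx => hω0 x hx.2,
    fun x hx => ?_, fun y hy => ?_⟩
  · exact ((contDiffAt_coord 3 x).mul (hU4 x hx.2)).congr_of_eventuallyEq (he hx.2)
  · exact biharmonic_coord_mul ((hup hx.2).mono fun y hy => ⟨hU4 y hy, hUl y hy⟩) (he hx.2)
  · obtain ⟨hx1, hx3⟩ := mem_Mhs_diff.1 hx
    rw [P3M_coord_mul_harmonic (e := fun _ => 0) hx1 (hU4 x hx3)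
      ((hup hx3).mono fun y hy => hUl y hy) (he hx3) contDiffAt_const ?_]
    · simp
    · filter_upwards [hup hx3] with y hy hy1
      have h1 := hD y hy1 hy
      rw [(Dr_congr (he hy)).eq_of_nhds, Dr_mul (differentiableAt_coord 3 y)
        ((hU4 y hy).diff (by norm_num)), Dr_coord] at h1
      have h2 : y 3 * (U y + Dr U y) = 0 := by linarith
      exact (mul_eq_zero.1 h2).resolve_left hy.ne'
  · exact P3N_coord_mul_harmonic hω (fun y hy => ⟨hU4 y hy.2, hUl y hy.2⟩)
      (fun y hy => hωU y hy.2) (fun y _ hy => hω0 y hy) hx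
  · refine continuous_eq_on_Mhs hmu.continuousOn continuousOn_const (fun y hy => ?_) hx
    obtain ⟨hy1, hy3⟩ := mem_Mhs_diff.1 hy
    rw [muM_eq]
    simp only [hD y hy1 hy3, neg_zero]
  · rw [muN_eq]
    exact hωφ y hy

/-- Reflection in the hyperplane. -/
def reflN (x : E4) : E4 := x - (2 * x 3) • e4 3

theorem reflN_apply (x : E4) (i : Fin 4) : reflN x i = if i = 3 then -x i else x i := by
  rw [reflN, PiLp.sub_apply, PiLp.smul_apply, e4_apply]
  split_ifs with h
  · subst h
    simp
    ring
  · simp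

theorem contDiff_reflN {n : WithTop ℕ∞} : ContDiff ℝ n reflN :=
  contDiff_id.sub ((contDiff_const.mul (contDiff_coord 3)).smul contDiff_const)

theorem reflN_of_flat {x : E4} (hx : x 3 = 0) : reflN x = x := by
  rw [reflN, hx]
  simp

theorem pd_comp_reflN {u : E4 → ℝ} {x : E4} (hu : DifferentiableAt ℝ u (reflN x)) (i : Fin 4) :
    pd i (fun y => u (reflN y)) x = (if i = 3 then -1 else 1) * pd i u (reflN x) := by
  have h : HasFDerivAt reflN (ContinuousLinearMap.id ℝ E4 -
      ((2 : ℝ) • (EuclideanSpace.proj 3 : E4 →L[ℝ] ℝ)).smulRight (e4 3)) x := by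
    have := (ContinuousLinearMap.id ℝ E4 -
      ((2 : ℝ) • (EuclideanSpace.proj 3 : E4 →L[ℝ] ℝ)).smulRight (e4 3)).hasFDerivAt (x := x)
    exact this
  change fderiv ℝ (u ∘ reflN) x (e4 i) = _
  rw [(hu.hasFDerivAt.comp x h).fderiv, ContinuousLinearMap.comp_apply]
  have : (ContinuousLinearMap.id ℝ E4 -
      ((2 : ℝ) • (EuclideanSpace.proj 3 : E4 →L[ℝ] ℝ)).smulRight (e4 3)) (e4 i) =
      (if i = 3 then (-1 : ℝ) else 1) • e4 i := by
    change e4 i - (2 * e4 i 3) • e4 3 = _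
    rw [e4_apply]
    split_ifs with h1 h2 h2
    · subst h1
      module
    · exact absurd h1.symm h2
    · exact absurd h2.symm h1
    · simp
  rw [this, map_smul, smul_eq_mul]
  rfl

theorem lap_comp_reflN {u : E4 → ℝ} {x : E4} (hu : ContDiffAt ℝ 2 u (reflN x)) :
    lap (fun y => u (reflN y)) x = lap u (reflN x) := by
  rw [lap_eq, lap_eq]
  refine Finset.sum_congr rfl fun i _ => ?_
  have h : pd i (fun y => u (reflN y)) =ᶠ[𝓝 x]
      fun y => (if i = 3 then -1 else 1) * pd i u (reflN y) := by
    filter_upwards [(contDiff_reflN (n := 1)).continuous.continuousAt.eventually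
      (hu.eventually (by simp))] with y hy
    exact pd_comp_reflN (hy.diff (by norm_num)) i
  rw [(pd_congr h i).eq_of_nhds, pd_const_mul,
    pd_comp_reflN ((hu.pd (m := 1) (by norm_num) i).diff le_rfl)]
  split_ifs <;> ring

theorem pd_three_eq_zero_of_even {u : E4 → ℝ} {x : E4} (hx : x 3 = 0)
    (hu : DifferentiableAt ℝ u x) (h : (fun y => u (reflN y)) =ᶠ[𝓝 x] u) : pd 3 u x = 0 := by
  have h1 := (pd_congr h 3).eq_of_nhds
  rw [pd_comp_reflN (by rwa [reflN_of_flat hx]), reflN_of_flat hx, if_pos rfl] at h1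
  linarith

/-- A function which is even near the open flat face satisfies the boundary condition there. -/
theorem P3N_eq_zero_of_even {u : E4 → ℝ} (hu : ContDiff ℝ 3 u)
    (h : ∀ x : E4, ‖x‖ < 1 → x 3 = 0 → (fun y => u (reflN y)) =ᶠ[𝓝 x] u) {x : E4}
    (hx : ‖x‖ < 1) (hx3 : x 3 = 0) : P3N u x = 0 := by
  have h1 : lap3 (muN u) x = 0 := by
    rw [muN_eq]
    exact lap3_eq_zero_of_flat (fun y hy hy3 => pd_three_eq_zero_of_even hy3
      (hu.differentiable (by norm_num) y) (h y hy hy3)) hx hx3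
  have h2 : pd 3 (lap u) x = 0 := by
    refine pd_three_eq_zero_of_even hx3
      ((hu.contDiffAt.lap (m := 1) (by norm_num)).diff le_rfl) ?_
    filter_upwards [(lap_congr (h x hx hx3))] with y hy
    rw [← hy, lap_comp_reflN (hu.contDiffAt.of_le (by norm_num))]
  rw [P3N, h1, muN_eq, h2]
  ring

/-! ### Solutions with prescribed normal derivative on the spherical face -/

theorem norm_sq_add_e4_three (x : E4) : ‖x + e4 3‖ ^ 2 = ‖x‖ ^ 2 + 2 * x 3 + 1 := by
  rw [norm_add_sq_real, inner_e4, norm_e4, one_pow]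

/-- The Möbius involution exchanging the unit ball and the half-space. -/
def cayley (x : E4) : E4 := -e4 3 + (2 : ℝ) • inversion₀ (x + e4 3)

theorem cayley_add_e4_three (x : E4) : cayley x + e4 3 = (2 : ℝ) • inversion₀ (x + e4 3) := by
  rw [cayley]
  abel

theorem cayley_three {x : E4} (hx : x + e4 3 ≠ 0) :
    cayley x 3 = rhoBar x * (2 * kerK (x + e4 3)) := by
  have h0 := pow_ne_zero 2 (norm_ne_zero_iff.2 hx)
  have h1 := norm_sq_add_e4_three x
  rw [cayley, PiLp.add_apply, PiLp.smul_apply, inversion₀, PiLp.smul_apply, PiLp.add_apply,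
    PiLp.neg_apply, e4_apply, kerK, rhoBar]
  simp only [if_true, smul_eq_mul]
  field_simp
  linear_combination -h1

theorem norm_sq_cayley {x : E4} (hx : x + e4 3 ≠ 0) :
    ‖cayley x‖ ^ 2 = 1 - 4 * (x 3 * kerK (x + e4 3)) := by
  have h0 := pow_ne_zero 2 (norm_ne_zero_iff.2 hx)
  have h2 := norm_sq_add_e4_three (cayley x)
  have h1 := norm_sq_add_e4_three x
  rw [cayley_add_e4_three, norm_smul, norm_inversion₀, cayley_three hx, Real.norm_eq_abs,
    abs_two, mul_pow, inv_pow] at h2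
  have h3 : ‖cayley x‖ ^ 2 = 2 ^ 2 * (‖x + e4 3‖ ^ 2)⁻¹ -
    2 * (rhoBar x * (2 * kerK (x + e4 3))) - 1 := by linarith
  rw [h3, kerK, rhoBar]
  field_simp
  linear_combination -2 * h1

theorem cayley_cayley {x : E4} (hx : x + e4 3 ≠ 0) : cayley (cayley x) = x := by
  have h0 := norm_ne_zero_iff.2 hx
  rw [cayley, cayley_add_e4_three, inversion₀, norm_smul, norm_inversion₀, inversion₀, smul_smul,
    smul_smul, smul_smul]
  have : 2 * ((‖(2 : ℝ)‖ * ‖x + e4 3‖⁻¹) ^ 2)⁻¹ * 2 * (‖x + e4 3‖ ^ 2)⁻¹ = 1 := by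
    rw [Real.norm_eq_abs, abs_two]
    field_simp
  rw [this, one_smul]
  abel

theorem reflN_norm_sq (x : E4) : ‖reflN x‖ ^ 2 = ‖x‖ ^ 2 := by
  rw [norm_sq_eq_sum, norm_sq_eq_sum]
  refine Finset.sum_congr rfl fun i _ => ?_
  rw [reflN_apply]
  split_ifs <;> ring

theorem cayley_reflN {x : E4} (hx : x + e4 3 ≠ 0) (hx' : reflN x + e4 3 ≠ 0) :
    cayley (reflN x) = inversion₀ (cayley x) := by
  have h0 := pow_ne_zero 2 (norm_ne_zero_iff.2 hx)
  have h0' := pow_ne_zero 2 (norm_ne_zero_iff.2 hx')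
  have h1 := norm_sq_add_e4_three x
  have h2 := norm_sq_add_e4_three (reflN x)
  rw [reflN_norm_sq, reflN_apply, if_pos rfl] at h2
  have h3 : ‖reflN x + e4 3‖ ^ 2 = ‖x + e4 3‖ ^ 2 - 4 * x 3 := by linarith
  rw [inversion₀, norm_sq_cayley hx, kerK, cayley, cayley, inversion₀, inversion₀, h3]
  rw [h3] at h0'
  have h4 : (1 - 4 * (x 3 * (‖x + e4 3‖ ^ 2)⁻¹)) ≠ 0 := by
    rw [show (1 - 4 * (x 3 * (‖x + e4 3‖ ^ 2)⁻¹)) =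
      (‖x + e4 3‖ ^ 2 - 4 * x 3) * (‖x + e4 3‖ ^ 2)⁻¹ by field_simp]
    exact mul_ne_zero h0' (inv_ne_zero h0)
  ext i
  simp only [PiLp.add_apply, PiLp.smul_apply, PiLp.neg_apply, reflN, PiLp.sub_apply, smul_eq_mul]
  rw [show (1 - 4 * (x 3 * (‖x + e4 3‖ ^ 2)⁻¹)) =
      (‖x + e4 3‖ ^ 2 - 4 * x 3) * (‖x + e4 3‖ ^ 2)⁻¹ by field_simp]
  generalize ‖x + e4 3‖ ^ 2 = s at *
  field_simp
  ring

theorem cayley_of_mem_Sig {x : E4} (hx : x ∈ Sig) : cayley x = x := by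
  have h : ‖x + e4 3‖ ^ 2 = 2 := by
    rw [norm_sq_add_e4_three, hx.1, hx.2]
    norm_num
  rw [cayley, inversion₀, h, smul_smul]
  norm_num

theorem contDiffAt_cayley {n : ℕ∞} {x : E4} (hx : x + e4 3 ≠ 0) : ContDiffAt ℝ n cayley x :=
  contDiffAt_const.add (ContDiffAt.const_smul (2 : ℝ) (ContDiffAt.comp (g := inversion₀) x
    (contDiffAt_inversion₀ hx) (contDiffAt_id.add contDiffAt_const)))

theorem cayley_flat (y : E3) :
    cayley (flat y) = -e4 3 + (2 * (1 + ‖y‖ ^ 2)⁻¹) • (flat y + e4 3) := by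
  rw [cayley, inversion₀, smul_smul, norm_sq_flat_add_e4_three]

theorem add_e4_three_ne_zero {x : E4} (hx : -1 < x 3) : x + e4 3 ≠ 0 := by
  intro h
  have := congrArg (fun y : E4 => y 3) h
  simp only [PiLp.add_apply, e4_apply, PiLp.zero_apply, if_true] at this
  linarith

theorem contDiff_cayley_flat_weight {ψ : E4 → ℝ} (hψ : ContDiff ℝ (⊤ : ℕ∞) ψ) :
    ContDiff ℝ (⊤ : ℕ∞) fun y : E3 => 2 * (1 + ‖y‖ ^ 2)⁻¹ * ψ (cayley (flat y)) := by
  refine contDiff_iff_contDiffAt.2 fun y => ?_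
  refine ContDiffAt.mul (contDiffAt_const.mul
    ((contDiffAt_const.add (contDiff_norm_sq ℝ).contDiffAt).inv (by positivity))) ?_
  exact hψ.contDiffAt.comp y
    ((contDiffAt_cayley (flat_add_e4_three_ne_zero y)).comp y flat.contDiff.contDiffAt)

theorem fderiv_cayley_flat_weight {ψ : E4 → ℝ} (hψ : ContDiff ℝ (⊤ : ℕ∞) ψ)
    (hc : ∀ p ∈ Sig, pd 3 ψ p = 0) {y : E3} (hy : ‖y‖ = 1) :
    fderiv ℝ (fun y : E3 => 2 * (1 + ‖y‖ ^ 2)⁻¹ * ψ (cayley (flat y))) y y =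
      -(2 * (1 + ‖y‖ ^ 2)⁻¹ * ψ (cayley (flat y))) := by
  have hp : flat y ∈ Sig := ⟨by rw [norm_flat, hy], flat_three y⟩
  have hφ : DifferentiableAt ℝ (fun y : E3 => 2 * (1 + ‖y‖ ^ 2)⁻¹ * ψ (cayley (flat y))) y :=
    (contDiff_cayley_flat_weight hψ).contDiffAt.differentiableAt (by simp)
  have hr : HasDerivAt (fun r : ℝ => r • y) y 1 := by
    simpa using (hasDerivAt_id (1 : ℝ)).smul_const y
  have h1 := HasFDerivAt.comp_hasDerivAt (f := fun r : ℝ => r • y) (1 : ℝ)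
    (by rw [one_smul]; exact hφ.hasFDerivAt) hr
  have hτ : HasDerivAt (fun r : ℝ => 2 * (1 + r ^ 2)⁻¹) (-1) 1 := by
    have := (((hasDerivAt_pow 2 (1 : ℝ)).const_add 1).fun_inv (by norm_num)).const_mul 2
    refine this.congr_deriv ?_
    norm_num
  have hrp : HasDerivAt (fun r : ℝ => r • flat y + e4 3) (flat y) 1 := by
    simpa using ((hasDerivAt_id (1 : ℝ)).smul_const (flat y)).add_const (e4 3)
  have hcv : HasDerivAt (fun r : ℝ => -e4 3 + (2 * (1 + r ^ 2)⁻¹) • (r • flat y + e4 3))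
      (-e4 3) 1 := by
    refine ((hτ.fun_smul hrp).const_add (-e4 3)).congr_deriv ?_
    norm_num
  have h2 := HasFDerivAt.comp_hasDerivAt
    (f := fun r : ℝ => -e4 3 + (2 * (1 + r ^ 2)⁻¹) • (r • flat y + e4 3)) (1 : ℝ)
    (l := ψ) (l' := fderiv ℝ ψ (flat y))
    (by
      have : -e4 3 + ((2 : ℝ) * (1 + 1 ^ 2)⁻¹) • ((1 : ℝ) • flat y + e4 3) = flat y := by
        norm_num
      rw [this]
      exact (hψ.differentiable (by simp) _).hasFDerivAt) hcv
  have h3 := hτ.fun_mul h2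
  have he : ((fun y : E3 => 2 * (1 + ‖y‖ ^ 2)⁻¹ * ψ (cayley (flat y))) ∘ fun r : ℝ => r • y) =
      fun r : ℝ => 2 * (1 + r ^ 2)⁻¹ *
        (ψ ∘ fun r : ℝ => -e4 3 + (2 * (1 + r ^ 2)⁻¹) • (r • flat y + e4 3)) r := by
    ext r
    have : ‖r • y‖ ^ 2 = r ^ 2 := by rw [norm_smul, hy, mul_one, Real.norm_eq_abs, sq_abs]
    simp only [Function.comp_apply]
    rw [cayley_flat, this, map_smul]
  rw [he] at h1
  have h4 := h1.unique h3
  have h5 : fderiv ℝ ψ (flat y) (e4 3) = 0 := hc _ hp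
  rw [h4, map_neg, h5, cayley_of_mem_Sig hp, hy]
  have h6 : -e4 3 + ((2 : ℝ) * (1 + 1 ^ 2)⁻¹) • ((1 : ℝ) • flat y + e4 3) = flat y := by
    norm_num
  simp only [Function.comp_apply]
  rw [h6]
  ring

theorem cayley_weight_of_mem_Mhs {ψ : E4 → ℝ} {x : E4} (hx : x ∈ Mhs) :
    flat (horiz (cayley x)) = cayley x ∧ ‖horiz (cayley x)‖ ≤ 1 ∧
      2 * (1 + ‖horiz (cayley x)‖ ^ 2)⁻¹ * ψ (cayley (flat (horiz (cayley x)))) *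
        (2 * kerK (x + e4 3)) = ψ x := by
  have hx0 : x + e4 3 ≠ 0 := add_e4_three_ne_zero (by linarith [hx.2])
  have hr : rhoBar x = 0 := by
    rw [rhoBar, hx.1]
    norm_num
  have h3 : cayley x 3 = 0 := by rw [cayley_three hx0, hr, zero_mul]
  have hf := (eq_flat_horiz h3).symm
  have hn : ‖horiz (cayley x)‖ ^ 2 = 1 - 4 * (x 3 * kerK (x + e4 3)) := by
    rw [← norm_flat, hf, norm_sq_cayley hx0]
  have hs := norm_sq_add_e4_three x
  rw [hx.1] at hs
  have hs0 : (1 + x 3) ≠ 0 := by linarith [hx.2]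
  have hk : kerK (x + e4 3) = (2 * (1 + x 3))⁻¹ := by
    rw [kerK, hs]
    ring_nf
  have hk0 : 0 ≤ x 3 * kerK (x + e4 3) := by
    rw [hk]
    have := hx.2
    positivity
  refine ⟨hf, ?_, ?_⟩
  · refine (sq_le_one_iff₀ (norm_nonneg _)).1 ?_
    rw [hn]
    linarith
  · rw [hf, cayley_cayley hx0, hn, hk]
    have h1 : 1 + (1 - 4 * (x 3 * (2 * (1 + x 3))⁻¹)) = 2 * (1 + x 3)⁻¹ := by
      field_simp
      ring
    rw [h1]
    field_simp

theorem exists_spherical_solution {ψ : E4 → ℝ} (hψ : ContDiff ℝ (⊤ : ℕ∞) ψ)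
    (hc : ∀ p ∈ Sig, pd 3 ψ p = 0) :
    ∃ F : E4 → ℝ, ContDiff ℝ 3 F ∧ (∀ x ∈ Bp, ContDiffAt ℝ 4 F x ∧ lap (lap F) x = 0) ∧
      (∀ x ∈ Mhs \ Sig, P3M F x = 0) ∧ (∀ x ∈ Nfb \ Sig, P3N F x = 0) ∧
      (∀ x ∈ Sig, F x = 0) ∧ (∀ x ∈ Mhs, muM F x = ψ x) ∧ ∀ x ∈ Nfb, muN F x = 0 := by
  obtain ⟨ω, U, hω, hU, hUl, hωU, hωi, hω0, hωφ⟩ := exists_inversion_invariant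
    (contDiff_cayley_flat_weight hψ) fun y hy => fderiv_cayley_flat_weight hψ hc hy
  have hopen : IsOpen {x : E4 | -1 < x 3} := isOpen_lt continuous_const (continuous_coord 3)
  have hne : ∀ {x : E4}, -1 < x 3 → x + e4 3 ≠ 0 := fun hx => add_e4_three_ne_zero hx
  have hsub : B4p ⊆ {x : E4 | -1 < x 3} := fun x hx => by
    have := hx.2
    change -1 < x 3
    linarith
  obtain ⟨F, hF, hFe⟩ := exists_contDiff_extension (n := 3) (f := ω ∘ cayley) hopen
    isCompact_B4p.isClosed hsub
    fun x hx => hω.contDiffAt.comp x (contDiffAt_cayley (n := 3) (hne hx))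
  have hF : ContDiff ℝ 3 F := hF
  have hFd : Differentiable ℝ F := hF.differentiable (by norm_num)
  have hFv : ∀ x ∈ B4p, F x = ω (cayley x) := fun x hx => (hFe x hx).eq_of_nhds
  have hrM : ∀ {x : E4}, ‖x‖ = 1 → rhoBar x = 0 := fun hx => by
    rw [rhoBar, hx]
    norm_num
  have hFM : ∀ x ∈ Mhs, F x = 0 := fun x hx => by
    have hx3 := hsub (Mhs_subset_B4p hx)
    rw [hFv x (Mhs_subset_B4p hx), hω0 _ (by rw [cayley_three (hne hx3), hrM hx.1, zero_mul])]
  have hrpos : ∀ {x : E4}, ‖x‖ < 1 → 0 < rhoBar x := fun {x} hx => by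
    have : ‖x‖ ^ 2 < 1 := (sq_lt_one_iff₀ (norm_nonneg x)).2 hx
    rw [rhoBar]
    linarith
  have hcpos : ∀ {x : E4}, ‖x‖ < 1 → -1 < x 3 → 0 < cayley x 3 := fun {x} hx hx3 => by
    have := hrpos hx
    have := norm_pos_iff.2 (hne hx3)
    rw [cayley_three (hne hx3), kerK]
    positivity
  -- the harmonic factor
  set H : E4 → ℝ := fun x =>
    2 * (fun z => kelvin (fun w => U (-e4 3 + (2 : ℝ) • w)) (e4 3 + (1 : ℝ) • z)) x with hHdef
  have hH : ∀ x ∈ Bp, ContDiffAt ℝ 4 H x ∧ lap H x = 0 := fun x hx => by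
    have hx3 := hsub (Bp_subset_B4p hx)
    have hz : e4 3 + (1 : ℝ) • x = x + e4 3 := by rw [one_smul, add_comm]
    have hz0 : e4 3 + (1 : ℝ) • x ≠ 0 := by
      rw [hz]
      exact hne hx3
    have hcz : -e4 3 + (2 : ℝ) • inversion₀ (e4 3 + (1 : ℝ) • x) = cayley x := by rw [hz, cayley]
    have hUc : ContDiffAt ℝ 4 U (-e4 3 + (2 : ℝ) • inversion₀ (e4 3 + (1 : ℝ) • x)) := by
      rw [hcz]
      exact (hU _ (hcpos hx.1 hx3)).of_le ENat.LEInfty.out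
    have haff : ContDiffAt ℝ 4 (fun w : E4 => U (-e4 3 + (2 : ℝ) • w))
        (inversion₀ (e4 3 + (1 : ℝ) • x)) :=
      ContDiffAt.comp (g := U) _ hUc (contDiffAt_const.add (contDiffAt_id.const_smul (2 : ℝ)))
    have hk := contDiffAt_kelvin hz0 haff
    refine ⟨contDiffAt_const.mul (ContDiffAt.comp
      (g := kelvin (fun w => U (-e4 3 + (2 : ℝ) • w))) (f := fun z : E4 => e4 3 + (1 : ℝ) • z) x hk
      (contDiffAt_const.add (contDiffAt_id.const_smul (1 : ℝ)))), ?_⟩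
    rw [hHdef, lap_const_mul, lap_comp_affine _ _ (hk.of_le (by norm_num)),
      lap_kelvin hz0 (haff.of_le (by norm_num)), kelvin,
      lap_comp_affine _ _ (hUc.of_le (by norm_num)), hcz, hUl _ (hcpos hx.1 hx3)]
    ring
  have hFH : ∀ x ∈ Bp, F x = rhoBar x * H x := fun x hx => by
    have hx3 := hsub (Bp_subset_B4p hx)
    have hz : e4 3 + (1 : ℝ) • x = x + e4 3 := by rw [one_smul, add_comm]
    rw [hFv x (Bp_subset_B4p hx), hωU _ (hcpos hx.1 hx3), cayley_three (hne hx3), hHdef]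
    simp only
    rw [hz, kelvin, ← cayley, kerK]
    ring
  have hev : ∀ x ∈ Bp, F =ᶠ[𝓝 x] fun y => rhoBar y * H y := fun x hx =>
    Filter.eventually_of_mem (isOpen_Bp.mem_nhds hx) hFH
  have heven : ∀ x : E4, ‖x‖ < 1 → x 3 = 0 → (fun y => F (reflN y)) =ᶠ[𝓝 x] F := by
    intro x hx hx3
    have hxB : x ∈ B4p := ⟨hx.le, hx3.ge⟩
    have hr : Filter.Tendsto reflN (𝓝 x) (𝓝 x) := by
      have := (contDiff_reflN (n := 0)).continuous.tendsto x
      rwa [reflN_of_flat hx3] at this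
    have h3 : ∀ᶠ y : E4 in 𝓝 x, -1 < y 3 := hopen.mem_nhds (hsub hxB)
    have h1 : ∀ᶠ y : E4 in 𝓝 x, ‖y‖ < 1 := (isOpen_lt continuous_norm continuous_const).mem_nhds hx
    filter_upwards [hFe x hxB, hr.eventually (hFe x hxB), h3, hr.eventually h3, h1]
      with y e1 e2 e3 e4 e5
    rw [e1, e2, Function.comp_apply, Function.comp_apply, cayley_reflN (hne e3) (hne e4),
      hωi _ (hcpos e5 e3)]
  have hmuN : Continuous (muN F) := by
    rw [muN_eq]
    exact (hF.continuous_fderiv (by norm_num)).clm_apply continuous_const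
  refine ⟨F, hF, fun x hx => ⟨?_, ?_⟩, fun x hx => P3M_rhoBar_mul_harmonic hF hH hFH hFM hx,
    fun x hx => ?_, fun x hx => hFM x ⟨hx.1, hx.2.ge⟩, fun x hx => ?_, fun x hx => ?_⟩
  · exact (contDiff_rhoBar.contDiffAt.mul (hH x hx).1).congr_of_eventuallyEq (hev x hx)
  · exact biharmonic_rhoBar_mul (Filter.eventually_of_mem (isOpen_Bp.mem_nhds hx) hH) (hev x hx)
  · obtain ⟨h1, h2⟩ := mem_Nfb_diff.1 hx
    exact P3N_eq_zero_of_even hF heven h1 h2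
  · have hxB := Mhs_subset_B4p hx
    have hx3 := hsub hxB
    obtain ⟨hf, hn, hw⟩ := cayley_weight_of_mem_Mhs (ψ := ψ) hx
    have hcd : DifferentiableAt ℝ cayley x :=
      (contDiffAt_cayley (n := 1) (hne hx3)).differentiableAt (by simp)
    have h3 : cayley x 3 = 0 := by rw [cayley_three (hne hx3), hrM hx.1, zero_mul]
    have hDF : Dr F x = fderiv ℝ cayley x x 3 * pd 3 ω (cayley x) := by
      rw [(Dr_congr (hFe x hxB)).eq_of_nhds, Dr, fderiv_comp x
        (hω.differentiable (by norm_num) _) hcd]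
      exact fderiv_of_eq_zero_on_hyperplane (hω.differentiable (by norm_num)) hω0 h3 _
    have hk : ContinuousAt (fun y : E4 => 2 * kerK (y + e4 3)) x := by
      refine ContinuousAt.mul continuousAt_const (ContinuousAt.inv₀ ?_ ?_)
      · fun_prop
      · exact pow_ne_zero 2 (norm_ne_zero_iff.2 (hne hx3))
    have hd : HasFDerivAt (fun y : E4 => cayley y 3)
        ((2 * kerK (x + e4 3)) • fderiv ℝ rhoBar x) x := by
      refine (hasFDerivAt_mul_of_eq_zero ((contDiff_rhoBar (n := 1)).contDiffAt.diff le_rfl) hk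
        (hrM hx.1)).congr_of_eventuallyEq ?_
      filter_upwards [hopen.mem_nhds hx3] with y hy
      exact cayley_three (hne hy)
    have hd2 : HasFDerivAt (fun y : E4 => cayley y 3)
        ((EuclideanSpace.proj 3 : E4 →L[ℝ] ℝ).comp (fderiv ℝ cayley x)) x :=
      (EuclideanSpace.proj 3 : E4 →L[ℝ] ℝ).hasFDerivAt.comp x hcd.hasFDerivAt
    have hd3 := congrArg (fun L : E4 →L[ℝ] ℝ => L x) (hd2.unique hd)
    have hd4 : fderiv ℝ cayley x x 3 = 2 * kerK (x + e4 3) * Dr rhoBar x := hd3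
    have h5 := hωφ _ hn
    rw [hf] at h5 hw
    rw [muM_eq]
    simp only
    rw [hDF, hd4, Dr_rhoBar, hx.1, h5, ← hw]
    ring
  · refine continuous_eq_on_Nfb hmuN.continuousOn continuousOn_const (fun y hy => ?_) hx
    obtain ⟨h1, h2⟩ := mem_Nfb_diff.1 hy
    rw [muN_eq]
    exact pd_three_eq_zero_of_even h2 (hFd y) (heven y h1 h2)

/-! ### Existence -/

theorem isClosed_Mhs : IsClosed Mhs :=
  (isClosed_eq continuous_norm continuous_const).inter
    (isClosed_le continuous_const (continuous_coord 3))

theorem isClosed_Nfb : IsClosed Nfb :=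
  (isClosed_le continuous_norm continuous_const).inter
    (isClosed_eq (continuous_coord 3) continuous_const)

theorem fderiv_eq_of_eq_on_curve {f g : E4 → ℝ} {γ : ℝ → E4} {a b : ℝ} (hab : a < b) {p v : E4}
    (hγ : HasDerivAt γ v b) (hp : γ b = p) (hf : DifferentiableAt ℝ f p)
    (hg : DifferentiableAt ℝ g p) (h : ∀ t ∈ Icc a b, f (γ t) = g (γ t)) :
    fderiv ℝ f p v = fderiv ℝ g p v := by
  subst hp
  have h1 := (hf.hasFDerivAt.comp_hasDerivAt b hγ).hasDerivWithinAt (s := Icc a b)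
  have h2 := (hg.hasFDerivAt.comp_hasDerivAt b hγ).hasDerivWithinAt (s := Icc a b)
  have hb : b ∈ Icc a b := right_mem_Icc.2 hab.le
  exact UniqueDiffWithinAt.eq_deriv _ (uniqueDiffOn_Icc hab b hb) h1
    (h2.congr (fun t ht => h t ht) (h b hb))

theorem pd_three_eq_of_eqOn_Mhs {f g : E4 → ℝ} {p : E4} (hp : p ∈ Sig)
    (hf : DifferentiableAt ℝ f p) (hg : DifferentiableAt ℝ g p) (h : ∀ x ∈ Mhs, f x = g x) :
    pd 3 f p = pd 3 g p := by
  have h1 : HasDerivAt (fun t : ℝ => Real.sin t • p + Real.cos t • e4 3) (-e4 3) (π / 2) := by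
    refine (((Real.hasDerivAt_sin (π / 2)).smul_const p).fun_add
      ((Real.hasDerivAt_cos (π / 2)).smul_const (e4 3))).congr_deriv ?_
    simp
  have h2 := fderiv_eq_of_eq_on_curve (a := 0) (by positivity) h1 (by simp) hf hg fun t ht => by
    refine h _ ⟨?_, ?_⟩
    · have h3 : ‖Real.sin t • p + Real.cos t • e4 3‖ ^ 2 = 1 := by
        rw [norm_add_sq_real, norm_smul, norm_smul, hp.1, norm_e4, inner_smul_left,
          inner_smul_right, inner_e4, hp.2, Real.norm_eq_abs, Real.norm_eq_abs, mul_one, mul_one,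
          sq_abs, sq_abs]
        linear_combination Real.sin_sq_add_cos_sq t
      exact (pow_eq_one_iff_of_nonneg (norm_nonneg _) two_ne_zero).1 h3
    · have h3 : (Real.sin t • p + Real.cos t • e4 3) 3 = Real.cos t := by
        rw [PiLp.add_apply, PiLp.smul_apply, PiLp.smul_apply, hp.2, e4_apply]
        simp
      rw [h3]
      exact Real.cos_nonneg_of_mem_Icc ⟨by linarith [ht.1, Real.pi_pos], ht.2⟩
  rw [map_neg, map_neg, neg_inj] at h2
  exact h2

theorem Dr_eq_of_eqOn_Nfb {f g : E4 → ℝ} {p : E4} (hp : p ∈ Sig)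
    (hf : DifferentiableAt ℝ f p) (hg : DifferentiableAt ℝ g p) (h : ∀ x ∈ Nfb, f x = g x) :
    Dr f p = Dr g p := by
  have h1 : HasDerivAt (fun r : ℝ => r • p) p 1 := by
    simpa using (hasDerivAt_id (1 : ℝ)).smul_const p
  refine fderiv_eq_of_eq_on_curve zero_lt_one h1 (one_smul _ _) hf hg fun t ht => h _ ⟨?_, ?_⟩
  · rw [norm_smul, hp.1, mul_one, Real.norm_of_nonneg ht.1]
    exact ht.2
  · rw [PiLp.smul_apply, hp.2, smul_zero]

theorem exists_solHB {ψ φ : E4 → ℝ}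
    (hψreg : ∃ U : Set E4, IsOpen U ∧ Mhs ⊆ U ∧ ContDiffOn ℝ (⊤ : ℕ∞) ψ U)
    (hφreg : ∃ U : Set E4, IsOpen U ∧ Nfb ⊆ U ∧ ContDiffOn ℝ (⊤ : ℕ∞) φ U)
    (hψc : ∀ p ∈ Sig, nuM ψ p = π / 4) (hφc : ∀ p ∈ Sig, nuN φ p - φ p = π / 4) :
    ∃ ω : E4 → ℝ, SolHB ψ φ ω := by
  obtain ⟨U, hU, hMU, hψU⟩ := hψreg
  obtain ⟨V, hV, hNV, hφV⟩ := hφreg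
  have hSM : Sig ⊆ Mhs := fun p hp => ⟨hp.1, hp.2.ge⟩
  have hSN : Sig ⊆ Nfb := fun p hp => ⟨hp.1.le, hp.2⟩
  obtain ⟨Ψ, hΨ, hΨe⟩ := exists_contDiff_extension (n := ⊤) hU isClosed_Mhs hMU fun x hx =>
    hψU.contDiffAt (hU.mem_nhds hx)
  obtain ⟨Φ, hΦ, hΦe⟩ := exists_contDiff_extension (n := ⊤) hV isClosed_Nfb hNV fun x hx =>
    hφV.contDiffAt (hV.mem_nhds hx)
  have hψd : ∀ p ∈ Sig, DifferentiableAt ℝ ψ p := fun p hp =>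
    (hψU.contDiffAt (hU.mem_nhds (hMU (hSM hp)))).differentiableAt (by simp)
  have hφd : ∀ p ∈ Sig, DifferentiableAt ℝ φ p := fun p hp =>
    (hφV.contDiffAt (hV.mem_nhds (hNV (hSN hp)))).differentiableAt (by simp)
  have hΨd : Differentiable ℝ Ψ := hΨ.differentiable (by simp)
  have hΦd : Differentiable ℝ Φ := hΦ.differentiable (by simp)
  obtain ⟨ω₀, h0, h0l, h0M, h0N, h0z, h0ψ, h0φ⟩ := exists_reference_solution
  have h03 : ContDiff ℝ 3 ω₀ := h0.of_le ENat.LEInfty.out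
  have hmuN0 : ContDiff ℝ (⊤ : ℕ∞) (muN ω₀) := by
    rw [muN_eq]
    exact contDiff_iff_contDiffAt.2 fun x => h0.contDiffAt.pd (by simp) 3
  have hmuM0 : ContDiff ℝ (⊤ : ℕ∞) (muM ω₀) := by
    rw [muM_eq]
    exact contDiff_iff_contDiffAt.2 fun x => (h0.contDiffAt.Dr (by simp)).neg
  have hmuN0d : Differentiable ℝ (muN ω₀) := hmuN0.differentiable (by simp)
  have hmuM0d : Differentiable ℝ (muM ω₀) := hmuM0.differentiable (by simp)
  obtain ⟨ωN, hN, hNl, hNM, hNN, hNz, hNψ, hNφ⟩ := exists_flat_solution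
    (φ := fun y => Φ (flat y) - muN ω₀ (flat y))
    ((hΦ.comp flat.contDiff).sub (hmuN0.comp flat.contDiff)) fun y hy => by
      have hp : flat y ∈ Sig := ⟨by rw [norm_flat, hy], flat_three y⟩
      have h1 := (((hΦd (flat y)).hasFDerivAt.comp y flat.hasFDerivAt).fun_sub
        ((hmuN0d (flat y)).hasFDerivAt.comp y flat.hasFDerivAt)).fderiv
      have h2 := congrArg (fun L : E3 →L[ℝ] ℝ => L y) h1
      have h3 : fderiv ℝ (fun y => Φ (flat y) - muN ω₀ (flat y)) y y =
        Dr Φ (flat y) - Dr (muN ω₀) (flat y) := h2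
      have h4 := hφc _ hp
      rw [nuN_eq_Dr (hφd _ hp), ← (Dr_congr (hΦe _ (hSN hp))).eq_of_nhds,
        ← (hΦe _ (hSN hp)).eq_of_nhds] at h4
      have h5 := h0φ _ hp
      rw [h3]
      linarith
  obtain ⟨ωM, hM, hMl, hMM, hMN, hMz, hMψ, hMφ⟩ := exists_spherical_solution
    (ψ := fun x => Ψ x - muM ω₀ x) (hΨ.sub hmuM0) fun p hp => by
      rw [pd_sub (hΨd p) (hmuM0d p), h0ψ p hp, (pd_congr (hΨe _ (hSM hp)) 3).eq_of_nhds,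
        ← nuM_eq_pd (hψd p hp), hψc p hp, sub_self]
  have hsum : ContDiff ℝ 3 fun y => ωN y + ωM y := hN.add hM
  have hd0 : Differentiable ℝ ω₀ := h0.differentiable (by simp)
  have hdN : Differentiable ℝ ωN := hN.differentiable (by norm_num)
  have hdM : Differentiable ℝ ωM := hM.differentiable (by norm_num)
  have hω : ContDiff ℝ 3 fun y => ω₀ y + (ωN y + ωM y) := h03.add hsum
  have hωd := hω.differentiable (by norm_num)
  have hmuM : ∀ x ∈ Mhs, muM (fun y => ω₀ y + (ωN y + ωM y)) x = ψ x := fun x hx => by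
    rw [muM_add (hd0 x) ((hdN x).fun_add (hdM x)), muM_add (hdN x) (hdM x), hNψ x hx, hMψ x hx,
      ← (hΨe x hx).eq_of_nhds]
    ring
  have hmuN : ∀ x ∈ Nfb, muN (fun y => ω₀ y + (ωN y + ωM y)) x = φ x := fun x hx => by
    have h1 := hNφ (horiz x) (by
      rw [← norm_flat, ← eq_flat_horiz hx.2]
      exact hx.1)
    have h2 := hMφ x hx
    rw [← eq_flat_horiz hx.2] at h1
    rw [← (hΦe x hx).eq_of_nhds]
    simp only [muN_eq] at h1 h2 ⊢
    rw [pd_add (hd0 x) ((hdN x).fun_add (hdM x)), pd_add (hdN x) (hdM x), h1, h2]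
    ring
  refine ⟨fun y => ω₀ y + (ωN y + ωM y), hω, fun x hx => ?_, ⟨0, fun p hp => ?_⟩,
    fun x hx hx3 => ?_, fun x hx => ?_, fun x hx => ?_, fun p hp => ?_, hmuM, hmuN⟩
  · exact ((h0.of_le ENat.LEInfty.out).contDiffAt.add
      ((hNl x hx).1.add (hMl x hx).1)).contDiffWithinAt
  · simp only
    rw [h0z p (hSN hp), hNz p hp, hMz p hp]
    norm_num
  · have hx' : x ∈ Bp := ⟨hx, hx3⟩
    have e1 : lap (fun y => ω₀ y + (ωN y + ωM y)) =ᶠ[𝓝 x]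
        fun y => lap ω₀ y + (lap ωN y + lap ωM y) := by
      filter_upwards with y
      rw [lap_add (h03.contDiffAt.of_le (by norm_num)) (hsum.contDiffAt.of_le (by norm_num)),
        lap_add (hN.contDiffAt.of_le (by norm_num)) (hM.contDiffAt.of_le (by norm_num))]
    have c0 : ContDiffAt ℝ 2 (lap ω₀) x :=
      (h0.of_le (m := 4) ENat.LEInfty.out).contDiffAt.lap (by norm_num)
    have cN : ContDiffAt ℝ 2 (lap ωN) x := (hNl x hx').1.lap (by norm_num)
    have cM : ContDiffAt ℝ 2 (lap ωM) x := (hMl x hx').1.lap (by norm_num)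
    rw [(lap_congr e1).eq_of_nhds, lap_add c0 (cN.add cM), lap_add cN cM, h0l x hx',
      (hNl x hx').2, (hMl x hx').2]
    norm_num
  · rw [P3M_add hx.1.1 h03.contDiffAt hsum.contDiffAt,
      P3M_add hx.1.1 hN.contDiffAt hM.contDiffAt, h0M x hx, hNM x hx, hMM x hx]
    norm_num
  · rw [P3N_add h03.contDiffAt hsum.contDiffAt,
      P3N_add hN.contDiffAt hM.contDiffAt, h0N x hx, hNN x hx, hMN x hx]
    norm_num
  · have dM : DifferentiableAt ℝ (muM fun y => ω₀ y + (ωN y + ωM y)) p := by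
      rw [muM_eq]
      exact ((hω.contDiffAt.Dr (m := 1) (by norm_num)).diff le_rfl).neg
    have dN : DifferentiableAt ℝ (muN fun y => ω₀ y + (ωN y + ωM y)) p := by
      rw [muN_eq]
      exact (hω.contDiffAt.pd (m := 1) (by norm_num) 3).diff le_rfl
    have h1 := hmuN p (hSN hp)
    rw [muN_eq] at h1
    have h2 := hφc p hp
    have h3 := hψc p hp
    rw [nuM_eq_pd (hψd p hp)] at h3
    rw [nuN_eq_Dr (hφd p hp)] at h2
    rw [nuM_eq_pd dM, nuN_eq_Dr dN, nuM_eq_pd (hωd p),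
      pd_three_eq_of_eqOn_Mhs hp dM (hψd p hp) hmuM, Dr_eq_of_eqOn_Nfb hp dN (hφd p hp) hmuN, h1,
      h3]
    linarith

/-- **Theorem A.** If `ψ` and `φ` (restrictions to `M`, `N` of smooth functions on open
neighborhoods) satisfy the corner compatibility conditions `ν_M ψ = π/4` and
`ν_N φ - φ = π/4` along `Σ`, then the boundary value problem has a solution `ω`, constant
along `Σ`, with the prescribed normal derivatives; with the normalization `ω|_Σ = 0` the
solution is unique (on the half-ball). -/
theorem stmt0 (ψ φ : E4 → ℝ)
    (hψreg : ∃ U : Set E4, IsOpen U ∧ Mhs ⊆ U ∧ ContDiffOn ℝ (⊤ : ℕ∞) ψ U)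
    (hφreg : ∃ U : Set E4, IsOpen U ∧ Nfb ⊆ U ∧ ContDiffOn ℝ (⊤ : ℕ∞) φ U)
    (hψc : ∀ p ∈ Sig, nuM ψ p = π/4)
    (hφc : ∀ p ∈ Sig, nuN φ p - φ p = π/4) :
    (∃ ω : E4 → ℝ, SolHB ψ φ ω) ∧
    (∀ ω₁ ω₂ : E4 → ℝ, SolHB ψ φ ω₁ → SolHB ψ φ ω₂ →
      (∀ p ∈ Sig, ω₁ p = 0) → (∀ p ∈ Sig, ω₂ p = 0) →
      Set.EqOn ω₁ ω₂ B4p) := by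
  exact ⟨exists_solHB hψreg hφreg hψc hφc, fun _ _ h₁ h₂ hs₁ hs₂ =>
    solHB_unique h₁ h₂ hs₁ hs₂⟩
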